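/- Let Q ⊂ ℝ² be a finite set, not all collinear, and let K be a triangulation of the convex polygon conv(Q) with vertex set Q (a set of 3-element affinely independent subsets of Q whose closed triangles cover conv(Q), any two distinct triangles meeting in a common edge, common vertex, or not at all, and every point of Q a vertex of some triangle). Let Δ assign to each edge of K a value in (0, π] and let Λ assign to each boundary vertex of K a value in (0, π]. Then there exist a finite set P ⊂ ℝ², a Delaunay triangulation D of P, and a bijection φ : Q → P such that {a,b,c} ∈ K if and only if {φ(a), φ(b), φ(c)} ∈ D, the dihedral angle of D at the edge {φ(a), φ(b)} equals Δ({a,b}) for every edge {a,b} of K, and the boundary angle of D at φ(q) (the sum of the angles at φ(q) of the triangles of D containing φ(q)) equals Λ(q) for every boundary vertex q of K, if and only if the following four conditions hold: (1) for every interior vertex q of K, Σ_{e : q ∈ e} (π − Δ(e)) = 2π; (2) for every boundary vertex q of K, Σ_{e : q ∈ e} (π − Δ(e)) + (π − Λ(q)) = 2π; (3) Σ over all boundary vertices q of (π − Λ(q)) equals 2π (equivalently, Σ over all edges of Δ(e) equals π·|K|); (4) for every nonempty proper subset S ⊊ K of triangles, Σ_{e ∈ E(S)} Δ(e) > π·|S|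 (this is the positive-excess condition, equivalent to the strict cutset inequalities of Theorem 5.1 by Theorems 4.3 and 4.9). -/

import Mathlib

noncomputable section
open Finset Real EuclideanGeometry

attribute [local instance] Classical.propDecidable

/-- The Euclidean plane. -/
abbrev Pt := EuclideanSpace ℝ (Fin 2)

/-- The (unsigned) angle at `p` subtended by the two endpoints of a two-element set `e`:
for `e = {a, b}` with `a ≠ b` this is `∠ a p b`. -/
def oppAngle (p : Pt) (e : Finset Pt) : ℝ :=
  (1 / 2) * ∑ a ∈ e, ∑ b ∈ e.erase a, EuclideanGeometry.angle a p b

/-- The set of edges (2-element subsets of triangles) of a set of triangles. -/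
def edgesOf (D : Finset (Finset Pt)) : Finset (Finset Pt) :=
  D.biUnion (fun t => Finset.powersetCard 2 t)

/-- The dihedral angle of an edge `e`: the sum, over the triangles of `D` containing `e`,
of the angle of the triangle at its vertex opposite to `e`. -/
def dihedral (D : Finset (Finset Pt)) (e : Finset Pt) : ℝ :=
  ∑ t ∈ D.filter (fun t => e ⊆ t), ∑ p ∈ t \ e, oppAngle p e

/-- The boundary angle at a vertex `p`: the sum of the angles at `p` of the triangles of
`D` containing `p`. -/
def bdryAngle (D : Finset (Finset Pt)) (p : Pt) : ℝ :=
  ∑ t ∈ D.filter (fun t => p ∈ t), oppAngle p (t.erase p)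

/-- `D` is a triangulation of the convex hull of `P` with vertex set `P`: a finite set of
3-element affinely independent subsets of `P` whose closed triangles cover `conv(P)`,
any two distinct triangles meeting in a common edge, a common vertex, or not at all,
and every point of `P` a vertex of some triangle. -/
structure IsTriangulationOf (D : Finset (Finset Pt)) (P : Finset Pt) : Prop where
  card3 : ∀ t ∈ D, t.card = 3
  subset : ∀ t ∈ D, t ⊆ P
  indep : ∀ t ∈ D, AffineIndependent ℝ (fun p : (t : Finset Pt) => (p : Pt))
  cover : (⋃ t ∈ D, convexHull ℝ (t : Set Pt)) = convexHull ℝ (P : Set Pt)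
  inter : ∀ t ∈ D, ∀ t' ∈ D, t ≠ t' →
    convexHull ℝ (t : Set Pt) ∩ convexHull ℝ (t' : Set Pt)
      = convexHull ℝ ((t ∩ t' : Finset Pt) : Set Pt)
  vertex : ∀ p ∈ P, ∃ t ∈ D, p ∈ t

/-- The empty-circumdisk condition: for every triangle `t ∈ D`, the open circumscribed
disk of `t` contains no point of `P` (stated via circumcenters: any point equidistant
from the vertices of `t` at distance `r` is at distance at least `r` from every point
of `P`). -/
def EmptyCircumdisk (D : Finset (Finset Pt)) (P : Finset Pt) : Prop :=
  ∀ t ∈ D, ∀ z : Pt, ∀ r : ℝ, (∀ q ∈ t, dist z q = r) → ∀ p ∈ P, r ≤ dist z p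

/-- `D` is a Delaunay triangulation of `P`. -/
def IsDelaunay (D : Finset (Finset Pt)) (P : Finset Pt) : Prop :=
  IsTriangulationOf D P ∧ EmptyCircumdisk D P

section

/-- Twice the signed area of the triangle `v a b`. -/
def ori (v a b : Pt) : ℝ := (a 0 - v 0) * (b 1 - v 1) - (a 1 - v 1) * (b 0 - v 0)

lemma ori_rot (v a b : Pt) : ori a b v = ori v a b := by simp only [ori]; ring

lemma ori_swap (v a b : Pt) : ori v b a = -ori v a b := by simp only [ori]; ring

lemma ori_self_left (v b : Pt) : ori v v b = 0 := by simp only [ori]; ring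

lemma ori_self_right (v a : Pt) : ori v a a = 0 := by simp only [ori]; ring

lemma ori_self_outer (v a : Pt) : ori v a v = 0 := by simp only [ori]; ring

lemma ori_split (v a b x : Pt) : ori x a b + ori v x b + ori v a x = ori v a b := by
  simp only [ori]; ring

lemma ori_combo (v a x y : Pt) {s t : ℝ} (h : s + t = 1) :
    ori v a (s • x + t • y) = s * ori v a x + t * ori v a y := by
  obtain rfl : t = 1 - s := by linarith
  simp only [ori, PiLp.add_apply, PiLp.smul_apply, smul_eq_mul]; ring

lemma ori_continuous (v a : Pt) : Continuous fun x => ori v a x := by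
  unfold ori; fun_prop

lemma convex_ori_nonneg (v a : Pt) : Convex ℝ {x | 0 ≤ ori v a x} := by
  intro x hx y hy s t hs ht hst
  simp only [Set.mem_ofPred_eq] at *
  rw [ori_combo v a x y hst]; positivity

lemma ori_hull {v a : Pt} {s : Set Pt} (h : ∀ q ∈ s, 0 ≤ ori v a q) {x : Pt}
    (hx : x ∈ convexHull ℝ s) : 0 ≤ ori v a x :=
  convexHull_min (s := s) (t := {x | 0 ≤ ori v a x}) h (convex_ori_nonneg v a) hx

lemma mem_triangle_iff {v a b : Pt} (h : 0 < ori v a b) (x : Pt) :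
    x ∈ convexHull ℝ ({v, a, b} : Set Pt) ↔
      0 ≤ ori x a b ∧ 0 ≤ ori v x b ∧ 0 ≤ ori v a x := by
  constructor
  · intro hx
    refine ⟨?_, ?_, ?_⟩
    · rw [← ori_rot]
      refine ori_hull ?_ hx
      rintro q (rfl | rfl | rfl)
      · rw [ori_rot]; exact h.le
      · rw [ori_self_outer]
      · rw [ori_self_right]
    · rw [← ori_rot, ← ori_rot]
      refine ori_hull ?_ hx
      rintro q (rfl | rfl | rfl)
      · rw [ori_self_right]
      · rw [ori_rot, ori_rot]; exact h.le
      · rw [ori_self_outer]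
    · refine ori_hull ?_ hx
      rintro q (rfl | rfl | rfl)
      · rw [ori_self_outer]
      · rw [ori_self_right]
      · exact h.le
  · rintro ⟨h1, h2, h3⟩
    have hx : x = ∑ i : Fin 3, (![ori x a b / ori v a b, ori v x b / ori v a b,
        ori v a x / ori v a b] i) • (![v, a, b] i) := by
      have h' := h.ne'
      ext i
      simp only [Fin.sum_univ_three, Matrix.cons_val_zero, Matrix.cons_val_one,
        Matrix.cons_val_two, Matrix.head_cons, Matrix.tail_cons,
        PiLp.add_apply, PiLp.smul_apply, smul_eq_mul]
      have key : ori v a b * x i = ori x a b * v i + ori v x b * a i + ori v a x * b i := by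
        fin_cases i <;> simp [ori] <;> ring
      field_simp
      linarith
    rw [hx]
    refine (convex_convexHull ℝ _).sum_mem ?_ ?_ ?_
    · intro i _; fin_cases i <;> simp <;> positivity
    · simp only [Fin.sum_univ_three, Matrix.cons_val_zero, Matrix.cons_val_one,
        Matrix.cons_val]
      rw [← add_div, ← add_div, ori_split, div_self h.ne']
    · intro i _
      apply subset_convexHull
      fin_cases i <;> simp

/-- The identification of the plane with the complex numbers. -/
def toC (p : Pt) : ℂ := ⟨p 0, p 1⟩

/-- The inverse of `toC`. -/
def ofC (z : ℂ) : Pt := !₂[z.re, z.im]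

lemma toC_ofC (z : ℂ) : toC (ofC z) = z := by
  apply Complex.ext <;> simp [toC, ofC]

lemma ori_eq_im (v a b : Pt) :
    ori v a b = ((starRingEnd ℂ) (toC a - toC v) * (toC b - toC v)).im := by
  simp [ori, toC]; ring

lemma toC_injective : Function.Injective toC := by
  intro p q h
  have h0 := congrArg Complex.re h
  have h1 := congrArg Complex.im h
  simp only [toC] at h0 h1
  ext i; fin_cases i <;> simpa

lemma inner_toC (p q : Pt) : inner ℝ (toC p) (toC q) = inner ℝ p q := by
  simp [toC, Complex.inner, PiLp.inner_apply, Fin.sum_univ_two]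

lemma norm_toC (p : Pt) : ‖toC p‖ = ‖p‖ := by
  rw [norm_eq_sqrt_real_inner, norm_eq_sqrt_real_inner, inner_toC]

lemma toC_sub (p q : Pt) : toC (p - q) = toC p - toC q := by
  apply Complex.ext <;> simp [toC]

/-- The signed angle at `v` from `a` to `b`, with values in `(-π, π]`. -/
def sang (v a b : Pt) : ℝ := Complex.arg ((toC b - toC v) / (toC a - toC v))

lemma im_div_eq (z w : ℂ) :
    (w / z).im = ((starRingEnd ℂ) z * w).im / Complex.normSq z := by
  rw [div_eq_mul_inv, Complex.inv_def, ← mul_assoc, mul_comm w]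
  rw [Complex.im_mul_ofReal, div_eq_mul_inv]

lemma ne_of_ori {v a b : Pt} (h : 0 < ori v a b) : a ≠ v ∧ b ≠ v ∧ a ≠ b := by
  refine ⟨?_, ?_, ?_⟩ <;> rintro rfl
  · rw [ori_self_left] at h; exact h.false
  · rw [ori_self_outer] at h; exact h.false
  · rw [ori_self_right] at h; exact h.false

lemma arg_pos_iff {z : ℂ} (h : z.im ≠ 0) : 0 < z.arg ↔ 0 < z.im := by
  constructor
  · intro h1
    exact lt_of_le_of_ne (Complex.arg_nonneg_iff.1 h1.le) (Ne.symm h)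
  · intro h1
    refine lt_of_le_of_ne (Complex.arg_nonneg_iff.2 h1.le) ?_
    intro h2
    rw [eq_comm, Complex.arg_eq_zero_iff] at h2
    exact h h2.2

lemma arg_lt_pi_of_im {z : ℂ} (h : z.im ≠ 0) : z.arg < π :=
  lt_of_le_of_ne (Complex.arg_le_pi z) fun h2 => h (Complex.arg_eq_pi_iff.1 h2).2

lemma sang_pos {v a b : Pt} (h : 0 < ori v a b) : 0 < sang v a b ∧ sang v a b < π := by
  have hne := ne_of_ori h
  have h1 : 0 < ((toC b - toC v) / (toC a - toC v)).im := by
    rw [im_div_eq, ← ori_eq_im]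
    apply div_pos h
    rw [Complex.normSq_pos, sub_ne_zero]
    exact fun h => hne.1 (toC_injective h)
  exact ⟨(arg_pos_iff h1.ne').2 h1, arg_lt_pi_of_im h1.ne'⟩

lemma angle_eq_abs_sang {v a b : Pt} (ha : a ≠ v) (hb : b ≠ v) :
    EuclideanGeometry.angle a v b = |sang v a b| := by
  have e : EuclideanGeometry.angle a v b
      = InnerProductGeometry.angle (toC b - toC v) (toC a - toC v) := by
    rw [InnerProductGeometry.angle_comm, ← toC_sub, ← toC_sub]
    simp only [EuclideanGeometry.angle, InnerProductGeometry.angle, inner_toC, norm_toC,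
      vsub_eq_sub]
  rw [e, Complex.angle_eq_abs_arg]
  · rfl
  · exact sub_ne_zero.2 fun h => hb (toC_injective h)
  · exact sub_ne_zero.2 fun h => ha (toC_injective h)

lemma angle_eq_sang {v a b : Pt} (h : 0 < ori v a b) :
    EuclideanGeometry.angle a v b = sang v a b := by
  have hne := ne_of_ori h
  rw [angle_eq_abs_sang hne.1 hne.2.1, abs_of_pos (sang_pos h).1]

/-- Turning from `a` to `b` about the origin, seen from the branch cut opposite to `d`. -/
lemma arg_div_sub_arg_div {a b d : ℂ} (hab : 0 < ((starRingEnd ℂ) a * b).im)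
    (ha : ((starRingEnd ℂ) d * a).im ≠ 0) (hb : ((starRingEnd ℂ) d * b).im ≠ 0) :
    (b / d).arg - (a / d).arg = (b / a).arg -
      2 * π * (if 0 < ((starRingEnd ℂ) d * a).im ∧ ((starRingEnd ℂ) d * b).im < 0
        then 1 else 0) := by
  have ha0 : a ≠ 0 := by rintro rfl; simp at hab
  have hb0 : b ≠ 0 := by rintro rfl; simp at hab
  have hd0 : d ≠ 0 := by rintro rfl; simp at ha
  have nd : 0 < Complex.normSq d := Complex.normSq_pos.2 hd0
  have na : 0 < Complex.normSq a := Complex.normSq_pos.2 ha0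
  have h1 : 0 < (b / a).im := by rw [im_div_eq]; positivity
  have e2 : (a / d).im = ((starRingEnd ℂ) d * a).im / Complex.normSq d := im_div_eq d a
  have e3 : (b / d).im = ((starRingEnd ℂ) d * b).im / Complex.normSq d := im_div_eq d b
  have h2 : (a / d).im ≠ 0 := by rw [e2]; exact div_ne_zero ha nd.ne'
  have h3 : (b / d).im ≠ 0 := by rw [e3]; exact div_ne_zero hb nd.ne'
  have c1 : 0 < ((starRingEnd ℂ) d * a).im ↔ 0 < (a / d).arg := by
    rw [arg_pos_iff h2, e2, div_pos_iff_of_pos_right nd]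
  have c2 : 0 < ((starRingEnd ℂ) d * b).im ↔ 0 < (b / d).arg := by
    rw [arg_pos_iff h3, e3, div_pos_iff_of_pos_right nd]
  have hcong : (((b / d).arg - (a / d).arg - (b / a).arg : ℝ) : Real.Angle) = 0 := by
    have : b / d = (b / a) * (a / d) := by field_simp
    have h4 := Complex.arg_mul_coe_angle (div_ne_zero hb0 ha0) (div_ne_zero ha0 hd0)
    rw [← this] at h4
    rw [Real.Angle.coe_sub, Real.Angle.coe_sub, h4]
    abel
  obtain ⟨n, hn⟩ := Real.Angle.coe_eq_zero_iff.1 hcong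
  have p1 := (arg_pos_iff h1.ne').2 h1
  have p2 := arg_lt_pi_of_im h1.ne'
  have p3 := arg_lt_pi_of_im h2
  have p4 := arg_lt_pi_of_im h3
  have p5 := Complex.neg_pi_lt_arg (a / d)
  have p6 := Complex.neg_pi_lt_arg (b / d)
  have hpi := Real.pi_pos
  rw [zsmul_eq_mul] at hn
  have n1 : (n : ℝ) < 1 := by nlinarith
  have n2 : (-2 : ℝ) < n := by nlinarith
  have n1' : n < 1 := by exact_mod_cast n1
  have n2' : -2 < n := by exact_mod_cast n2
  have hb' : ((starRingEnd ℂ) d * b).im < 0 ↔ (b / d).arg < 0 := by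
    rw [← not_iff_not, not_lt, not_lt]
    constructor
    · intro h; exact (c2.1 (lt_of_le_of_ne h hb.symm)).le
    · intro h
      refine (c2.2 (lt_of_le_of_ne h ?_)).le
      intro h0
      rw [eq_comm, Complex.arg_eq_zero_iff] at h0
      exact h3 h0.2
  obtain rfl | rfl : n = 0 ∨ n = -1 := by omega
  · rw [if_neg]
    · push_cast at hn; linarith
    · rintro ⟨h5, h6⟩; rw [c1] at h5; rw [hb'] at h6; push_cast at hn; linarith
  · rw [if_pos]
    · push_cast at hn; linarith
    · push_cast at hn
      rw [c1, hb']
      constructor <;> linarith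

end

section

/-- The cross product of two complex numbers. -/
def cr (d z : ℂ) : ℝ := ((starRingEnd ℂ) d * z).im

lemma cr_eq (d z : ℂ) : cr d z = d.re * z.im - d.im * z.re := by
  simp [cr]; ring

lemma cr_neg_left (d z : ℂ) : cr (-d) z = -cr d z := by simp [cr_eq]; ring

/-- The vector from `p v` to `p a`. -/
def vec (p : Pt → Pt) (v a : Pt) : ℂ := toC (p a) - toC (p v)

lemma ori_eq_cr (p : Pt → Pt) (v a b : Pt) :
    ori (p v) (p a) (p b) = cr (vec p v a) (vec p v b) := ori_eq_im _ _ _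

/-- The line through `p x.1` in direction `d` leaves the angle of the triangle `x` at its first
vertex through the ray in direction `-d`. -/
def Separates (p : Pt → Pt) (d : ℂ) (x : Pt × Pt × Pt) : Prop :=
  0 < cr d (vec p x.1 x.2.1) ∧ cr d (vec p x.1 x.2.2) < 0

/-- The number of triangles of `T` whose angle at the first vertex contains `-d`. -/
def sepCount (T : Finset (Pt × Pt × Pt)) (p : Pt → Pt) (d : ℂ) : ℕ := (T.filter (Separates p d)).card

/-- The direction `d` is not parallel to the edges of the triangles in `T` at their first vertex. -/
def Transverse (T : Finset (Pt × Pt × Pt)) (p : Pt → Pt) (d : ℂ) : Prop :=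
  ∀ x ∈ T, cr d (vec p x.1 x.2.1) ≠ 0 ∧ cr d (vec p x.1 x.2.2) ≠ 0

lemma Transverse.neg {T : Finset (Pt × Pt × Pt)} {p : Pt → Pt} {d : ℂ} (h : Transverse T p d) :
    Transverse T p (-d) := by
  intro x hx
  simpa [cr_neg_left] using h x hx

lemma Transverse.mono {S T : Finset (Pt × Pt × Pt)} {p : Pt → Pt} {d : ℂ} (h : Transverse T p d)
    (hS : S ⊆ T) : Transverse S p d := fun x hx => h x (hS hx)

/-- The triangles with first vertex `v`. -/
def fan (O : Finset (Pt × Pt × Pt)) (v : Pt) : Finset (Pt × Pt × Pt) := O.filter (fun x => x.1 = v)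

/-- The second vertices of a set of ordered triangles. -/
def firsts (T : Finset (Pt × Pt × Pt)) : Finset Pt := T.image (fun x => x.2.1)

/-- The third vertices of a set of ordered triangles. -/
def seconds (T : Finset (Pt × Pt × Pt)) : Finset Pt := T.image (fun x => x.2.2)

/-- `T` is part of the fan of triangles around `v`. -/
structure IsFan (T : Finset (Pt × Pt × Pt)) (v : Pt) : Prop where
  fst : ∀ x ∈ T, x.1 = v
  inj₁ : ∀ x ∈ T, ∀ y ∈ T, x.2.1 = y.2.1 → x = y
  inj₂ : ∀ x ∈ T, ∀ y ∈ T, x.2.2 = y.2.2 → x = y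

lemma IsFan.mono {S T : Finset (Pt × Pt × Pt)} {v : Pt} (h : IsFan T v) (hS : S ⊆ T) :
    IsFan S v :=
  ⟨fun x hx => h.fst x (hS hx), fun x hx y hy => h.inj₁ x (hS hx) y (hS hy),
    fun x hx y hy => h.inj₂ x (hS hx) y (hS hy)⟩

lemma IsFan.card_sdiff {T : Finset (Pt × Pt × Pt)} {v : Pt} (h : IsFan T v) :
    (seconds T \ firsts T).card = (firsts T \ seconds T).card := by
  apply Finset.card_sdiff_comm
  rw [seconds, firsts, Finset.card_image_of_injOn, Finset.card_image_of_injOn]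
  · exact fun x hx y hy => h.inj₁ x hx y hy
  · exact fun x hx y hy => h.inj₂ x hx y hy

lemma IsFan.sum_sub {T : Finset (Pt × Pt × Pt)} {v : Pt} (h : IsFan T v) (F : Pt → ℝ) :
    ∑ x ∈ T, (F x.2.2 - F x.2.1) =
      ∑ b ∈ seconds T \ firsts T, F b - ∑ a ∈ firsts T \ seconds T, F a := by
  have h1 : ∑ x ∈ T, F x.2.1 = ∑ a ∈ firsts T, F a := by
    rw [firsts, Finset.sum_image fun x hx y hy => h.inj₁ x hx y hy]
  have h2 : ∑ x ∈ T, F x.2.2 = ∑ a ∈ seconds T, F a := by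
    rw [seconds, Finset.sum_image fun x hx y hy => h.inj₂ x hx y hy]
  rw [Finset.sum_sub_distrib, h1, h2, Finset.sum_sdiff_sub_sum_sdiff]

/-- The sum of the angles of a set of ordered triangles at their first vertices. -/
def angSum (T : Finset (Pt × Pt × Pt)) (p : Pt → Pt) : ℝ :=
  ∑ x ∈ T, sang (p x.1) (p x.2.1) (p x.2.2)

/-- All triangles in `T` are positively oriented by `p`. -/
def Pos (T : Finset (Pt × Pt × Pt)) (p : Pt → Pt) : Prop :=
  ∀ x ∈ T, 0 < ori (p x.1) (p x.2.1) (p x.2.2)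

lemma angSum_pos {T : Finset (Pt × Pt × Pt)} {p : Pt → Pt} (hp : Pos T p) (hT : T.Nonempty) :
    0 < angSum T p := Finset.sum_pos (fun x hx => (sang_pos (hp x hx)).1) hT

lemma IsFan.telescope {T : Finset (Pt × Pt × Pt)} {v : Pt} (h : IsFan T v) {p : Pt → Pt}
    (hp : Pos T p) {d : ℂ} (hd : Transverse T p d) :
    ∑ b ∈ seconds T \ firsts T, (vec p v b / d).arg - ∑ a ∈ firsts T \ seconds T, (vec p v a / d).arg
      = angSum T p - 2 * π * sepCount T p d := by
  rw [← h.sum_sub, angSum, sepCount, Finset.card_eq_sum_ones, Finset.sum_filter]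
  push_cast
  rw [Finset.mul_sum, ← Finset.sum_sub_distrib]
  refine Finset.sum_congr rfl fun x hx => ?_
  have h1 := hp x hx
  rw [ori_eq_cr] at h1
  have := arg_div_sub_arg_div h1 (hd x hx).1 (hd x hx).2
  rw [← h.fst x hx, this]
  congr 2
  exact if_congr Iff.rfl rfl rfl

/-- In a closed fan every transverse direction is covered equally often. -/
lemma IsFan.angSum_closed {T : Finset (Pt × Pt × Pt)} {v : Pt} (h : IsFan T v) {p : Pt → Pt}
    (hp : Pos T p) {d : ℂ} (hd : Transverse T p d) (hc : firsts T ⊆ seconds T) :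
    angSum T p = 2 * π * sepCount T p d := by
  have h1 := h.telescope hp hd
  have h2 : firsts T \ seconds T = ∅ := Finset.sdiff_eq_empty_iff_subset.2 hc
  have h3 : seconds T \ firsts T = ∅ := by
    rw [← Finset.card_eq_zero, h.card_sdiff, h2, Finset.card_empty]
  rw [h2, h3] at h1
  simp at h1
  linarith

lemma arg_div_cases {z d : ℂ} (h : cr d z ≠ 0) :
    (0 < cr d z ∧ 0 < (z / d).arg ∧ (z / d).arg < π) ∨
      (cr d z < 0 ∧ -π < (z / d).arg ∧ (z / d).arg < 0) := by
  have hd0 : d ≠ 0 := by rintro rfl; simp [cr] at h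
  have nd : 0 < Complex.normSq d := Complex.normSq_pos.2 hd0
  have e : (z / d).im = cr d z / Complex.normSq d := im_div_eq d z
  have h1 : (z / d).im ≠ 0 := by rw [e]; exact div_ne_zero h nd.ne'
  rcases lt_or_gt_of_ne h with h2 | h2
  · right
    refine ⟨h2, Complex.neg_pi_lt_arg _, ?_⟩
    apply Complex.arg_neg_iff.2
    rw [e]; exact div_neg_of_neg_of_pos h2 nd
  · left
    refine ⟨h2, (arg_pos_iff h1).2 ?_, arg_lt_pi_of_im h1⟩
    rw [e]; exact div_pos h2 nd

section openFan

variable {T : Finset (Pt × Pt × Pt)} {v a b : Pt} {p : Pt → Pt} {d : ℂ}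

lemma IsFan.transverse_ends (hd : Transverse T p d) (h : IsFan T v)
    (ha : firsts T \ seconds T = {a}) (hb : seconds T \ firsts T = {b}) :
    cr d (vec p v a) ≠ 0 ∧ cr d (vec p v b) ≠ 0 := by
  have h1 : a ∈ firsts T := (Finset.mem_sdiff.1 (ha ▸ Finset.mem_singleton_self a)).1
  have h2 : b ∈ seconds T := (Finset.mem_sdiff.1 (hb ▸ Finset.mem_singleton_self b)).1
  obtain ⟨x, hx, rfl⟩ := Finset.mem_image.1 h1
  obtain ⟨y, hy, rfl⟩ := Finset.mem_image.1 h2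
  refine ⟨?_, ?_⟩
  · rw [← h.fst x hx]; exact (hd x hx).1
  · rw [← h.fst y hy]; exact (hd y hy).2

lemma IsFan.one_le_sepCount (h : IsFan T v) (hp : Pos T p) (hd : Transverse T p d)
    (ha : firsts T \ seconds T = {a}) (hb : seconds T \ firsts T = {b})
    (h1 : 0 < cr d (vec p v a)) (h2 : cr d (vec p v b) < 0) : 1 ≤ sepCount T p d := by
  have hT : T.Nonempty := by
    rw [Finset.nonempty_iff_ne_empty]
    rintro rfl
    simp [firsts] at ha
  have h3 := h.telescope hp hd
  rw [ha, hb, Finset.sum_singleton, Finset.sum_singleton] at h3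
  have h4 := angSum_pos hp hT
  by_contra h5
  have h6 : sepCount T p d = 0 := by omega
  rw [h6] at h3
  have ca := arg_div_cases (d := d) (z := vec p v a) h1.ne'
  have cb := arg_div_cases (d := d) (z := vec p v b) h2.ne
  rcases ca with ca | ca
  · rcases cb with cb | cb
    · linarith
    · simp at h3; linarith
  · linarith

lemma IsFan.sign_of_sepCount (h : IsFan T v) (hp : Pos T p) (hd : Transverse T p d)
    (ha : firsts T \ seconds T = {a}) (hb : seconds T \ firsts T = {b})
    (hS : angSum T p ≤ π) (h0 : sepCount T p d ≠ 0) :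
    0 < cr d (vec p v a) ∧ cr d (vec p v b) < 0 := by
  have h3 := h.telescope hp hd
  rw [ha, hb, Finset.sum_singleton, Finset.sum_singleton] at h3
  obtain ⟨na, nb⟩ := h.transverse_ends hd ha hb
  have h5 : (1 : ℝ) ≤ sepCount T p d := by exact_mod_cast Nat.one_le_iff_ne_zero.2 h0
  have hpi := Real.pi_pos
  have h6 : 2 * π ≤ 2 * π * sepCount T p d := by nlinarith
  rcases arg_div_cases (d := d) (z := vec p v a) na with ca | ca <;>
    rcases arg_div_cases (d := d) (z := vec p v b) nb with cb | cb
  · linarith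
  · exact ⟨ca.1, cb.1⟩
  · linarith
  · linarith

lemma IsFan.sepCount_le_one (h : IsFan T v) (hp : Pos T p) (hd : Transverse T p d)
    (ha : firsts T \ seconds T = {a}) (hb : seconds T \ firsts T = {b})
    (hS : angSum T p ≤ π) : sepCount T p d ≤ 1 := by
  by_contra h0
  have h3 := h.telescope hp hd
  rw [ha, hb, Finset.sum_singleton, Finset.sum_singleton] at h3
  have h5 : (2 : ℝ) ≤ sepCount T p d := by exact_mod_cast (by omega : 2 ≤ sepCount T p d)
  have hpi := Real.pi_pos
  have h6 : 4 * π ≤ 2 * π * sepCount T p d := by nlinarith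
  have := Complex.arg_le_pi (vec p v a / d)
  have := Complex.neg_pi_lt_arg (vec p v b / d)
  linarith

lemma IsFan.sepCount_add_le_one (h : IsFan T v) (hp : Pos T p) (hd : Transverse T p d)
    (ha : firsts T \ seconds T = {a}) (hb : seconds T \ firsts T = {b})
    (hS : angSum T p ≤ π) : sepCount T p d + sepCount T p (-d) ≤ 1 := by
  have h1 := h.sepCount_le_one hp hd ha hb hS
  have h2 := h.sepCount_le_one hp hd.neg ha hb hS
  by_contra h3
  have h4 := h.sign_of_sepCount hp hd ha hb hS (by omega)
  have h5 := h.sign_of_sepCount hp hd.neg ha hb hS (by omega)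
  rw [cr_neg_left, cr_neg_left] at h5
  linarith

end openFan

lemma card_filter_rot {O : Finset (Pt × Pt × Pt)}
    (rot : ∀ v a b, (v, a, b) ∈ O → (a, b, v) ∈ O) (F : Pt × Pt × Pt → ℝ) :
    ∑ x ∈ O, F x = ∑ x ∈ O, F (x.2.1, x.2.2, x.1) := by
  symm
  refine Finset.sum_bij' (fun x _ => (x.2.1, x.2.2, x.1)) (fun x _ => (x.2.2, x.1, x.2.1))
    ?_ ?_ ?_ ?_ ?_
  · rintro ⟨v, a, b⟩ h; exact rot _ _ _ h
  · rintro ⟨v, a, b⟩ h; exact rot _ _ _ (rot _ _ _ h)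
  · rintro ⟨v, a, b⟩ h; rfl
  · rintro ⟨v, a, b⟩ h; rfl
  · rintro ⟨v, a, b⟩ h; rfl

lemma sum_rot_three {O : Finset (Pt × Pt × Pt)}
    (rot : ∀ v a b, (v, a, b) ∈ O → (a, b, v) ∈ O) (F : Pt × Pt × Pt → ℝ) :
    3 * ∑ x ∈ O, F x =
      ∑ x ∈ O, (F x + F (x.2.1, x.2.2, x.1) + F (x.2.2, x.1, x.2.1)) := by
  rw [Finset.sum_add_distrib, Finset.sum_add_distrib, ← card_filter_rot rot F]
  have := card_filter_rot rot (fun x => F (x.2.1, x.2.2, x.1))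
  simp only at this
  rw [← this, ← card_filter_rot rot F]
  ring

/-- A combinatorial triangulated disk: oriented triangles, closed under rotation, each vertex
having at most one outgoing boundary edge, with the Euler relation. -/
structure DiskComplex (Q : Finset Pt) (O : Finset (Pt × Pt × Pt)) : Prop where
  rot : ∀ v a b, (v, a, b) ∈ O → (a, b, v) ∈ O
  uniq : ∀ v a b b', (v, a, b) ∈ O → (v, a, b') ∈ O → b = b'
  mem : ∀ v a b, (v, a, b) ∈ O → v ∈ Q
  vert : ∀ v ∈ Q, ∃ a b, (v, a, b) ∈ O
  starts_le : ∀ v, (firsts (fan O v) \ seconds (fan O v)).card ≤ 1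
  euler : (O.card : ℝ) / 3 + 2 =
    ∑ v ∈ Q, (if firsts (fan O v) ⊆ seconds (fan O v) then 2 else 1)

lemma mem_fan {O : Finset (Pt × Pt × Pt)} {v : Pt} {x : Pt × Pt × Pt} :
    x ∈ fan O v ↔ x ∈ O ∧ x.1 = v := Finset.mem_filter

lemma mem_firsts {O : Finset (Pt × Pt × Pt)} {v a : Pt} :
    a ∈ firsts (fan O v) ↔ ∃ b, (v, a, b) ∈ O := by
  simp only [firsts, fan, Finset.mem_image, Finset.mem_filter, Prod.exists]
  constructor
  · rintro ⟨_, _, b, ⟨h, rfl⟩, rfl⟩; exact ⟨b, h⟩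
  · rintro ⟨b, h⟩; exact ⟨v, a, b, ⟨h, rfl⟩, rfl⟩

lemma mem_seconds {O : Finset (Pt × Pt × Pt)} {v b : Pt} :
    b ∈ seconds (fan O v) ↔ ∃ a, (v, a, b) ∈ O := by
  simp only [seconds, fan, Finset.mem_image, Finset.mem_filter, Prod.exists]
  constructor
  · rintro ⟨_, a, _, ⟨h, rfl⟩, rfl⟩; exact ⟨a, h⟩
  · rintro ⟨a, h⟩; exact ⟨v, a, b, ⟨h, rfl⟩, rfl⟩

lemma isFan_fan {O : Finset (Pt × Pt × Pt)} (rot : ∀ v a b, (v, a, b) ∈ O → (a, b, v) ∈ O)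
    (uniq : ∀ v a b b', (v, a, b) ∈ O → (v, a, b') ∈ O → b = b') (v : Pt) :
    IsFan (fan O v) v := by
  refine ⟨fun x hx => (mem_fan.1 hx).2, ?_, ?_⟩
  · rintro ⟨v1, a, b⟩ hx ⟨v2, a', b'⟩ hy h
    obtain ⟨hx', hx1⟩ := mem_fan.1 hx
    obtain ⟨hy', hy1⟩ := mem_fan.1 hy
    simp only at h hx1 hy1
    subst h hx1 hy1
    rw [uniq _ _ _ _ hx' hy']
  · rintro ⟨v1, a, b⟩ hx ⟨v2, a', b'⟩ hy h
    obtain ⟨hx', hx1⟩ := mem_fan.1 hx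
    obtain ⟨hy', hy1⟩ := mem_fan.1 hy
    simp only at h hx1 hy1
    subst h hx1 hy1
    rw [uniq _ _ _ _ (rot _ _ _ (rot _ _ _ hx')) (rot _ _ _ (rot _ _ _ hy'))]

lemma sum_fan {Q : Finset Pt} {O : Finset (Pt × Pt × Pt)}
    (mem : ∀ v a b, (v, a, b) ∈ O → v ∈ Q) (F : Pt × Pt × Pt → ℝ) :
    ∑ v ∈ Q, ∑ x ∈ fan O v, F x = ∑ x ∈ O, F x :=
  Finset.sum_fiberwise_of_maps_to (fun x hx => mem x.1 x.2.1 x.2.2 hx) F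

lemma sepCount_eq_sum (T : Finset (Pt × Pt × Pt)) (p : Pt → Pt) (d : ℂ) :
    (sepCount T p d : ℝ) = ∑ x ∈ T, if Separates p d x then 1 else 0 := by
  rw [sepCount, Finset.card_eq_sum_ones, Finset.sum_filter]; push_cast; rfl

lemma separates_iff {p : Pt → Pt} {d : ℂ} {v a b : Pt} {s t : ℝ} (hs : cr d (vec p v a) = s)
    (ht : cr d (vec p v b) = t) :
    (Separates p d (v, a, b) ↔ 0 < s ∧ t < 0) ∧ (Separates p (-d) (v, a, b) ↔ s < 0 ∧ 0 < t) := by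
  simp [Separates, cr_neg_left, hs, ht]

/-- Every triangle has exactly one middle vertex with respect to a transverse linear functional. -/
lemma sum_sepCount_linear {Q : Finset Pt} {O : Finset (Pt × Pt × Pt)}
    (rot : ∀ v a b, (v, a, b) ∈ O → (a, b, v) ∈ O)
    (mem : ∀ v a b, (v, a, b) ∈ O → v ∈ Q) {p : Pt → Pt} {d : ℂ} (hd : Transverse O p d) :
    ∑ v ∈ Q, ((sepCount (fan O v) p d : ℝ) + sepCount (fan O v) p (-d)) = (O.card : ℝ) / 3 := by
  simp_rw [sepCount_eq_sum, ← Finset.sum_add_distrib]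
  rw [sum_fan mem]
  have h := sum_rot_three rot
    (fun x => (if Separates p d x then (1 : ℝ) else 0) + (if Separates p (-d) x then 1 else 0))
  have h2 : ∀ x ∈ O, (((if Separates p d x then (1 : ℝ) else 0) + (if Separates p (-d) x then 1 else 0))
      + ((if Separates p d (x.2.1, x.2.2, x.1) then (1 : ℝ) else 0)
          + (if Separates p (-d) (x.2.1, x.2.2, x.1) then 1 else 0))
      + ((if Separates p d (x.2.2, x.1, x.2.1) then (1 : ℝ) else 0)
          + (if Separates p (-d) (x.2.2, x.1, x.2.1) then 1 else 0))) = 1 := by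
    rintro ⟨v, a, b⟩ hx
    have h1 := (hd _ hx).1
    have h2 := (hd _ hx).2
    have h3 := (hd _ (rot _ _ _ hx)).1
    simp only at h1 h2 h3
    have e4 : cr d (vec p a b) = cr d (vec p v b) - cr d (vec p v a) := by
      simp [cr_eq, vec]; ring
    have e1 : cr d (vec p a v) = -cr d (vec p v a) := by simp [cr_eq, vec]; ring
    have e2 : cr d (vec p b v) = -cr d (vec p v b) := by simp [cr_eq, vec]; ring
    have e3 : cr d (vec p b a) = -(cr d (vec p v b) - cr d (vec p v a)) := by
      simp [cr_eq, vec]; ring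
    rw [e4] at h3
    simp only [separates_iff (d := d) (p := p) (v := v) (a := a) (b := b) rfl rfl,
      separates_iff e4 e1, separates_iff e2 e3]
    generalize cr d (vec p v a) = s at *
    generalize cr d (vec p v b) = t at *
    clear e1 e2 e3 e4
    generalize hu : t - s = u at *
    rcases lt_or_gt_of_ne h1 with h1 | h1 <;> rcases lt_or_gt_of_ne h2 with h2 | h2 <;>
      rcases lt_or_gt_of_ne h3 with h3 | h3 <;>
      first
      | (exfalso; linarith)
      | norm_num [h1, h2, h3, h1.not_gt, h2.not_gt, h3.not_gt]
  rw [Finset.sum_congr rfl h2, Finset.sum_const, nsmul_eq_mul, mul_one] at h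
  linarith

/-- The number of ordered triangles of `O` whose image contains `x` in the interior. -/
def insideCount (O : Finset (Pt × Pt × Pt)) (p : Pt → Pt) (x : Pt) : ℕ :=
  (O.filter (fun y => 0 < ori x (p y.2.1) (p y.2.2) ∧ 0 < ori (p y.1) x (p y.2.2) ∧
    0 < ori (p y.1) (p y.2.1) x)).card

/-- The point `x` is not on the line through any edge. -/
def GenericPt (O : Finset (Pt × Pt × Pt)) (p : Pt → Pt) (x : Pt) : Prop :=
  ∀ y ∈ O, ori (p y.1) (p y.2.1) x ≠ 0

/-- Seen from a generic point `x`, a triangle has one middle vertex, except that all three vertices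
count if the triangle contains `x`. -/
lemma sum_sepCount_point {Q : Finset Pt} {O : Finset (Pt × Pt × Pt)}
    (rot : ∀ v a b, (v, a, b) ∈ O → (a, b, v) ∈ O)
    (mem : ∀ v a b, (v, a, b) ∈ O → v ∈ Q) {p : Pt → Pt} (hp : Pos O p) {x : Pt}
    (hx : GenericPt O p x) :
    ∑ v ∈ Q, ((sepCount (fan O v) p (toC x - toC (p v)) : ℝ)
        + sepCount (fan O v) p (-(toC x - toC (p v))))
      = (O.card : ℝ) / 3 + 2 * ((insideCount O p x : ℝ) / 3) := by
  have hrw : ∀ v ∈ Q, ((sepCount (fan O v) p (toC x - toC (p v)) : ℝ)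
        + sepCount (fan O v) p (-(toC x - toC (p v)))) = ∑ y ∈ fan O v,
        ((if Separates p (toC x - toC (p y.1)) y then (1 : ℝ) else 0)
          + (if Separates p (-(toC x - toC (p y.1))) y then 1 else 0)) := by
    intro v _
    rw [sepCount_eq_sum, sepCount_eq_sum, ← Finset.sum_add_distrib]
    refine Finset.sum_congr rfl fun y hy => ?_
    rw [(mem_fan.1 hy).2]
  rw [Finset.sum_congr rfl hrw, sum_fan mem]
  have h := sum_rot_three rot
    (fun y => (if Separates p (toC x - toC (p y.1)) y then (1 : ℝ) else 0)
          + (if Separates p (-(toC x - toC (p y.1))) y then 1 else 0))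
  have h2 : ∀ y ∈ O, (((if Separates p (toC x - toC (p y.1)) y then (1 : ℝ) else 0)
        + (if Separates p (-(toC x - toC (p y.1))) y then 1 else 0))
      + ((if Separates p (toC x - toC (p y.2.1)) (y.2.1, y.2.2, y.1) then (1 : ℝ) else 0)
          + (if Separates p (-(toC x - toC (p y.2.1))) (y.2.1, y.2.2, y.1) then 1 else 0))
      + ((if Separates p (toC x - toC (p y.2.2)) (y.2.2, y.1, y.2.1) then (1 : ℝ) else 0)
          + (if Separates p (-(toC x - toC (p y.2.2))) (y.2.2, y.1, y.2.1) then 1 else 0)))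
      = 1 + 2 * (if 0 < ori x (p y.2.1) (p y.2.2) ∧ 0 < ori (p y.1) x (p y.2.2) ∧
    0 < ori (p y.1) (p y.2.1) x then 1 else 0) := by
    rintro ⟨v, a, b⟩ hy
    have h1 := hx _ hy
    have h2 := hx _ (rot _ _ _ hy)
    have h3 := hx _ (rot _ _ _ (rot _ _ _ hy))
    have hpos := hp _ hy
    have hs := ori_split (p v) (p a) (p b) x
    simp only at h1 h2 h3 hpos
    rw [ori_rot] at h2
    rw [ori_rot, ori_rot] at h3
    rw [← ori_rot (p v) x (p b), ← ori_rot x (p b) (p v)] at hs ⊢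
    rw [← ori_rot, ← ori_rot] at h3
    have e1 : cr (toC x - toC (p v)) (vec p v a) = -ori (p v) (p a) x := by
      simp [cr_eq, vec, toC, ori]; ring
    have e2 : cr (toC x - toC (p v)) (vec p v b) = ori (p b) (p v) x := by
      simp [cr_eq, vec, toC, ori]; ring
    have e3 : cr (toC x - toC (p a)) (vec p a b) = -ori x (p a) (p b) := by
      simp [cr_eq, vec, toC, ori]; ring
    have e4 : cr (toC x - toC (p a)) (vec p a v) = ori (p v) (p a) x := by
      simp [cr_eq, vec, toC, ori]; ring
    have e5 : cr (toC x - toC (p b)) (vec p b v) = -ori (p b) (p v) x := by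
      simp [cr_eq, vec, toC, ori]; ring
    have e6 : cr (toC x - toC (p b)) (vec p b a) = ori x (p a) (p b) := by
      simp [cr_eq, vec, toC, ori]; ring
    simp only [separates_iff e1 e2, separates_iff e3 e4, separates_iff e5 e6]
    clear e1 e2 e3 e4 e5 e6
    generalize ori (p v) (p a) x = r at *
    generalize ori x (p a) (p b) = s at *
    generalize ori (p b) (p v) x = t at *
    rcases lt_or_gt_of_ne h1 with h1 | h1 <;> rcases lt_or_gt_of_ne h2 with h2 | h2 <;>
      rcases lt_or_gt_of_ne h3 with h3 | h3 <;>
      first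
      | (exfalso; linarith)
      | norm_num [h1, h2, h3, h1.not_gt, h2.not_gt, h3.not_gt]
  rw [Finset.sum_congr rfl h2, Finset.sum_add_distrib (f := fun _ => (1 : ℝ)), Finset.sum_const,
    nsmul_eq_mul, mul_one, ← Finset.mul_sum] at h
  rw [insideCount, Finset.card_eq_sum_ones (O.filter _), Finset.sum_filter]
  push_cast
  linarith

end

section

/-- The complement of finitely many lines is dense. -/
lemma dense_off_lines (L : Finset (Pt × Pt)) (hL : ∀ l ∈ L, l.1 ≠ l.2) :
    Dense {x : Pt | ∀ l ∈ L, ori l.1 l.2 x ≠ 0} := by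
  have h1 : {x : Pt | ∀ l ∈ L, ori l.1 l.2 x ≠ 0}
      = ⋂ l ∈ (L : Set (Pt × Pt)), {x : Pt | ori l.1 l.2 x ≠ 0} := by
    ext x; simp
  rw [h1]
  refine dense_biInter_of_isOpen (fun l _ => ?_) L.countable_toSet fun l hl => ?_
  · exact isOpen_ne_fun (ori_continuous _ _) continuous_const
  obtain ⟨v, a⟩ := l
  have hva := hL _ hl
  simp only at hva ⊢
  rw [Metric.dense_iff]
  intro x r hr
  by_cases hx : ori v a x = 0
  · set w : Pt := ofC (Complex.I * (toC a - toC v)) with hw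
    refine ⟨x + (r / (2 * (‖w‖ + 1))) • w, ?_, ?_⟩
    · have : 0 ≤ ‖w‖ := norm_nonneg _
      rw [Metric.mem_ball, dist_eq_norm, add_sub_cancel_left, norm_smul, Real.norm_eq_abs,
        abs_of_pos (by positivity), div_mul_eq_mul_div, div_lt_iff₀ (by positivity)]
      nlinarith
    · have h2 : ori v a (x + (r / (2 * (‖w‖ + 1))) • w) =
          ori v a x + (r / (2 * (‖w‖ + 1))) * Complex.normSq (toC a - toC v) := by
        simp [ori, hw, ofC, toC, Complex.normSq_apply]; ring
      have : 0 ≤ ‖w‖ := norm_nonneg _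
      have h3 : 0 < Complex.normSq (toC a - toC v) := by
        rw [Complex.normSq_pos, sub_ne_zero]
        exact fun h => hva (toC_injective h).symm
      rw [Set.mem_ofPred_eq, h2, hx, zero_add]
      positivity
  · exact ⟨x, Metric.mem_ball_self hr, hx⟩

lemma cr_rotate (d z : ℂ) (η : ℝ) :
    cr (d * (1 + η * Complex.I)) z = cr d z - η * (d.re * z.re + d.im * z.im) := by
  simp [cr_eq]; ring

/-- Small rotations of a direction avoid finitely many given directions. -/
lemma eventually_cr_ne {d : ℂ} (hd : d ≠ 0) (Z : Finset ℂ) (hZ : ∀ z ∈ Z, z ≠ 0) :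
    ∀ᶠ η : ℝ in nhdsWithin 0 (Set.Ioi 0), ∀ z ∈ Z, cr (d * (1 + η * Complex.I)) z ≠ 0 := by
  rw [Filter.eventually_all_finset]
  intro z hz
  by_cases h : cr d z = 0
  · have h2 : d.re * z.re + d.im * z.im ≠ 0 := by
      intro h3
      have h4 : Complex.normSq d * Complex.normSq z = 0 := by
        rw [cr_eq] at h
        simp only [Complex.normSq_apply]
        linear_combination (d.re * z.im - d.im * z.re) * h + (d.re * z.re + d.im * z.im) * h3
      rcases mul_eq_zero.1 h4 with h5 | h5
      · exact hd (Complex.normSq_eq_zero.1 h5)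
      · exact hZ z hz (Complex.normSq_eq_zero.1 h5)
    filter_upwards [self_mem_nhdsWithin] with η hη
    rw [cr_rotate, h, zero_sub]
    exact neg_ne_zero.2 (mul_ne_zero (ne_of_gt hη) h2)
  · have : Filter.Tendsto (fun η : ℝ => cr (d * (1 + η * Complex.I)) z)
        (nhdsWithin 0 (Set.Ioi 0)) (nhds (cr d z)) := by
      simp_rw [cr_rotate]
      have h1 : Continuous fun η : ℝ => cr d z - η * (d.re * z.re + d.im * z.im) := by fun_prop
      have h2 := h1.tendsto 0
      simp only [zero_mul, sub_zero] at h2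
      exact h2.mono_left nhdsWithin_le_nhds
    exact this.eventually_ne h

lemma eventually_cr_pos {d z : ℂ} (h : 0 < cr d z) :
    ∀ᶠ η : ℝ in nhdsWithin 0 (Set.Ioi 0), 0 < cr (d * (1 + η * Complex.I)) z := by
  have h1 : Continuous fun η : ℝ => cr d z - η * (d.re * z.re + d.im * z.im) := by fun_prop
  have h2 := h1.tendsto 0
  simp only [zero_mul, sub_zero] at h2
  simp_rw [cr_rotate]
  exact (h2.mono_left nhdsWithin_le_nhds).eventually_const_lt h

lemma DiskComplex.isFan {Q : Finset Pt} {O : Finset (Pt × Pt × Pt)} (h : DiskComplex Q O) (v : Pt) :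
    IsFan (fan O v) v := isFan_fan h.rot h.uniq v

/-- The first and the last neighbour of a boundary vertex. -/
lemma DiskComplex.exists_ends {Q : Finset Pt} {O : Finset (Pt × Pt × Pt)} (h : DiskComplex Q O)
    {v : Pt} (hv : ¬ firsts (fan O v) ⊆ seconds (fan O v)) :
    ∃ a b, firsts (fan O v) \ seconds (fan O v) = {a} ∧
      seconds (fan O v) \ firsts (fan O v) = {b} := by
  have h1 := h.starts_le v
  have h2 : (firsts (fan O v) \ seconds (fan O v)).card ≠ 0 := by
    rw [Finset.card_ne_zero, Finset.nonempty_iff_ne_empty]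
    exact fun h3 => hv (Finset.sdiff_eq_empty_iff_subset.1 h3)
  have h3 : (firsts (fan O v) \ seconds (fan O v)).card = 1 := by omega
  have h4 := (h.isFan v).card_sdiff
  rw [h3] at h4
  obtain ⟨a, ha⟩ := Finset.card_eq_one.1 h3
  obtain ⟨b, hb⟩ := Finset.card_eq_one.1 h4
  exact ⟨a, b, ha, hb⟩

lemma DiskComplex.mem_seconds_iff {Q : Finset Pt} {O : Finset (Pt × Pt × Pt)}
    (h : DiskComplex Q O) {v a : Pt} : a ∈ seconds (fan O v) ↔ v ∈ firsts (fan O a) := by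
  rw [mem_seconds, mem_firsts]
  exact ⟨fun ⟨x, hx⟩ => ⟨x, h.rot _ _ _ (h.rot _ _ _ hx)⟩, fun ⟨x, hx⟩ => ⟨x, h.rot _ _ _ hx⟩⟩

/-- A positively oriented map of a disk complex to the plane, with cone angles `2π` at interior
vertices and at most `π` at boundary vertices. -/
structure Devel (Q : Finset Pt) (O : Finset (Pt × Pt × Pt)) (p : Pt → Pt) : Prop where
  disk : DiskComplex Q O
  pos : Pos O p
  int : ∀ v ∈ Q, firsts (fan O v) ⊆ seconds (fan O v) → angSum (fan O v) p = 2 * π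
  bd : ∀ v ∈ Q, ¬ firsts (fan O v) ⊆ seconds (fan O v) → angSum (fan O v) p ≤ π

lemma Pos.mono {S T : Finset (Pt × Pt × Pt)} {p : Pt → Pt} (h : Pos T p) (hS : S ⊆ T) : Pos S p :=
  fun x hx => h x (hS hx)

lemma fan_subset (O : Finset (Pt × Pt × Pt)) (v : Pt) : fan O v ⊆ O := Finset.filter_subset _ _

lemma vec_ne_zero {p : Pt → Pt} {v a : Pt} (h : p a ≠ p v) : vec p v a ≠ 0 :=
  sub_ne_zero.2 fun h1 => h (toC_injective h1)

/-- The vectors along the edges of the triangles in `O`. -/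
def edgeVecs (O : Finset (Pt × Pt × Pt)) (p : Pt → Pt) : Finset ℂ :=
  O.image (fun x => vec p x.1 x.2.1) ∪ O.image (fun x => vec p x.1 x.2.2)

lemma edgeVecs_ne_zero {O : Finset (Pt × Pt × Pt)} {p : Pt → Pt} (h : Pos O p) :
    ∀ z ∈ edgeVecs O p, z ≠ 0 := by
  intro z hz
  simp only [edgeVecs, Finset.mem_union, Finset.mem_image] at hz
  rcases hz with ⟨x, hx, rfl⟩ | ⟨x, hx, rfl⟩
  · exact vec_ne_zero (ne_of_ori (h x hx)).1
  · exact vec_ne_zero (ne_of_ori (h x hx)).2.1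

lemma transverse_of_edgeVecs {O : Finset (Pt × Pt × Pt)} {p : Pt → Pt} {d : ℂ}
    (h : ∀ z ∈ edgeVecs O p, cr d z ≠ 0) : Transverse O p d := by
  intro x hx
  constructor <;> apply h <;> simp only [edgeVecs, Finset.mem_union, Finset.mem_image]
  · exact Or.inl ⟨x, hx, rfl⟩
  · exact Or.inr ⟨x, hx, rfl⟩

lemma exists_transverse {O : Finset (Pt × Pt × Pt)} {p : Pt → Pt} (h : Pos O p) :
    ∃ d, Transverse O p d := by
  obtain ⟨η, hη⟩ := (eventually_cr_ne one_ne_zero _ (edgeVecs_ne_zero h)).exists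
  exact ⟨_, transverse_of_edgeVecs hη⟩

/-- A fan of total angle at most `π` spans a convex corner. -/
lemma IsFan.arg_eq_angSum {T : Finset (Pt × Pt × Pt)} {v a b : Pt} {p : Pt → Pt}
    (h : IsFan T v) (hp : Pos T p)
    (ha : firsts T \ seconds T = {a}) (hb : seconds T \ firsts T = {b})
    (hS : angSum T p ≤ π) : (vec p v b / vec p v a).arg = angSum T p := by
  obtain ⟨d, hd⟩ := exists_transverse hp
  have h3 := h.telescope hp hd
  rw [ha, hb, Finset.sum_singleton, Finset.sum_singleton] at h3
  obtain ⟨na, nb⟩ := h.transverse_ends hd ha hb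
  have hd0 : d ≠ 0 := by rintro rfl; simp [cr] at na
  have za : vec p v a ≠ 0 := by intro h0; rw [h0] at na; simp [cr] at na
  have zb : vec p v b ≠ 0 := by intro h0; rw [h0] at nb; simp [cr] at nb
  have hT : T.Nonempty := by
    rw [Finset.nonempty_iff_ne_empty]
    rintro rfl
    simp [firsts] at ha
  have h4 := angSum_pos hp hT
  have h5 : (((vec p v b / vec p v a).arg : ℝ) : Real.Angle) = ((angSum T p : ℝ) : Real.Angle) := by
    have h6 : angSum T p = ((vec p v b / d).arg - (vec p v a / d).arg) + sepCount T p d • (2 * π) := by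
      rw [h3, nsmul_eq_mul]; ring
    rw [h6, Real.Angle.coe_add, Real.Angle.coe_sub, Real.Angle.coe_nsmul, Real.Angle.coe_two_pi,
      smul_zero, add_zero, Complex.arg_div_coe_angle zb za, Complex.arg_div_coe_angle zb hd0,
      Complex.arg_div_coe_angle za hd0]
    abel
  have h7 := congrArg Real.Angle.toReal h5
  rwa [Real.Angle.toReal_coe_eq_self_iff.2 ⟨Complex.neg_pi_lt_arg _, Complex.arg_le_pi _⟩,
    Real.Angle.toReal_coe_eq_self_iff.2 ⟨by linarith [Real.pi_pos], hS⟩] at h7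

end

section

section devel

variable {Q : Finset Pt} {O : Finset (Pt × Pt × Pt)} {p : Pt → Pt}

lemma Devel.fan_pos (h : Devel Q O p) (v : Pt) : Pos (fan O v) p := h.pos.mono (fan_subset O v)

lemma Devel.sepCount_int (h : Devel Q O p) {v : Pt} (hv : v ∈ Q)
    (hi : firsts (fan O v) ⊆ seconds (fan O v)) {d : ℂ} (hd : Transverse (fan O v) p d) :
    sepCount (fan O v) p d = 1 := by
  have h1 := (h.disk.isFan v).angSum_closed (h.fan_pos v) hd hi
  rw [h.int v hv hi] at h1
  have h2 : (sepCount (fan O v) p d : ℝ) = 1 := by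
    have := Real.pi_pos
    have h3 : 2 * π * ((sepCount (fan O v) p d : ℝ) - 1) = 0 := by linarith
    rcases mul_eq_zero.1 h3 with h4 | h4
    · linarith
    · linarith
  exact_mod_cast h2

lemma Devel.sepCount_le (h : Devel Q O p) {v : Pt} (hv : v ∈ Q) {d : ℂ}
    (hd : Transverse (fan O v) p d) :
    (sepCount (fan O v) p d : ℝ) + sepCount (fan O v) p (-d) ≤
      if firsts (fan O v) ⊆ seconds (fan O v) then 2 else 1 := by
  split_ifs with hi
  · rw [h.sepCount_int hv hi hd, h.sepCount_int hv hi hd.neg]; norm_num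
  · obtain ⟨a, b, ha, hb⟩ := h.disk.exists_ends hi
    exact_mod_cast (h.disk.isFan v).sepCount_add_le_one (h.fan_pos v) hd ha hb (h.bd v hv hi)

/-- A transverse linear functional has at most two local extrema on the vertices. -/
lemma Devel.not_three_extrema (h : Devel Q O p) {d : ℂ} (hd : Transverse O p d) {u v w : Pt}
    (hu : u ∈ Q) (hv : v ∈ Q) (hw : w ∈ Q) (huv : u ≠ v) (huw : u ≠ w) (hvw : v ≠ w)
    (h0 : ∀ x ∈ ({u, v, w} : Finset Pt), sepCount (fan O x) p d = 0 ∧ sepCount (fan O x) p (-d) = 0) :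
    False := by
  have h1 := sum_sepCount_linear h.disk.rot h.disk.mem hd
  have h2 := h.disk.euler
  set cap : Pt → ℝ := fun v => if firsts (fan O v) ⊆ seconds (fan O v) then 2 else 1 with hcap
  have h3 : ∑ v ∈ Q, (cap v - ((sepCount (fan O v) p d : ℝ) + sepCount (fan O v) p (-d))) = 2 := by
    rw [Finset.sum_sub_distrib, h1, ← h2]; ring
  have h4 : ∑ v ∈ ({u, v, w} : Finset Pt),
      (cap v - ((sepCount (fan O v) p d : ℝ) + sepCount (fan O v) p (-d))) ≤ 2 := by
    rw [← h3]
    refine Finset.sum_le_sum_of_subset_of_nonneg ?_ ?_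
    · intro x hx
      simp only [Finset.mem_insert, Finset.mem_singleton] at hx
      rcases hx with rfl | rfl | rfl <;> assumption
    · intro x hx _
      have := h.sepCount_le hx (hd.mono (fan_subset O x))
      simp only [hcap]; linarith
  have h5 : ∑ v ∈ ({u, v, w} : Finset Pt), (1 : ℝ) ≤ ∑ v ∈ ({u, v, w} : Finset Pt),
      (cap v - ((sepCount (fan O v) p d : ℝ) + sepCount (fan O v) p (-d))) := by
    refine Finset.sum_le_sum fun x hx => ?_
    rw [(h0 x hx).1, (h0 x hx).2]
    simp only [hcap]
    split_ifs <;> norm_num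
  rw [Finset.sum_const, Finset.card_eq_three.2 ⟨u, v, w, huv, huw, hvw, rfl⟩] at h5
  simp only [nsmul_eq_mul, mul_one, Nat.cast_ofNat] at h5
  linarith

lemma sepCount_eq_zero_of_min {v : Pt} {d : ℂ}
    (hm : ∀ x ∈ fan O v, 0 ≤ cr d (vec p v x.2.1) ∧ 0 ≤ cr d (vec p v x.2.2)) :
    sepCount (fan O v) p d = 0 ∧ sepCount (fan O v) p (-d) = 0 := by
  constructor
  · rw [sepCount, Finset.card_eq_zero, Finset.filter_eq_empty_iff]
    rintro x hx ⟨_, h2⟩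
    rw [(mem_fan.1 hx).2] at h2
    linarith [(hm x hx).2]
  · rw [sepCount, Finset.card_eq_zero, Finset.filter_eq_empty_iff]
    rintro x hx ⟨h2, _⟩
    rw [(mem_fan.1 hx).2, cr_neg_left] at h2
    linarith [(hm x hx).1]

lemma cr_vec (p : Pt → Pt) (d : ℂ) (v a : Pt) :
    cr d (vec p v a) = cr d (toC (p a)) - cr d (toC (p v)) := by
  simp [cr_eq, vec]; ring

lemma DiskComplex.mem₂ (h : DiskComplex Q O) {v a b : Pt} (hx : (v, a, b) ∈ O) : a ∈ Q :=
  h.mem _ _ _ (h.rot _ _ _ hx)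

lemma DiskComplex.mem₃ (h : DiskComplex Q O) {v a b : Pt} (hx : (v, a, b) ∈ O) : b ∈ Q :=
  h.mem _ _ _ (h.rot _ _ _ (h.rot _ _ _ hx))

/-- The image lies to the left of every boundary edge. -/
lemma Devel.support (h : Devel Q O p) {v a : Pt}
    (hva : a ∈ firsts (fan O v) \ seconds (fan O v)) {q : Pt} (hq : q ∈ Q) :
    0 ≤ ori (p v) (p a) (p q) := by
  by_contra! hneg
  set d₀ := vec p v a with hd₀
  obtain ⟨b₀, hb₀⟩ := mem_firsts.1 (Finset.mem_sdiff.1 hva).1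
  have hd₀0 : d₀ ≠ 0 := vec_ne_zero (ne_of_ori (h.pos _ hb₀)).1
  -- vertices reached along boundary edges on the line through the edge
  set C : Finset Pt := Q.filter (fun w => cr d₀ (vec p v w) = 0 ∧
    ∃ u, w ∈ firsts (fan O u) \ seconds (fan O u) ∧ ∃ l : ℝ, 0 < l ∧ vec p u w = l * d₀) with hC
  have haC : a ∈ C := by
    rw [hC, Finset.mem_filter]
    refine ⟨h.disk.mem₂ hb₀, ?_, v, hva, 1, one_pos, by simp [hd₀]⟩
    simp [cr_eq, hd₀]; ring
  obtain ⟨w, hwC, hwmax⟩ := Finset.exists_max_image C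
    (fun w => d₀.re * (toC (p w)).re + d₀.im * (toC (p w)).im) ⟨a, haC⟩
  obtain ⟨hwQ, hw0, u, hu, l, hl, hul⟩ := Finset.mem_filter.1 hwC
  have hwb : ¬ firsts (fan O w) ⊆ seconds (fan O w) := by
    intro hsub
    have h1 : seconds (fan O w) \ firsts (fan O w) = ∅ := by
      rw [← Finset.card_eq_zero, (h.disk.isFan w).card_sdiff,
        Finset.sdiff_eq_empty_iff_subset.2 hsub, Finset.card_empty]
    have h2 : u ∈ seconds (fan O w) \ firsts (fan O w) := by
      rw [Finset.mem_sdiff, h.disk.mem_seconds_iff, ← h.disk.mem_seconds_iff (v := u)]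
      exact Finset.mem_sdiff.1 hu
    rw [h1] at h2
    simp at h2
  obtain ⟨a', b', ha', hb'⟩ := h.disk.exists_ends hwb
  have hub : u = b' := by
    have h2 : u ∈ seconds (fan O w) \ firsts (fan O w) := by
      rw [Finset.mem_sdiff, h.disk.mem_seconds_iff, ← h.disk.mem_seconds_iff (v := u)]
      exact Finset.mem_sdiff.1 hu
    rw [hb'] at h2
    exact Finset.mem_singleton.1 h2
  subst hub
  have ha'm : a' ∈ firsts (fan O w) \ seconds (fan O w) := by rw [ha']; simp
  obtain ⟨c', hc'⟩ := mem_firsts.1 (Finset.mem_sdiff.1 ha'm).1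
  have hA0 : vec p w a' ≠ 0 := vec_ne_zero (ne_of_ori (h.pos _ hc')).1
  have harg := (h.disk.isFan w).arg_eq_angSum (h.fan_pos w) ha' hb' (h.bd w hwQ hwb)
  have hargpos : 0 < angSum (fan O w) p :=
    angSum_pos (h.fan_pos w) ⟨_, mem_fan.2 ⟨hc', rfl⟩⟩
  have hB : vec p w u = -(l * d₀) := by rw [← hul]; simp [vec]
  -- the corner at `w` turns
  have hcrA : 0 < cr d₀ (vec p w a') := by
    have h1 : 0 ≤ (vec p w u / vec p w a').im := Complex.arg_nonneg_iff.1 (by linarith)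
    have e1 : (vec p w u / vec p w a').im = l * cr d₀ (vec p w a') / Complex.normSq (vec p w a') := by
      rw [im_div_eq, hB]
      congr 1
      simp [cr_eq]; ring
    have n1 : 0 < Complex.normSq (vec p w a') := Complex.normSq_pos.2 hA0
    rcases lt_or_eq_of_le h1 with h2 | h2
    · rw [e1] at h2
      by_contra! h3
      have : l * cr d₀ (vec p w a') / Complex.normSq (vec p w a') ≤ 0 :=
        div_nonpos_of_nonpos_of_nonneg (mul_nonpos_of_nonneg_of_nonpos hl.le h3) n1.le
      linarith
    · exfalso
      have hre : (vec p w u / vec p w a').re < 0 := by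
        by_contra! h3
        have := Complex.arg_eq_zero_iff.2 ⟨h3, h2.symm⟩
        linarith
      set r := (vec p w u / vec p w a').re with hr
      have e2 : vec p w u = r * vec p w a' := by
        rw [← div_eq_iff hA0]
        apply Complex.ext <;> simp [hr, ← h2]
      have hrne : (r : ℂ) ≠ 0 := by exact_mod_cast hre.ne
      have e3 : vec p w a' = ((l / -r : ℝ) : ℂ) * d₀ := by
        rw [hB] at e2
        push_cast
        field_simp
        linear_combination -e2
      have hpos : 0 < l / -r := div_pos hl (by linarith)
      have haC' : a' ∈ C := by
        rw [hC, Finset.mem_filter]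
        refine ⟨h.disk.mem₂ hc', ?_, w, ha'm, l / -r, hpos, e3⟩
        have e4 : vec p v a' = vec p v w + vec p w a' := by simp [vec]
        rw [e4, e3]
        have : cr d₀ (vec p v w + ((l / -r : ℝ) : ℂ) * d₀) = cr d₀ (vec p v w) := by
          generalize l / -r = k
          simp [cr_eq]; ring
        rw [this, hw0]
      have h5 := hwmax a' haC'
      have e6 : toC (p a') = toC (p w) + ((l / -r : ℝ) : ℂ) * d₀ := by
        rw [← e3]; simp [vec]
      rw [e6] at h5
      have h7 : 0 < Complex.normSq d₀ := Complex.normSq_pos.2 hd₀0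
      rw [Complex.normSq_apply] at h7
      simp only [Complex.add_re, Complex.add_im, Complex.re_ofReal_mul, Complex.im_ofReal_mul] at h5
      nlinarith
  have hqw : 0 < cr d₀ (vec p q w) := by
    rw [ori_eq_cr, ← hd₀] at hneg
    rw [cr_vec] at hw0 hneg ⊢
    linarith
  obtain ⟨η, ⟨⟨h1, h2⟩, h3⟩, h4⟩ := (((eventually_cr_pos hcrA).and (eventually_cr_pos hqw)).and
    (eventually_cr_ne hd₀0 _ (edgeVecs_ne_zero h.pos))).and self_mem_nhdsWithin |>.exists
  set d := d₀ * (1 + η * Complex.I) with hd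
  have htr : Transverse O p d := transverse_of_edgeVecs h3
  have hcrB : 0 < cr d (vec p w u) := by
    have h7 : 0 < Complex.normSq d₀ := Complex.normSq_pos.2 hd₀0
    have : cr d (vec p w u) = η * l * Complex.normSq d₀ := by
      rw [hd, cr_rotate, hB, Complex.normSq_apply]; simp [cr_eq]; ring
    rw [this]
    exact mul_pos (mul_pos h4 hl) h7
  obtain ⟨m, hm, hmin⟩ := Finset.exists_min_image Q (fun x => cr d (toC (p x))) ⟨q, hq⟩
  obtain ⟨M, hM, hmax⟩ := Finset.exists_max_image Q (fun x => cr d (toC (p x))) ⟨q, hq⟩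
  have htw := htr.mono (fan_subset O w)
  have hmw : cr d (toC (p m)) < cr d (toC (p w)) := by
    have := hmin q hq
    rw [cr_vec] at h2
    linarith
  have hMw : cr d (toC (p w)) < cr d (toC (p M)) := by
    have := hmax a' (h.disk.mem₂ hc')
    rw [cr_vec] at h1
    linarith
  refine h.not_three_extrema htr hm hwQ hM ?_ ?_ ?_ ?_
  · rintro rfl; exact lt_irrefl _ hmw
  · rintro rfl; exact lt_irrefl _ (hmw.trans hMw)
  · rintro rfl; exact lt_irrefl _ hMw
  · intro x hx
    simp only [Finset.mem_insert, Finset.mem_singleton] at hx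
    rcases hx with rfl | rfl | rfl
    · apply sepCount_eq_zero_of_min
      rintro ⟨x1, x2, x3⟩ hx
      obtain ⟨hx1, hx2⟩ := mem_fan.1 hx
      rw [cr_vec, cr_vec]
      exact ⟨sub_nonneg.2 (hmin _ (h.disk.mem₂ hx1)), sub_nonneg.2 (hmin _ (h.disk.mem₃ hx1))⟩
    · constructor
      · by_contra h0
        have := (h.disk.isFan x).sign_of_sepCount (h.fan_pos x) htw ha' hb' (h.bd x hwQ hwb) h0
        linarith
      · by_contra h0
        have := (h.disk.isFan x).sign_of_sepCount (h.fan_pos x) htw.neg ha' hb' (h.bd x hwQ hwb) h0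
        rw [cr_neg_left, cr_neg_left] at this
        linarith
    · have := sepCount_eq_zero_of_min (O := O) (p := p) (v := x) (d := -d) ?_
      · rw [neg_neg] at this; exact this.symm
      rintro ⟨x1, x2, x3⟩ hx
      obtain ⟨hx1, hx2⟩ := mem_fan.1 hx
      rw [cr_neg_left, cr_neg_left, cr_vec, cr_vec]
      have := hmax _ (h.disk.mem₂ hx1)
      have := hmax _ (h.disk.mem₃ hx1)
      constructor <;> simp only at * <;> linarith

end devel

end

section

/-- The point `x` lies in the interior of the image of the triangle `y`. -/
def Inside (p : Pt → Pt) (y : Pt × Pt × Pt) (x : Pt) : Prop :=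
  0 < ori x (p y.2.1) (p y.2.2) ∧ 0 < ori (p y.1) x (p y.2.2) ∧ 0 < ori (p y.1) (p y.2.1) x

lemma Inside.rot {p : Pt → Pt} {v a b x : Pt} (h : Inside p (v, a, b) x) :
    Inside p (a, b, v) x := by
  obtain ⟨h1, h2, h3⟩ := h
  refine ⟨?_, ?_, ?_⟩ <;> simp only at *
  · rwa [ori_rot]
  · rwa [ori_rot]
  · rwa [ori_rot]

lemma isOpen_inside (p : Pt → Pt) (y : Pt × Pt × Pt) : IsOpen {x | Inside p y x} := by
  have c1 : Continuous fun x => ori x (p y.2.1) (p y.2.2) := by unfold ori; fun_prop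
  have c2 : Continuous fun x => ori (p y.1) x (p y.2.2) := by unfold ori; fun_prop
  have c3 : Continuous fun x => ori (p y.1) (p y.2.1) x := by unfold ori; fun_prop
  exact (isOpen_lt continuous_const c1).inter
    ((isOpen_lt continuous_const c2).inter (isOpen_lt continuous_const c3))

section devel

variable {Q : Finset Pt} {O : Finset (Pt × Pt × Pt)} {p : Pt → Pt}

lemma GenericPt.transverse (rot : ∀ v a b, (v, a, b) ∈ O → (a, b, v) ∈ O) {x : Pt}
    (hx : GenericPt O p x) (v : Pt) : Transverse (fan O v) p (toC x - toC (p v)) := by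
  rintro ⟨w, a, b⟩ hy₀
  obtain ⟨hy, rfl⟩ := mem_fan.1 hy₀
  have h1 := hx _ hy
  have h2 := hx _ (rot _ _ _ (rot _ _ _ hy))
  simp only at *
  have e1 : cr (toC x - toC (p w)) (vec p w a) = -ori (p w) (p a) x := by
    simp [cr_eq, vec, toC, ori]; ring
  have e2 : cr (toC x - toC (p w)) (vec p w b) = ori (p b) (p w) x := by
    simp [cr_eq, vec, toC, ori]; ring
  rw [e1, e2]
  exact ⟨neg_ne_zero.2 h1, h2⟩

lemma Devel.insideCount_le (h : Devel Q O p) {x : Pt} (hx : GenericPt O p x) :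
    insideCount O p x ≤ 3 := by
  have h1 := sum_sepCount_point h.disk.rot h.disk.mem h.pos hx
  have h2 := h.disk.euler
  have h3 := Finset.sum_le_sum fun v hv =>
    h.sepCount_le (v := v) hv (hx.transverse h.disk.rot v)
  rw [h1, ← h2] at h3
  have h4 : (insideCount O p x : ℝ) ≤ 3 := by linarith
  exact_mod_cast h4

/-- A generic point lies in the interior of at most one triangle. -/
lemma Devel.inside_unique (h : Devel Q O p) {x : Pt} (hx : GenericPt O p x) {v a b : Pt}
    {z : Pt × Pt × Pt} (hy : (v, a, b) ∈ O) (hz : z ∈ O) (hyx : Inside p (v, a, b) x)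
    (hzx : Inside p z x) : z = (v, a, b) ∨ z = (a, b, v) ∨ z = (b, v, a) := by
  by_contra hcon
  push Not at hcon
  obtain ⟨n1, n2, n3⟩ := hcon
  have hne := ne_of_ori (h.pos _ hy)
  simp only at hne
  have k1 : a ≠ v := fun e => hne.1 (congrArg p e)
  have k2 : b ≠ v := fun e => hne.2.1 (congrArg p e)
  have k3 : a ≠ b := fun e => hne.2.2 (congrArg p e)
  have hsub : ({z, (v, a, b), (a, b, v), (b, v, a)} : Finset (Pt × Pt × Pt)) ⊆
      O.filter (fun y => Inside p y x) := by
    intro y hy'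
    simp only [Finset.mem_insert, Finset.mem_singleton] at hy'
    rw [Finset.mem_filter]
    rcases hy' with rfl | rfl | rfl | rfl
    · exact ⟨hz, hzx⟩
    · exact ⟨hy, hyx⟩
    · exact ⟨h.disk.rot _ _ _ hy, hyx.rot⟩
    · exact ⟨h.disk.rot _ _ _ (h.disk.rot _ _ _ hy), hyx.rot.rot⟩
  have h2 := Finset.card_le_card hsub
  rw [Finset.card_insert_of_notMem, Finset.card_insert_of_notMem, Finset.card_insert_of_notMem,
    Finset.card_singleton] at h2
  · have h3 := h.insideCount_le hx
    have h4 : insideCount O p x = (O.filter (fun y => Inside p y x)).card := by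
      unfold insideCount Inside
      congr!
    omega
  · simp only [Finset.mem_singleton, Prod.mk.injEq]; tauto
  · simp only [Finset.mem_insert, Finset.mem_singleton, Prod.mk.injEq]
    rintro (⟨e, _⟩ | ⟨e, _⟩)
    · exact k1 e.symm
    · exact k2 e.symm
  · simp only [Finset.mem_insert, Finset.mem_singleton]; tauto

lemma Devel.support_hull (h : Devel Q O p) {v a : Pt}
    (hva : a ∈ firsts (fan O v) \ seconds (fan O v)) {x : Pt}
    (hx : x ∈ convexHull ℝ (p '' (Q : Set Pt))) : 0 ≤ ori (p v) (p a) x := by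
  refine ori_hull ?_ hx
  rintro _ ⟨q, hq, rfl⟩
  exact h.support hva hq

/-- Seen from a boundary vertex, generic points of the hull are covered. -/
lemma Devel.one_le_sepCount (h : Devel Q O p) {x : Pt}
    (hxQ : x ∈ convexHull ℝ (p '' (Q : Set Pt))) (hx : GenericPt O p x) {v : Pt} (hv : v ∈ Q) :
    1 ≤ sepCount (fan O v) p (-(toC x - toC (p v))) := by
  have htr := (hx.transverse h.disk.rot v).neg
  by_cases hi : firsts (fan O v) ⊆ seconds (fan O v)
  · rw [h.sepCount_int hv hi htr]
  obtain ⟨a, b, ha, hb⟩ := h.disk.exists_ends hi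
  have ham : a ∈ firsts (fan O v) \ seconds (fan O v) := by rw [ha]; simp
  have hbm : b ∈ seconds (fan O v) \ firsts (fan O v) := by rw [hb]; simp
  have hbm' : v ∈ firsts (fan O b) \ seconds (fan O b) := by
    rw [Finset.mem_sdiff, ← h.disk.mem_seconds_iff, h.disk.mem_seconds_iff (v := b)]
    exact Finset.mem_sdiff.1 hbm
  have h1 := h.support_hull ham hxQ
  have h2 := h.support_hull hbm' hxQ
  have e1 : cr (-(toC x - toC (p v))) (vec p v a) = ori (p v) (p a) x := by
    simp [cr_eq, vec, toC, ori]; ring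
  have e2 : cr (-(toC x - toC (p v))) (vec p v b) = -ori (p b) (p v) x := by
    simp [cr_eq, vec, toC, ori]; ring
  have h3 := (h.disk.isFan v).transverse_ends htr ha hb
  refine (h.disk.isFan v).one_le_sepCount (h.fan_pos v) htr ha hb ?_ ?_
  · rw [e1] at h3 ⊢
    exact lt_of_le_of_ne h1 (Ne.symm h3.1)
  · rw [e2] at h3 ⊢
    have : 0 ≠ ori (p b) (p v) x := fun e => h3.2 (by rw [← e]; simp)
    have := lt_of_le_of_ne h2 this
    linarith

lemma Devel.exists_inside (h : Devel Q O p) {x : Pt}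
    (hxQ : x ∈ convexHull ℝ (p '' (Q : Set Pt))) (hx : GenericPt O p x) :
    ∃ y ∈ O, Inside p y x := by
  by_contra hcon
  push Not at hcon
  have h0 : insideCount O p x = 0 := by
    rw [insideCount, Finset.card_eq_zero, Finset.filter_eq_empty_iff]
    exact fun {y} hy => hcon y hy
  have h1 := sum_sepCount_point h.disk.rot h.disk.mem h.pos hx
  have h2 := h.disk.euler
  rw [h0] at h1
  have h3 : ∑ v ∈ Q, (if firsts (fan O v) ⊆ seconds (fan O v) then (2 : ℝ) else 1) ≤
      ∑ v ∈ Q, ((sepCount (fan O v) p (toC x - toC (p v)) : ℝ)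
        + sepCount (fan O v) p (-(toC x - toC (p v)))) := by
    refine Finset.sum_le_sum fun v hv => ?_
    have h4 : (1 : ℝ) ≤ sepCount (fan O v) p (-(toC x - toC (p v))) := by
      exact_mod_cast h.one_le_sepCount hxQ hx hv
    split_ifs with hi
    · rw [h.sepCount_int hv hi (hx.transverse h.disk.rot v)]
      push_cast; linarith
    · have : (0 : ℝ) ≤ sepCount (fan O v) p (toC x - toC (p v)) := Nat.cast_nonneg _
      linarith
  rw [h1, ← h2] at h3
  norm_num at h3

lemma Devel.dense_generic (h : Devel Q O p) : Dense {x | GenericPt O p x} := by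
  have := dense_off_lines (O.image fun y => (p y.1, p y.2.1)) ?_
  · refine this.mono fun x (hx : ∀ l ∈ _, _) y hy => hx (p y.1, p y.2.1) ?_
    exact Finset.mem_image.2 ⟨y, hy, rfl⟩
  · intro l hl
    obtain ⟨y, hy, rfl⟩ := Finset.mem_image.1 hl
    exact (ne_of_ori (h.pos y hy)).1.symm

/-- Points of a triangle are limits of generic interior points. -/
lemma Devel.exists_generic_near (h : Devel Q O p) {y : Pt × Pt × Pt} (hy : y ∈ O) {w : Pt}
    (hw : 0 ≤ ori w (p y.2.1) (p y.2.2) ∧ 0 ≤ ori (p y.1) w (p y.2.2) ∧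
      0 ≤ ori (p y.1) (p y.2.1) w) {P : Pt → Prop} (hP : ∀ᶠ x in nhds w, P x) :
    ∃ x, Inside p y x ∧ GenericPt O p x ∧ P x := by
  obtain ⟨U, hUP, hU, hwU⟩ := mem_nhds_iff.1 hP
  have hpos := h.pos y hy
  -- move from `w` towards the barycentre
  set m : Pt := (1 / 3 : ℝ) • (p y.1 + p y.2.1 + p y.2.2) with hm
  have hc : Continuous fun t : ℝ => w + t • (m - w) := by fun_prop
  have h1 : ∀ᶠ t : ℝ in nhdsWithin 0 (Set.Ioi 0), w + t • (m - w) ∈ U := by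
    have := hc.tendsto 0
    simp only [zero_smul, add_zero] at this
    exact (this.mono_left nhdsWithin_le_nhds).eventually (hU.mem_nhds hwU)
  have h2 : ∀ᶠ t : ℝ in nhdsWithin 0 (Set.Ioi 0), t < 1 :=
    nhdsWithin_le_nhds (Iio_mem_nhds one_pos)
  obtain ⟨t, ⟨ht1, ht2⟩, ht0⟩ := ((h1.and h2).and self_mem_nhdsWithin).exists
  have ht0 : 0 < t := ht0
  have hin : Inside p y (w + t • (m - w)) := by
    have hD : 0 < t * (ori (p y.1) (p y.2.1) (p y.2.2) / 3) := by positivity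
    have e1 : ori (w + t • (m - w)) (p y.2.1) (p y.2.2) = (1 - t) * ori w (p y.2.1) (p y.2.2)
        + t * (ori (p y.1) (p y.2.1) (p y.2.2) / 3) := by
      simp [ori, hm]; ring
    have e2 : ori (p y.1) (w + t • (m - w)) (p y.2.2) = (1 - t) * ori (p y.1) w (p y.2.2)
        + t * (ori (p y.1) (p y.2.1) (p y.2.2) / 3) := by
      simp [ori, hm]; ring
    have e3 : ori (p y.1) (p y.2.1) (w + t • (m - w)) = (1 - t) * ori (p y.1) (p y.2.1) w
        + t * (ori (p y.1) (p y.2.1) (p y.2.2) / 3) := by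
      simp [ori, hm]; ring
    have ht : 0 ≤ 1 - t := by linarith
    refine ⟨?_, ?_, ?_⟩
    · rw [e1]; linarith [mul_nonneg ht hw.1]
    · rw [e2]; linarith [mul_nonneg ht hw.2.1]
    · rw [e3]; linarith [mul_nonneg ht hw.2.2]
  obtain ⟨x, ⟨hxU, hxi⟩, hxg⟩ := h.dense_generic.inter_open_nonempty _
    (hU.inter (isOpen_inside p y)) ⟨_, ht1, hin⟩
  exact ⟨x, hxi, hxg, hUP hxU⟩

end devel

end

section

/-- The point `x` lies in the closed triangle `p y`. -/
def InClosed (p : Pt → Pt) (y : Pt × Pt × Pt) (x : Pt) : Prop :=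
  0 ≤ ori x (p y.2.1) (p y.2.2) ∧ 0 ≤ ori (p y.1) x (p y.2.2) ∧ 0 ≤ ori (p y.1) (p y.2.1) x

lemma InClosed.rot {p : Pt → Pt} {v a b x : Pt} (h : InClosed p (v, a, b) x) :
    InClosed p (a, b, v) x := by
  obtain ⟨h1, h2, h3⟩ := h
  refine ⟨?_, ?_, ?_⟩ <;> simp only at *
  · rwa [ori_rot]
  · rwa [ori_rot]
  · rwa [ori_rot]

lemma Inside.inClosed {p : Pt → Pt} {y : Pt × Pt × Pt} {x : Pt} (h : Inside p y x) :
    InClosed p y x := ⟨h.1.le, h.2.1.le, h.2.2.le⟩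

/-- The vertex set of an ordered triangle. -/
def verts (y : Pt × Pt × Pt) : Finset Pt := {y.1, y.2.1, y.2.2}

lemma verts_rot (v a b : Pt) : verts (a, b, v) = verts (v, a, b) := by
  ext; simp only [verts, Finset.mem_insert, Finset.mem_singleton]; tauto

lemma image_verts (p : Pt → Pt) (y : Pt × Pt × Pt) :
    p '' (verts y : Set Pt) = {p y.1, p y.2.1, p y.2.2} := by
  simp [verts, Set.image_insert_eq]

lemma ori_bary (v a b w x y : Pt) : ori v a b * ori w x y =
    ori w a b * ori v x y + ori v w b * ori a x y + ori v a w * ori b x y := by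
  simp only [ori]; ring

lemma coord_bary (v a b w : Pt) (i : Fin 2) : ori v a b * w i =
    ori w a b * v i + ori v w b * a i + ori v a w * b i := by
  fin_cases i <;> simp only [ori] <;> simp <;> ring

lemma eq_of_ori_zero {v a b w : Pt} (h : 0 < ori v a b) (h2 : ori v w b = 0) (h3 : ori v a w = 0) :
    w = v := by
  have h1 := ori_split v a b w
  rw [h2, h3, add_zero, add_zero] at h1
  ext i
  have := coord_bary v a b w i
  rw [h2, h3, h1] at this
  have h4 : ori v a b * (w i - v i) = 0 := by linarith
  rcases mul_eq_zero.1 h4 with h5 | h5 <;> linarith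

section devel

variable {Q : Finset Pt} {O : Finset (Pt × Pt × Pt)} {p : Pt → Pt}

lemma Devel.inClosed_iff (h : Devel Q O p) {y : Pt × Pt × Pt} (hy : y ∈ O) (x : Pt) :
    InClosed p y x ↔ x ∈ convexHull ℝ (p '' (verts y : Set Pt)) := by
  rw [image_verts, mem_triangle_iff (h.pos y hy)]; rfl

lemma DiskComplex.verts_subset (h : DiskComplex Q O) {y : Pt × Pt × Pt} (hy : y ∈ O) :
    verts y ⊆ Q := by
  obtain ⟨v, a, b⟩ := y
  intro x hx
  simp only [verts, Finset.mem_insert, Finset.mem_singleton] at hx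
  rcases hx with rfl | rfl | rfl
  · exact h.mem _ _ _ hy
  · exact h.mem₂ hy
  · exact h.mem₃ hy

lemma Devel.mem_hull (h : Devel Q O p) {y : Pt × Pt × Pt} (hy : y ∈ O) {x : Pt}
    (hx : InClosed p y x) : x ∈ convexHull ℝ (p '' (Q : Set Pt)) :=
  convexHull_mono (Set.image_mono (Finset.coe_subset.2 (h.disk.verts_subset hy)))
    ((h.inClosed_iff hy x).1 hx)

lemma Devel.near_vertex (h : Devel Q O p) {v : Pt} (hv : v ∈ Q) :
    ∀ᶠ x in nhds (p v), x ∈ convexHull ℝ (p '' (Q : Set Pt)) → GenericPt O p x →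
      ∃ a b, (v, a, b) ∈ O ∧ Inside p (v, a, b) x := by
  have h1 : ∀ᶠ x in nhds (p v), ∀ y ∈ fan O v, 0 < ori x (p y.2.1) (p y.2.2) := by
    rw [Filter.eventually_all_finset]
    intro y hy
    have c1 : Continuous fun x => ori x (p y.2.1) (p y.2.2) := by unfold ori; fun_prop
    refine (c1.tendsto (p v)).eventually_const_lt ?_
    have := h.pos y (mem_fan.1 hy).1
    rwa [(mem_fan.1 hy).2] at this
  filter_upwards [h1] with x hx hxQ hxg
  have h2 := h.one_le_sepCount hxQ hxg hv
  obtain ⟨⟨v', a, b⟩, hy⟩ := Finset.card_pos.1 h2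
  obtain ⟨hy1, hy2, hy3⟩ := Finset.mem_filter.1 hy
  obtain ⟨hyO, hv'⟩ := mem_fan.1 hy1
  simp only at hv'
  subst hv'
  refine ⟨a, b, hyO, hx _ hy1, ?_, ?_⟩
  · have e2 : cr (-(toC x - toC (p v'))) (vec p v' b) = -ori (p v') x (p b) := by
      simp [cr_eq, vec, toC, ori]; ring
    simp only [e2] at hy3
    simpa using hy3
  · have e1 : cr (-(toC x - toC (p v'))) (vec p v' a) = ori (p v') (p a) x := by
      simp [cr_eq, vec, toC, ori]; ring
    simp only [e1] at hy2
    exact hy2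

lemma eventually_ori_pos {w v a : Pt} (h : 0 < ori w v a) :
    ∀ᶠ x in nhds w, 0 < ori x v a := by
  have c1 : Continuous fun x => ori x v a := by unfold ori; fun_prop
  exact (c1.tendsto w).eventually_const_lt h

lemma eventually_ori_pos_mid {w v a : Pt} (h : 0 < ori v w a) :
    ∀ᶠ x in nhds w, 0 < ori v x a := by
  have c1 : Continuous fun x => ori v x a := by unfold ori; fun_prop
  exact (c1.tendsto w).eventually_const_lt h

lemma DiskComplex.edge_or (h : DiskComplex Q O) {v a b : Pt} (hy : (v, a, b) ∈ O) :
    a ∈ firsts (fan O v) \ seconds (fan O v) ∨ ∃ c, (a, v, c) ∈ O := by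
  by_cases hc : ∃ c, (a, v, c) ∈ O
  · exact Or.inr hc
  · left
    rw [Finset.mem_sdiff, h.mem_seconds_iff, mem_firsts, mem_firsts]
    exact ⟨⟨b, hy⟩, hc⟩

/-- The coordinates of a point on an edge with respect to the triangle on the other side. -/
lemma pos_of_edge {v a b c w : Pt} (hb : 0 < ori v a b) (hc : 0 < ori a v c) (h0 : ori v a w = 0)
    (h1 : 0 < ori w a b) (h2 : 0 < ori v w b) : 0 < ori w v c ∧ 0 < ori a w c := by
  have e1 := ori_bary v a b w v c
  have e2 := ori_bary v a b w c a
  rw [h0, zero_mul, add_zero, ori_self_left, mul_zero, zero_add] at e1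
  rw [h0, zero_mul, add_zero, ori_self_outer a c, mul_zero, add_zero] at e2
  rw [ori_rot a w c] at e2
  have e3 : ori v c a = ori a v c := ori_rot a v c
  rw [e3] at e2
  constructor
  · have := mul_pos h2 hc
    rw [← e1] at this
    exact pos_of_mul_pos_right this hb.le
  · have := mul_pos h1 hc
    rw [← e2] at this
    exact pos_of_mul_pos_right this hb.le

lemma Devel.near_edge (h : Devel Q O p) {v a b w : Pt} (hy : (v, a, b) ∈ O)
    (h0 : ori (p v) (p a) w = 0) (h1 : 0 < ori w (p a) (p b)) (h2 : 0 < ori (p v) w (p b)) :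
    ∀ᶠ x in nhds w, x ∈ convexHull ℝ (p '' (Q : Set Pt)) → GenericPt O p x →
      Inside p (v, a, b) x ∨ ∃ c, (a, v, c) ∈ O ∧ Inside p (a, v, c) x := by
  rcases h.disk.edge_or hy with hb | ⟨c, hc⟩
  · filter_upwards [eventually_ori_pos h1, eventually_ori_pos_mid h2] with x hx1 hx2 hxQ hxg
    exact Or.inl ⟨hx1, hx2, lt_of_le_of_ne (h.support_hull hb hxQ) (hxg _ hy).symm⟩
  · obtain ⟨h3, h4⟩ := pos_of_edge (h.pos _ hy) (h.pos _ hc) h0 h1 h2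
    filter_upwards [eventually_ori_pos h1, eventually_ori_pos_mid h2, eventually_ori_pos h3,
      eventually_ori_pos_mid h4] with x hx1 hx2 hx3 hx4 hxQ hxg
    rcases lt_or_gt_of_ne (hxg _ hy) with h5 | h5
    · refine Or.inr ⟨c, hc, hx3, hx4, ?_⟩
      have : ori (p a) (p v) x = -ori (p v) (p a) x := by simp only [ori]; ring
      simp only at h5 ⊢
      linarith
    · exact Or.inl ⟨hx1, hx2, h5⟩

lemma Devel.verts_eq (h : Devel Q O p) {x : Pt} (hx : GenericPt O p x) {y z : Pt × Pt × Pt}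
    (hy : y ∈ O) (hz : z ∈ O) (hyx : Inside p y x) (hzx : Inside p z x) : verts z = verts y := by
  obtain ⟨v, a, b⟩ := y
  rcases h.inside_unique hx hy hz hyx hzx with rfl | rfl | rfl
  · rfl
  · exact verts_rot v a b
  · rw [verts_rot, verts_rot]

/-- A vertex lying in a closed triangle is a vertex of that triangle. -/
lemma Devel.vertex_mem (h : Devel Q O p) {v : Pt} (hv : v ∈ Q) {z : Pt × Pt × Pt} (hz : z ∈ O)
    (hvz : InClosed p z (p v)) : v ∈ verts z := by
  obtain ⟨x, hx1, hx2, hx3⟩ := h.exists_generic_near hz hvz (h.near_vertex hv)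
  obtain ⟨a, b, hab, hin⟩ := hx3 (h.mem_hull hz hx1.inClosed) hx2
  rw [h.verts_eq hx2 hab hz hin hx1]
  simp [verts]

lemma Devel.edge_mem (h : Devel Q O p) {v a b w : Pt} (hy : (v, a, b) ∈ O)
    (h0 : ori (p v) (p a) w = 0) (h1 : 0 < ori w (p a) (p b)) (h2 : 0 < ori (p v) w (p b))
    {z : Pt × Pt × Pt} (hz : z ∈ O) (hwz : InClosed p z w) : v ∈ verts z ∧ a ∈ verts z := by
  obtain ⟨x, hx1, hx2, hx3⟩ := h.exists_generic_near hz hwz (h.near_edge hy h0 h1 h2)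
  rcases hx3 (h.mem_hull hz hx1.inClosed) hx2 with hin | ⟨c, hc, hin⟩
  · rw [h.verts_eq hx2 hy hz hin hx1]
    simp [verts]
  · rw [h.verts_eq hx2 hc hz hin hx1]
    simp [verts]

lemma Devel.injOn (h : Devel Q O p) : Set.InjOn p (Q : Set Pt) := by
  intro v hv w hw e
  obtain ⟨a, b, hab⟩ := h.disk.vert w hw
  have hpos := h.pos _ hab
  have h1 : InClosed p (w, a, b) (p v) := by
    rw [e]
    refine ⟨hpos.le, ?_, ?_⟩ <;> simp only
    · rw [ori_self_left]
    · rw [ori_self_outer]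
  have h2 := h.vertex_mem hv hab h1
  simp only [verts, Finset.mem_insert, Finset.mem_singleton] at h2
  have hne := ne_of_ori hpos
  rcases h2 with h2 | h2 | h2
  · exact h2
  · rw [← h2] at hne; exact absurd e hne.1
  · rw [← h2] at hne; exact absurd e hne.2.1

lemma Devel.inter_of_edge (h : Devel Q O p) {v a b w : Pt} (hy : (v, a, b) ∈ O)
    (h0 : ori (p v) (p a) w = 0) (h1 : 0 ≤ ori w (p a) (p b)) (h2 : 0 ≤ ori (p v) w (p b))
    {z : Pt × Pt × Pt} (hz : z ∈ O) (hwz : InClosed p z w) :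
    w ∈ convexHull ℝ (p '' (verts (v, a, b) ∩ verts z : Finset Pt)) := by
  have hpos := h.pos _ hy
  simp only at hpos
  have hmem : ∀ u ∈ verts (v, a, b), u ∈ verts z →
      p u ∈ convexHull ℝ (p '' (verts (v, a, b) ∩ verts z : Finset Pt)) := fun u hu1 hu2 =>
    subset_convexHull ℝ _ ⟨u, by simpa using ⟨hu1, hu2⟩, rfl⟩
  rcases lt_or_eq_of_le h1 with h1 | h1
  · rcases lt_or_eq_of_le h2 with h2 | h2
    · obtain ⟨m1, m2⟩ := h.edge_mem hy h0 h1 h2 hz hwz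
      have hs := ori_split (p v) (p a) (p b) w
      rw [h0, add_zero] at hs
      have hw : w = (ori w (p a) (p b) / ori (p v) (p a) (p b)) • p v
          + (ori (p v) w (p b) / ori (p v) (p a) (p b)) • p a := by
        ext i
        have := coord_bary (p v) (p a) (p b) w i
        rw [h0] at this
        simp only [PiLp.add_apply, PiLp.smul_apply, smul_eq_mul]
        field_simp
        linarith
      rw [hw]
      refine (convex_convexHull ℝ _) (hmem v (by simp [verts]) m1) (hmem a (by simp [verts]) m2)
        (by positivity) (by positivity) ?_
      rw [← add_div, hs, div_self hpos.ne']
    · obtain rfl := eq_of_ori_zero hpos h2.symm h0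
      exact hmem v (by simp [verts]) (h.vertex_mem (h.disk.mem _ _ _ hy) hz hwz)
  · have hpos' : 0 < ori (p a) (p b) (p v) := by rw [ori_rot]; exact hpos
    have e1 : ori (p a) w (p v) = 0 := by rw [ori_rot]; exact h0
    have e2 : ori (p a) (p b) w = 0 := by rw [ori_rot]; exact h1.symm
    obtain rfl := eq_of_ori_zero hpos' e1 e2
    exact hmem a (by simp [verts]) (h.vertex_mem (h.disk.mem₂ hy) hz hwz)

/-- Two triangles meet in a common face. -/
lemma Devel.inter (h : Devel Q O p) {y z : Pt × Pt × Pt} (hy : y ∈ O) (hz : z ∈ O) {w : Pt}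
    (hwy : InClosed p y w) (hwz : InClosed p z w) :
    w ∈ convexHull ℝ (p '' (verts y ∩ verts z : Finset Pt)) := by
  obtain ⟨v, a, b⟩ := y
  have hy' := h.disk.rot _ _ _ hy
  have hy'' := h.disk.rot _ _ _ hy'
  have hwy' := hwy.rot
  have hwy'' := hwy'.rot
  rcases lt_or_eq_of_le hwy.2.2 with c3 | c3
  · rcases lt_or_eq_of_le hwy'.2.2 with c1 | c1
    · rcases lt_or_eq_of_le hwy''.2.2 with c2 | c2
      · have hin : Inside p (v, a, b) w := by
          refine ⟨?_, ?_, c3⟩ <;> simp only at *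
          · rwa [ori_rot] at c1
          · rwa [ori_rot, ori_rot] at c2
        obtain ⟨x, hx1, hx2, hx3⟩ := h.exists_generic_near hz hwz
          ((isOpen_inside p (v, a, b)).mem_nhds hin)
        rw [h.verts_eq hx2 hy hz hx3 hx1, Finset.inter_self]
        exact (h.inClosed_iff hy w).1 hwy
      · have := h.inter_of_edge hy'' c2.symm hwy''.1 hwy''.2.1 hz hwz
        rwa [verts_rot, verts_rot] at this
    · have := h.inter_of_edge hy' c1.symm hwy'.1 hwy'.2.1 hz hwz
      rwa [verts_rot] at this
  · exact h.inter_of_edge hy c3.symm hwy.1 hwy.2.1 hz hwz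

/-- The triangles cover the hull. -/
lemma Devel.cover (h : Devel Q O p) (hO : O.Nonempty) {x : Pt}
    (hx : x ∈ convexHull ℝ (p '' (Q : Set Pt))) : ∃ y ∈ O, InClosed p y x := by
  have hcl : IsClosed (⋃ y ∈ O, convexHull ℝ (p '' (verts y : Set Pt))) := by
    refine O.finite_toSet.isClosed_biUnion fun y _ => ?_
    exact ((verts y).finite_toSet.image p).isCompact_convexHull ℝ |>.isClosed
  have hinn : (interior (convexHull ℝ (p '' (Q : Set Pt)))).Nonempty := by
    obtain ⟨y, hy⟩ := hO
    have hc : InClosed p y (p y.1) := by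
      have hpos := h.pos _ hy
      refine ⟨hpos.le, ?_, ?_⟩
      · rw [ori_self_left]
      · rw [ori_self_outer]
    obtain ⟨x, hx, -⟩ := h.exists_generic_near hy hc Filter.univ_mem
    exact ⟨x, mem_interior.2 ⟨_, fun z hz => h.mem_hull hy (Inside.inClosed hz),
      isOpen_inside p y, hx⟩⟩
  have hsub : closure (interior (convexHull ℝ (p '' (Q : Set Pt))) ∩ {x | GenericPt O p x}) ⊆
      ⋃ y ∈ O, convexHull ℝ (p '' (verts y : Set Pt)) := by
    refine closure_minimal ?_ hcl
    rintro z ⟨hz1, hz2⟩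
    obtain ⟨y, hy, hin⟩ := h.exists_inside (interior_subset hz1) hz2
    simp only [Set.mem_iUnion]
    exact ⟨y, hy, (h.inClosed_iff hy z).1 hin.inClosed⟩
  have h2 : x ∈ closure (interior (convexHull ℝ (p '' (Q : Set Pt))) ∩ {x | GenericPt O p x}) := by
    refine closure_minimal (h.dense_generic.open_subset_closure_inter isOpen_interior)
      isClosed_closure ?_
    rw [(convex_convexHull ℝ _).closure_interior_eq_closure_of_nonempty_interior hinn]
    exact subset_closure hx
  have h3 := hsub h2
  simp only [Set.mem_iUnion] at h3
  obtain ⟨y, hy, hxy⟩ := h3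
  exact ⟨y, hy, (h.inClosed_iff hy x).2 hxy⟩

end devel

end

section

/-- The power of `x` with respect to the circumscribed circle of the triangle `v a b`. -/
def pow3 (v a b x : Pt) : ℝ :=
  (a 0 - x 0) * (b 0 - x 0) + (a 1 - x 1) * (b 1 - x 1) -
    ((a 0 - v 0) * (b 0 - v 0) + (a 1 - v 1) * (b 1 - v 1)) / ori v a b * ori x a b

lemma pow3_rot {v a b : Pt} (h : ori v a b ≠ 0) (x : Pt) : pow3 a b v x = pow3 v a b x := by
  have e := ori_rot v a b
  simp only [pow3, e]
  field_simp
  simp only [ori]; ring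

lemma pow3_vertex {v a b : Pt} (h : ori v a b ≠ 0) : pow3 v a b v = 0 := by
  simp only [pow3]; field_simp; ring

/-- The power of a point in terms of the circumcentre. -/
lemma pow3_eq_dist {v a b z : Pt} {r : ℝ} (h : ori v a b ≠ 0) (hv : dist z v = r) (ha : dist z a = r)
    (hb : dist z b = r) (x : Pt) : pow3 v a b x = dist z x ^ 2 - r ^ 2 := by
  have key : ∀ u : Pt, dist z u ^ 2 = (z 0 - u 0) ^ 2 + (z 1 - u 1) ^ 2 := by
    intro u
    rw [EuclideanSpace.dist_eq, Real.sq_sqrt (by positivity), Fin.sum_univ_two, Real.dist_eq,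
      Real.dist_eq, sq_abs, sq_abs]
  have hv' := key v
  have ha' := key a
  have hb' := key b
  rw [hv] at hv'
  rw [ha] at ha'
  rw [hb] at hb'
  rw [key x]
  simp only [pow3]
  apply mul_left_cancel₀ h
  have : ori v a b * ((a 0 - x 0) * (b 0 - x 0) + (a 1 - x 1) * (b 1 - x 1) -
      ((a 0 - v 0) * (b 0 - v 0) + (a 1 - v 1) * (b 1 - v 1)) / ori v a b * ori x a b)
      = ori v a b * ((a 0 - x 0) * (b 0 - x 0) + (a 1 - x 1) * (b 1 - x 1)) -
      ((a 0 - v 0) * (b 0 - v 0) + (a 1 - v 1) * (b 1 - v 1)) * ori x a b := by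
    field_simp
  rw [this]
  have e : ori x a b * r ^ 2 + ori v x b * r ^ 2 + ori v a x * r ^ 2 =
      ori x a b * ((z 0 - v 0) ^ 2 + (z 1 - v 1) ^ 2) +
      ori v x b * ((z 0 - a 0) ^ 2 + (z 1 - a 1) ^ 2) +
      ori v a x * ((z 0 - b 0) ^ 2 + (z 1 - b 1) ^ 2) := by
    rw [← hv', ← ha', ← hb']
  simp only [ori] at e ⊢
  linear_combination e

lemma dot_eq_re (v a b : Pt) : (a 0 - v 0) * (b 0 - v 0) + (a 1 - v 1) * (b 1 - v 1) =
    Complex.normSq (toC a - toC v) * ((toC b - toC v) / (toC a - toC v)).re := by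
  rcases eq_or_ne (toC a - toC v) 0 with h | h
  · rw [h]
    have h0 := congrArg Complex.re h
    have h1 := congrArg Complex.im h
    simp [toC] at h0 h1
    simp [h0, h1]
  · have h' : Complex.normSq (toC a - toC v) ≠ 0 := by simpa using h
    rw [Complex.div_re]
    field_simp
    simp [toC]; ring

lemma ori_eq_im_div (v a b : Pt) : ori v a b =
    Complex.normSq (toC a - toC v) * ((toC b - toC v) / (toC a - toC v)).im := by
  rcases eq_or_ne (toC a - toC v) 0 with h | h
  · rw [ori_eq_im, h]; simp
  · have h' : Complex.normSq (toC a - toC v) ≠ 0 := by simpa using h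
    rw [im_div_eq, ← ori_eq_im]
    field_simp

/-- Crossing an edge whose opposite angles add up to at most `π` decreases the power. -/
lemma pow3_le {v a b w x : Pt} (h : 0 < ori v a b) (hw : 0 < ori w b a)
    (hang : sang v a b + sang w b a ≤ π) (hx : ori x a b ≤ 0) : pow3 w b a x ≤ pow3 v a b x := by
  have s1 := sang_pos h
  have s2 := sang_pos hw
  have hsin : 0 ≤ Real.sin (sang v a b + sang w b a) :=
    Real.sin_nonneg_of_nonneg_of_le_pi (by linarith) hang
  have n1 : 0 < Complex.normSq (toC a - toC v) := by
    have := (ne_of_ori h).1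
    simpa [Complex.normSq_pos, sub_eq_zero] using fun h => this (toC_injective h)
  have n2 : 0 < Complex.normSq (toC b - toC w) := by
    have := (ne_of_ori hw).1
    simpa [Complex.normSq_pos, sub_eq_zero] using fun h => this (toC_injective h)
  have o1 := ori_eq_im_div v a b
  have o2 := ori_eq_im_div w b a
  have d1 := dot_eq_re v a b
  have d2 := dot_eq_re w b a
  set z := (toC b - toC v) / (toC a - toC v) with hz
  set u := (toC a - toC w) / (toC b - toC w) with hu
  have hzi : 0 < z.im := by
    have := o1 ▸ h
    exact (mul_pos_iff_of_pos_left n1).1 this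
  have hui : 0 < u.im := by
    have := o2 ▸ hw
    exact (mul_pos_iff_of_pos_left n2).1 this
  have e1 : z.re * u.im + z.im * u.re = ‖z‖ * ‖u‖ * Real.sin (sang v a b + sang w b a) := by
    have a1 := Complex.norm_mul_cos_arg z
    have a2 := Complex.norm_mul_sin_arg z
    have a3 := Complex.norm_mul_cos_arg u
    have a4 := Complex.norm_mul_sin_arg u
    rw [Real.sin_add, sang, sang, ← hz, ← hu, ← a1, ← a2, ← a3, ← a4]; ring_nf
  have e2 : 0 ≤ z.re / z.im + u.re / u.im := by
    rw [div_add_div _ _ hzi.ne' hui.ne', e1]; positivity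
  have c1 : ((a 0 - v 0) * (b 0 - v 0) + (a 1 - v 1) * (b 1 - v 1)) / ori v a b = z.re / z.im := by
    rw [d1, o1, mul_div_mul_left _ _ n1.ne']
  have c2 : ((b 0 - w 0) * (a 0 - w 0) + (b 1 - w 1) * (a 1 - w 1)) / ori w b a = u.re / u.im := by
    rw [d2, o2, mul_div_mul_left _ _ n2.ne']
  simp only [pow3, c1, c2]
  rw [ori_swap x a b]
  nlinarith [mul_nonneg e2 (neg_nonneg.2 hx)]

lemma eventually_combo_nonneg {A B : ℝ} (hA : 0 ≤ A) (h : 0 < A ∨ 0 ≤ B) :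
    ∀ᶠ σ : ℝ in nhdsWithin 0 (Set.Ioi 0), 0 ≤ (1 - σ) * A + σ * B := by
  rcases h with h | h
  · have c : Continuous fun σ : ℝ => (1 - σ) * A + σ * B := by fun_prop
    have := c.tendsto 0
    simp only [sub_zero, one_mul, zero_mul, add_zero] at this
    exact Filter.Eventually.filter_mono nhdsWithin_le_nhds
      ((this.eventually_const_lt h).mono fun _ h => h.le)
  · filter_upwards [Ioo_mem_nhdsGT (show (0 : ℝ) < 1 by norm_num)] with σ hσ
    have := hσ.1
    have : 0 < 1 - σ := by linarith [hσ.2]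
    positivity

lemma ori_combo_left (a b x y : Pt) {s t : ℝ} (h : s + t = 1) :
    ori (s • x + t • y) a b = s * ori x a b + t * ori y a b := by
  rw [← ori_rot, ori_combo a b x y h, ori_rot x, ori_rot y]

lemma ori_combo_mid (v b x y : Pt) {s t : ℝ} (h : s + t = 1) :
    ori v (s • x + t • y) b = s * ori v x b + t * ori v y b := by
  rw [ori_rot b v, ori_combo b v x y h, ← ori_rot b v x, ← ori_rot b v y]

/-- Moving a little from `w` towards `x` stays in a triangle. -/
lemma exists_stay {p : Pt → Pt} {y : Pt × Pt × Pt} {w x : Pt} (hw : InClosed p y w)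
    (h1 : 0 < ori w (p y.2.1) (p y.2.2) ∨ 0 ≤ ori x (p y.2.1) (p y.2.2))
    (h2 : 0 < ori (p y.1) w (p y.2.2) ∨ 0 ≤ ori (p y.1) x (p y.2.2))
    (h3 : 0 < ori (p y.1) (p y.2.1) w ∨ 0 ≤ ori (p y.1) (p y.2.1) x) :
    ∃ σ : ℝ, 0 < σ ∧ σ < 1 ∧ InClosed p y ((1 - σ) • w + σ • x) := by
  have := ((eventually_combo_nonneg hw.1 h1).and ((eventually_combo_nonneg hw.2.1 h2).and
    ((eventually_combo_nonneg hw.2.2 h3).and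
      (Ioo_mem_nhdsGT (show (0 : ℝ) < 1 by norm_num))))).exists
  obtain ⟨σ, g1, g2, g3, g4⟩ := this
  refine ⟨σ, g4.1, g4.2, ?_, ?_, ?_⟩
  · rwa [ori_combo_left _ _ _ _ (by ring)]
  · rwa [ori_combo_mid _ _ _ _ (by ring)]
  · rwa [ori_combo _ _ _ _ (by ring)]

variable {Q : Finset Pt} {O : Finset (Pt × Pt × Pt)} {p : Pt → Pt}

/-- The local Delaunay condition. -/
def LocDel (O : Finset (Pt × Pt × Pt)) (p : Pt → Pt) : Prop :=
  ∀ v a b w, (v, a, b) ∈ O → (w, b, a) ∈ O →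
    sang (p v) (p a) (p b) + sang (p w) (p b) (p a) ≤ π

lemma Devel.cross (h : Devel Q O p) (hloc : LocDel O p) {v a b w q : Pt} (hy : (v, a, b) ∈ O)
    (hq : q ∈ Q) (hwc : InClosed p (v, a, b) w) (hw : ori w (p a) (p b) = 0)
    (hwx : ori (p q) (p a) (p b) < 0) (hg : ∀ u ∈ Q, p u ≠ p q → w ≠ p u) :
    ∃ z ∈ O, pow3 (p z.1) (p z.2.1) (p z.2.2) (p q) ≤ pow3 (p v) (p a) (p b) (p q) ∧
      ∃ σ : ℝ, 0 < σ ∧ σ < 1 ∧ InClosed p z ((1 - σ) • w + σ • (p q)) := by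
  have hpos : 0 < ori (p v) (p a) (p b) := h.pos _ hy
  have hra := h.disk.rot _ _ _ hy
  have qa : p a ≠ p q := fun e => by rw [← e, ori_self_left] at hwx; exact hwx.false
  have qb : p b ≠ p q := fun e => by rw [← e, ori_self_outer] at hwx; exact hwx.false
  have ha : 0 < ori (p v) w (p b) := by
    refine lt_of_le_of_ne hwc.2.1 fun e => hg b (h.disk.mem₃ hy) qb ?_
    refine eq_of_ori_zero (v := p b) (a := p v) (b := p a) (by rw [ori_rot, ori_rot]; exact hpos) ?_ ?_
    · rw [← ori_rot]; exact hw
    · rw [ori_rot, ori_rot]; exact e.symm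
  have hb : 0 < ori (p v) (p a) w := by
    refine lt_of_le_of_ne hwc.2.2 fun e => hg a (h.disk.mem₂ hy) qa ?_
    refine eq_of_ori_zero (v := p a) (a := p b) (b := p v) (by rw [ori_rot]; exact hpos) ?_ ?_
    · rw [ori_rot]; exact e.symm
    · rw [ori_rot]; exact hw
  rcases h.disk.edge_or hra with hs | ⟨c, hc⟩
  · have := h.support hs hq
    rw [ori_rot] at this
    exact absurd hwx (not_lt.2 this)
  · have hcp : 0 < ori (p b) (p a) (p c) := h.pos _ hc
    have hcr := h.disk.rot _ _ _ (h.disk.rot _ _ _ hc)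
    obtain ⟨k1, k2⟩ := pos_of_edge (v := p a) (a := p b) (b := p v) (c := p c) (w := w)
      (by rw [ori_rot]; exact hpos) hcp (by rw [ori_rot]; exact hw)
      (by rw [ori_rot]; exact ha) (by rw [ori_rot]; exact hb)
    have hcp' : 0 < ori (p c) (p b) (p a) := h.pos _ hcr
    refine ⟨(c, b, a), hcr, pow3_le hpos hcp' (hloc _ _ _ _ hy hcr) hwx.le, ?_⟩
    have e1 : ori w (p b) (p a) = 0 := by rw [ori_swap, hw, neg_zero]
    have e2 : 0 < ori (p c) w (p a) := by rw [← ori_rot]; exact k1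
    have e3 : 0 < ori (p c) (p b) w := by rw [← ori_rot]; exact k2
    refine exists_stay ⟨e1.ge, e2.le, e3.le⟩ (Or.inr ?_) (Or.inl e2) (Or.inl e3)
    show 0 ≤ ori (p q) (p b) (p a)
    rw [ori_swap]; linarith

lemma Devel.step (h : Devel Q O p) (hloc : LocDel O p) {y : Pt × Pt × Pt} {w q : Pt} (hy : y ∈ O)
    (hq : q ∈ Q) (hwc : InClosed p y w) (hg : ∀ u ∈ Q, p u ≠ p q → w ≠ p u) :
    ∃ z ∈ O, pow3 (p z.1) (p z.2.1) (p z.2.2) (p q) ≤ pow3 (p y.1) (p y.2.1) (p y.2.2) (p q) ∧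
      ∃ σ : ℝ, 0 < σ ∧ σ < 1 ∧ InClosed p z ((1 - σ) • w + σ • (p q)) := by
  by_cases h1 : 0 < ori w (p y.2.1) (p y.2.2) ∨ 0 ≤ ori (p q) (p y.2.1) (p y.2.2)
  swap
  · obtain ⟨v, a, b⟩ := y
    push Not at h1
    exact h.cross hloc hy hq hwc (le_antisymm h1.1 hwc.1) h1.2 hg
  by_cases h2 : 0 < ori (p y.1) w (p y.2.2) ∨ 0 ≤ ori (p y.1) (p q) (p y.2.2)
  swap
  · obtain ⟨v, a, b⟩ := y
    push Not at h2
    have hpos : 0 < ori (p v) (p a) (p b) := h.pos _ hy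
    have e := h.cross hloc (h.disk.rot _ _ _ hy) hq hwc.rot
      (by rw [ori_rot]; exact le_antisymm h2.1 hwc.2.1) (by rw [ori_rot]; exact h2.2) hg
    rwa [pow3_rot hpos.ne'] at e
  by_cases h3 : 0 < ori (p y.1) (p y.2.1) w ∨ 0 ≤ ori (p y.1) (p y.2.1) (p q)
  swap
  · obtain ⟨v, a, b⟩ := y
    push Not at h3
    have hpos : 0 < ori (p v) (p a) (p b) := h.pos _ hy
    have hpos' : 0 < ori (p a) (p b) (p v) := by rw [ori_rot]; exact hpos
    have e := h.cross hloc (h.disk.rot _ _ _ (h.disk.rot _ _ _ hy)) hq hwc.rot.rot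
      (by rw [← ori_rot]; exact le_antisymm h3.1 hwc.2.2) (by rw [← ori_rot]; exact h3.2) hg
    rwa [pow3_rot hpos'.ne', pow3_rot hpos.ne'] at e
  exact ⟨y, hy, le_rfl, exists_stay hwc h1 h2 h3⟩

lemma isClosed_inClosed (p : Pt → Pt) (y : Pt × Pt × Pt) : IsClosed {x | InClosed p y x} := by
  have c1 : Continuous fun x => ori x (p y.2.1) (p y.2.2) := by unfold ori; fun_prop
  have c2 : Continuous fun x => ori (p y.1) x (p y.2.2) := by unfold ori; fun_prop
  have c3 : Continuous fun x => ori (p y.1) (p y.2.1) x := by unfold ori; fun_prop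
  exact (isClosed_le continuous_const c1).inter
    ((isClosed_le continuous_const c2).inter (isClosed_le continuous_const c3))

lemma Devel.pow3_nonneg (h : Devel Q O p) (hloc : LocDel O p) {t : Pt × Pt × Pt} (ht : t ∈ O) {q : Pt}
    (hq : q ∈ Q) : 0 ≤ pow3 (p t.1) (p t.2.1) (p t.2.2) (p q) := by
  set x := p q with hx
  set L : Finset (Pt × Pt) := (Q.filter fun u => p u ≠ x).image fun u => (x, p u) with hL
  obtain ⟨s, hs, hsg⟩ : ∃ s, Inside p t s ∧ ∀ u ∈ Q, p u ≠ x → ori x (p u) s ≠ 0 := by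
    have hd := dense_off_lines L (by
      intro l hl
      obtain ⟨u, hu, rfl⟩ := Finset.mem_image.1 hl
      exact (Finset.mem_filter.1 hu).2.symm)
    have hne : {s | Inside p t s}.Nonempty := by
      obtain ⟨s, hs, -⟩ := h.exists_generic_near ht (w := p t.1) (P := fun _ => True)
        ⟨(h.pos t ht).le, by rw [ori_self_left], by rw [ori_self_outer]⟩ (by simp)
      exact ⟨s, hs⟩
    obtain ⟨s, hs, hs'⟩ := hd.inter_open_nonempty _ (isOpen_inside p t) hne
    refine ⟨s, hs, fun u hu hux => hs' (x, p u) ?_⟩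
    exact Finset.mem_image.2 ⟨u, Finset.mem_filter.2 ⟨hu, hux⟩, rfl⟩
  set γ : ℝ → Pt := fun τ => (1 - τ) • s + τ • x with hγ
  have hγc : Continuous γ := by fun_prop
  set A : Set ℝ := Set.Icc 0 1 ∩ ⋃ y ∈ O.filter (fun y =>
    pow3 (p y.1) (p y.2.1) (p y.2.2) x ≤ pow3 (p t.1) (p t.2.1) (p t.2.2) x),
      γ ⁻¹' {z | InClosed p y z} with hA
  have hAc : IsCompact A := isCompact_Icc.inter_right
    ((Finset.finite_toSet _).isClosed_biUnion fun y _ => (isClosed_inClosed p y).preimage hγc)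
  have hmem : ∀ τ, τ ∈ A ↔ (0 ≤ τ ∧ τ ≤ 1) ∧ ∃ y ∈ O,
      pow3 (p y.1) (p y.2.1) (p y.2.2) x ≤ pow3 (p t.1) (p t.2.1) (p t.2.2) x ∧
      InClosed p y (γ τ) := by
    intro τ
    simp only [hA, Set.mem_inter_iff, Set.mem_Icc, Set.mem_iUnion, Finset.mem_filter,
      Set.mem_preimage, Set.mem_ofPred_eq, exists_prop, and_assoc]
  have hA0 : (0 : ℝ) ∈ A := by
    rw [hmem]
    refine ⟨⟨le_rfl, zero_le_one⟩, t, ht, le_rfl, ?_⟩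
    simpa [hγ] using hs.inClosed
  obtain ⟨τ, hτ, hmax⟩ := hAc.exists_isGreatest ⟨0, hA0⟩
  obtain ⟨⟨hτ0, hτ1⟩, y, hy, hyp, hyc⟩ := (hmem τ).1 hτ
  rcases hτ1.eq_or_lt with rfl | hlt
  · have e : γ 1 = p q := by simp [hγ, hx]
    rw [e] at hyc
    have hv := h.vertex_mem hq hy hyc
    refine le_trans (le_of_eq ?_) hyp
    obtain ⟨v, a, b⟩ := y
    have hpos : 0 < ori (p v) (p a) (p b) := h.pos _ hy
    have hpos' : 0 < ori (p a) (p b) (p v) := by rw [ori_rot]; exact hpos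
    have hpos'' : 0 < ori (p b) (p v) (p a) := by rw [ori_rot]; exact hpos'
    simp only [verts, Finset.mem_insert, Finset.mem_singleton] at hv
    simp only
    rcases hv with rfl | rfl | rfl
    · exact (pow3_vertex hpos.ne').symm
    · rw [← pow3_rot hpos.ne']
      exact (pow3_vertex hpos'.ne').symm
    · rw [← pow3_rot hpos.ne', ← pow3_rot hpos'.ne']
      exact (pow3_vertex hpos''.ne').symm
  · exfalso
    have hg : ∀ u ∈ Q, p u ≠ p q → γ τ ≠ p u := by
      intro u hu hux e
      have := hsg u hu hux
      have e2 : ori x (p u) (γ τ) = 0 := by rw [e, ori_self_right]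
      rw [hγ] at e2
      simp only at e2
      rw [ori_combo _ _ _ _ (by ring), ori_self_outer, mul_zero, add_zero] at e2
      exact (mul_ne_zero (by linarith) this) e2
    obtain ⟨z, hz, hzp, σ, hσ0, hσ1, hzc⟩ := h.step hloc hy hq hyc hg
    have e : (1 - σ) • γ τ + σ • p q = γ (τ + σ * (1 - τ)) := by
      simp only [hγ, ← hx]; module
    rw [e] at hzc
    have hpos : 0 < σ * (1 - τ) := mul_pos hσ0 (by linarith)
    have : τ + σ * (1 - τ) ∈ A := by
      rw [hmem]
      exact ⟨⟨by linarith, by nlinarith⟩, z, hz, hzp.trans hyp, hzc⟩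
    have := hmax this
    linarith

end

section

lemma collinear_of_ori {v a b : Pt} (h : ori v a b = 0) : Collinear ℝ ({v, a, b} : Set Pt) := by
  rcases eq_or_ne a v with rfl | hav
  · rw [Set.insert_eq_of_mem (Set.mem_insert _ _)]; exact collinear_pair ℝ _ _
  have hn : (a 0 - v 0) ^ 2 + (a 1 - v 1) ^ 2 ≠ 0 := by
    intro h0
    apply hav
    have h1 : a 0 - v 0 = 0 := by nlinarith [sq_nonneg (a 0 - v 0), sq_nonneg (a 1 - v 1)]
    have h2 : a 1 - v 1 = 0 := by nlinarith [sq_nonneg (a 0 - v 0), sq_nonneg (a 1 - v 1)]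
    ext i; fin_cases i
    · simpa [sub_eq_zero] using h1
    · simpa [sub_eq_zero] using h2
  rw [collinear_iff_of_mem (p₀ := v) (by simp)]
  refine ⟨a - v, ?_⟩
  intro q hq
  simp only [Set.mem_insert_iff, Set.mem_singleton_iff] at hq
  rcases hq with rfl | rfl | rfl
  · exact ⟨0, by simp⟩
  · exact ⟨1, by simp⟩
  · refine ⟨((a 0 - v 0) * (q 0 - v 0) + (a 1 - v 1) * (q 1 - v 1)) /
      ((a 0 - v 0) ^ 2 + (a 1 - v 1) ^ 2), ?_⟩
    simp only [ori] at h
    ext i; fin_cases i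
    · simp; field_simp; linear_combination (-(a 1 - v 1)) * h
    · simp; field_simp; linear_combination (a 0 - v 0) * h

lemma ori_of_collinear {v a b : Pt} (h : Collinear ℝ ({v, a, b} : Set Pt)) : ori v a b = 0 := by
  rw [collinear_iff_of_mem (p₀ := v) (by simp)] at h
  obtain ⟨w, hw⟩ := h
  obtain ⟨r, rfl⟩ := hw a (by simp)
  obtain ⟨s, rfl⟩ := hw b (by simp)
  simp [ori]; ring

lemma ori_ne_zero_of_indep {v a b : Pt}
    (h : AffineIndependent ℝ (fun p : ({v, a, b} : Finset Pt) => (p : Pt)))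
    (h1 : v ≠ a) (h2 : v ≠ b) (h3 : a ≠ b) : ori v a b ≠ 0 := by
  intro h0
  let f : Fin 3 ↪ ({v, a, b} : Finset Pt) :=
    ⟨![⟨v, by simp⟩, ⟨a, by simp⟩, ⟨b, by simp⟩], by
      intro i j hij
      fin_cases i <;> fin_cases j <;> simp_all⟩
  have h4 := h.comp_embedding f
  have h5 : (fun p : ({v, a, b} : Finset Pt) => (p : Pt)) ∘ f = ![v, a, b] := by
    ext i : 1; fin_cases i <;> rfl
  rw [h5, affineIndependent_iff_not_collinear_set] at h4
  exact h4 (collinear_of_ori h0)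

lemma indep_of_ori {v a b : Pt} (h : ori v a b ≠ 0) {t : Finset Pt} (ht : t = {v, a, b}) :
    AffineIndependent ℝ (fun p : t => (p : Pt)) := by
  have h1 : AffineIndependent ℝ ![v, a, b] :=
    affineIndependent_iff_not_collinear_set.2 fun h2 => h (ori_of_collinear h2)
  have h2 := h1.range
  have h3 : Set.range ![v, a, b] = (t : Set Pt) := by
    subst ht; ext x; simp; tauto
  rw [h3] at h2
  exact h2

/-- The positively oriented triangles of `K`, as ordered triples. -/
def otri (K : Finset (Finset Pt)) : Finset (Pt × Pt × Pt) :=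
  ((K.biUnion id) ×ˢ ((K.biUnion id) ×ˢ (K.biUnion id))).filter
    fun x => verts x ∈ K ∧ 0 < ori x.1 x.2.1 x.2.2

lemma mem_otri {K : Finset (Finset Pt)} {x : Pt × Pt × Pt} :
    x ∈ otri K ↔ verts x ∈ K ∧ 0 < ori x.1 x.2.1 x.2.2 := by
  simp only [otri, Finset.mem_filter, Finset.mem_product, Finset.mem_biUnion, id, and_iff_right_iff_imp]
  rintro ⟨h, -⟩
  exact ⟨⟨_, h, by simp [verts]⟩, ⟨_, h, by simp [verts]⟩, ⟨_, h, by simp [verts]⟩⟩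

variable {K : Finset (Finset Pt)} {Q : Finset Pt}

lemma otri_rot {v a b : Pt} (h : (v, a, b) ∈ otri K) : (a, b, v) ∈ otri K := by
  rw [mem_otri] at *
  rw [verts_rot]
  exact ⟨h.1, by simpa only [ori_rot] using h.2⟩

lemma IsTriangulationOf.exists_orient (hK : IsTriangulationOf K Q) {t : Finset Pt} (ht : t ∈ K) {v : Pt}
    (hv : v ∈ t) : ∃ a b, (v, a, b) ∈ otri K ∧ t = verts (v, a, b) := by
  have h1 : (t.erase v).card = 2 := by rw [Finset.card_erase_of_mem hv, hK.card3 t ht]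
  obtain ⟨a, b, hab, he⟩ := Finset.card_eq_two.1 h1
  have hva : v ≠ a := by
    rintro rfl; exact Finset.notMem_erase v t (he ▸ Finset.mem_insert_self _ _)
  have hvb : v ≠ b := by
    rintro rfl; exact Finset.notMem_erase v t (he ▸ by simp)
  have hte : t = {v, a, b} := by rw [← Finset.insert_erase hv, he]
  subst hte
  have h0 := ori_ne_zero_of_indep (hK.indep _ ht) hva hvb hab
  rcases lt_or_gt_of_ne h0 with h0 | h0
  · refine ⟨b, a, mem_otri.2 ⟨?_, by simp only; rw [ori_swap]; linarith⟩, ?_⟩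
    · simpa only [verts, Finset.pair_comm] using ht
    · simp only [verts, Finset.pair_comm]
  · exact ⟨a, b, mem_otri.2 ⟨ht, h0⟩, rfl⟩

/-- The vertex sets of positively oriented triangles determine them up to rotation. -/
lemma eq_of_verts {v a b a' b' : Pt} (h : 0 < ori v a b) (h' : 0 < ori v a' b')
    (he : verts (v, a, b) = verts (v, a', b')) : a = a' ∧ b = b' := by
  obtain ⟨n1, n2, n3⟩ := ne_of_ori h
  obtain ⟨m1, m2, m3⟩ := ne_of_ori h'
  have ha : a ∈ verts (v, a', b') := he ▸ by simp [verts]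
  have hb : b ∈ verts (v, a', b') := he ▸ by simp [verts]
  simp only [verts, Finset.mem_insert, Finset.mem_singleton] at ha hb
  rcases ha with ha | ha | ha <;> rcases hb with hb | hb | hb
  all_goals first | exact absurd ha n1 | exact absurd hb n2 | exact ⟨ha, hb⟩ | skip
  · exact absurd (ha.trans hb.symm) n3
  · subst ha hb; rw [ori_swap] at h'; linarith
  · exact absurd (ha.trans hb.symm) n3

lemma inClosed_id_iff {y : Pt × Pt × Pt} (h : 0 < ori y.1 y.2.1 y.2.2) (x : Pt) :
    InClosed id y x ↔ x ∈ convexHull ℝ (verts y : Set Pt) := by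
  have : (verts y : Set Pt) = {y.1, y.2.1, y.2.2} := by simp [verts]
  rw [this, mem_triangle_iff h]; rfl

lemma IsTriangulationOf.inter_otri (hK : IsTriangulationOf K Q) {y z : Pt × Pt × Pt} (hy : y ∈ otri K)
    (hz : z ∈ otri K) {x : Pt} (hxy : InClosed id y x) (hxz : InClosed id z x) :
    x ∈ convexHull ℝ ((verts y ∩ verts z : Finset Pt) : Set Pt) := by
  rw [mem_otri] at hy hz
  rw [inClosed_id_iff hy.2] at hxy
  rw [inClosed_id_iff hz.2] at hxz
  by_cases h : verts y = verts z
  · rw [← h, Finset.inter_self]; exact hxy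
  · rw [← hK.inter _ hy.1 _ hz.1 h]; exact ⟨hxy, hxz⟩

lemma ori_eq_zero_of_hull {v a x : Pt} {s : Set Pt} (h : ∀ q ∈ s, ori v a q = 0)
    (hx : x ∈ convexHull ℝ s) : ori v a x = 0 := by
  apply le_antisymm
  · have := ori_hull (v := a) (a := v) (fun q hq => by rw [ori_rot, ori_swap, ← ori_rot, h q hq] at *; simp) hx
    have e : ori a v x = - ori v a x := by simp only [ori]; ring
    linarith
  · exact ori_hull (fun q hq => (h q hq).ge) hx

/-- A point of a triangle off the edge opposite to `v` is only in triangles with vertex `v`. -/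
lemma IsTriangulationOf.mem_of_pos (hK : IsTriangulationOf K Q) {v a b : Pt} {z : Pt × Pt × Pt}
    (hy : (v, a, b) ∈ otri K) (hz : z ∈ otri K) {x : Pt} (hxy : InClosed id (v, a, b) x)
    (hxz : InClosed id z x) (h : 0 < ori x a b) : v ∈ verts z := by
  by_contra hv
  have h1 := hK.inter_otri hy hz hxy hxz
  have h2 : ori a b x = 0 := by
    refine ori_eq_zero_of_hull ?_ h1
    intro q hq
    simp only [Finset.coe_inter, Set.mem_inter_iff, Finset.mem_coe, verts, Finset.mem_insert,
      Finset.mem_singleton] at hq hv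
    rcases hq with ⟨rfl | rfl | rfl, hq2⟩
    · exact absurd hq2 hv
    · exact ori_self_outer _ _
    · exact ori_self_right _ _
  rw [ori_rot] at h2
  exact h.ne' h2

lemma IsTriangulationOf.verts_eq (hK : IsTriangulationOf K Q) {y z : Pt × Pt × Pt}
    (hy : y ∈ otri K) (hz : z ∈ otri K) {x : Pt} (hxy : Inside id y x)
    (hxz : InClosed id z x) : verts z = verts y := by
  symm
  obtain ⟨v, a, b⟩ := y
  apply Finset.eq_of_subset_of_card_le
  · intro q hq
    simp only [verts, Finset.mem_insert, Finset.mem_singleton] at hq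
    rcases hq with rfl | rfl | rfl
    · exact hK.mem_of_pos hy hz hxy.inClosed hxz hxy.1
    · exact hK.mem_of_pos (otri_rot hy) hz hxy.inClosed.rot hxz hxy.rot.1
    · exact hK.mem_of_pos (otri_rot (otri_rot hy)) hz hxy.inClosed.rot.rot hxz hxy.rot.rot.1
  · rw [hK.card3 _ (mem_otri.1 hy).1, hK.card3 _ (mem_otri.1 hz).1]

lemma inClosed_vertex {v a b : Pt} (h : 0 < ori v a b) : InClosed id (v, a, b) v :=
  ⟨h.le, by simp [ori_self_left], by simp [ori_self_outer]⟩

lemma IsTriangulationOf.vertex_mem (hK : IsTriangulationOf K Q) {v : Pt} (hv : v ∈ Q)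
    {z : Pt × Pt × Pt} (hz : z ∈ otri K) (hvz : InClosed id z v) : v ∈ verts z := by
  obtain ⟨t, ht, hvt⟩ := hK.vertex v hv
  obtain ⟨a, b, hab, -⟩ := hK.exists_orient ht hvt
  have := (mem_otri.1 hab).2
  exact hK.mem_of_pos hab hz (inClosed_vertex this) hvz this

end

section

variable {K : Finset (Finset Pt)} {Q : Finset Pt}

lemma IsTriangulationOf.cover_otri (hK : IsTriangulationOf K Q) {x : Pt}
    (hx : x ∈ convexHull ℝ (Q : Set Pt)) : ∃ z ∈ otri K, InClosed id z x := by
  rw [← hK.cover] at hx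
  simp only [Set.mem_iUnion] at hx
  obtain ⟨t, ht, hxt⟩ := hx
  have hne : t.Nonempty := Finset.card_pos.1 (by rw [hK.card3 t ht]; norm_num)
  obtain ⟨v, hv⟩ := hne
  obtain ⟨a, b, hab, rfl⟩ := hK.exists_orient ht hv
  exact ⟨_, hab, (inClosed_id_iff (mem_otri.1 hab).2 x).2 hxt⟩

/-- A segment starting at `w` starts inside some triangle. -/
lemma IsTriangulationOf.approach (hK : IsTriangulationOf K Q) {w q : Pt}
    (hw : w ∈ convexHull ℝ (Q : Set Pt)) (hq : q ∈ convexHull ℝ (Q : Set Pt)) :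
    ∃ z ∈ otri K, InClosed id z w ∧ ∃ σ : ℝ, 0 < σ ∧ σ < 1 ∧ InClosed id z ((1 - σ) • w + σ • q) := by
  by_contra hcon
  push Not at hcon
  have h1 : ∀ᶠ σ : ℝ in nhdsWithin 0 (Set.Ioi 0), ∀ z ∈ otri K,
      ¬ InClosed id z ((1 - σ) • w + σ • q) := by
    rw [Filter.eventually_all_finset]
    intro z hz
    by_cases hzw : InClosed id z w
    · filter_upwards [Ioo_mem_nhdsGT (show (0 : ℝ) < 1 by norm_num)] with σ hσ
      exact hcon z hz hzw σ hσ.1 hσ.2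
    · have hc : Continuous fun σ : ℝ => (1 - σ) • w + σ • q := by fun_prop
      have h2 := (isClosed_inClosed id z).isOpen_compl.preimage hc
      exact nhdsWithin_le_nhds (h2.mem_nhds (by simpa using hzw))
  obtain ⟨σ, h2, h3⟩ := (h1.and (Ioo_mem_nhdsGT (show (0 : ℝ) < 1 by norm_num))).exists
  obtain ⟨z, hz, hzc⟩ := hK.cover_otri
    ((convex_convexHull ℝ (Q : Set Pt)) hw hq (sub_nonneg.2 h3.2.le) h3.1.le (by ring))
  exact h2 z hz hzc

lemma IsTriangulationOf.reorient (hK : IsTriangulationOf K Q) {z : Pt × Pt × Pt} (hz : z ∈ otri K)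
    {v : Pt} (hv : v ∈ verts z) : ∃ a b, (v, a, b) ∈ otri K ∧ verts (v, a, b) = verts z ∧
      ∀ x, InClosed id z x → InClosed id (v, a, b) x := by
  obtain ⟨a, b, hab, he⟩ := hK.exists_orient (mem_otri.1 hz).1 hv
  refine ⟨a, b, hab, he.symm, fun x hx => ?_⟩
  rw [inClosed_id_iff (mem_otri.1 hz).2] at hx
  rw [inClosed_id_iff (mem_otri.1 hab).2, ← he]
  exact hx

lemma IsTriangulationOf.mem_Q (hK : IsTriangulationOf K Q) {v a b : Pt} (h : (v, a, b) ∈ otri K) :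
    v ∈ Q := hK.subset _ (mem_otri.1 h).1 (by simp [verts])

/-- The cones at `v` of the triangles at `v` cover the convex hull. -/
lemma IsTriangulationOf.cone_cover (hK : IsTriangulationOf K Q) {v q : Pt} (hv : v ∈ Q)
    (hq : q ∈ convexHull ℝ (Q : Set Pt)) :
    ∃ a b, (v, a, b) ∈ otri K ∧ 0 ≤ ori v a q ∧ 0 ≤ ori v q b := by
  obtain ⟨z, hz, hzv, σ, hσ0, hσ1, hzσ⟩ := hK.approach (subset_convexHull ℝ _ hv) hq
  obtain ⟨a, b, hab, -, hx⟩ := hK.reorient hz (hK.vertex_mem hv hz hzv)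
  obtain ⟨-, h2, h3⟩ := hx _ hzσ
  refine ⟨a, b, hab, ?_, ?_⟩
  · simp only [id] at h3
    rw [ori_combo _ _ _ _ (by ring), ori_self_outer, mul_zero, zero_add] at h3
    exact nonneg_of_mul_nonneg_right h3 hσ0
  · simp only [id] at h2
    rw [ori_combo_mid _ _ _ _ (by ring), ori_self_left, mul_zero, zero_add] at h2
    exact nonneg_of_mul_nonneg_right h2 hσ0

/-- The midpoint of two points. -/
def mid (u v : Pt) : Pt := (1 / 2 : ℝ) • u + (1 / 2 : ℝ) • v

lemma mid_facts {v a b : Pt} (h : 0 < ori v a b) : 0 < ori (mid v a) a b ∧ 0 < ori v (mid v a) b ∧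
    ori v a (mid v a) = 0 := by
  refine ⟨?_, ?_, ?_⟩
  · rw [mid, ori_combo_left _ _ _ _ (by norm_num), ori_self_left]; linarith
  · rw [mid, ori_combo_mid _ _ _ _ (by norm_num), ori_self_left]; linarith
  · rw [mid, ori_combo _ _ _ _ (by norm_num), ori_self_outer, ori_self_right]; simp

/-- An edge with a point of `Q` on its other side is in a second triangle. -/
lemma IsTriangulationOf.exists_left (hK : IsTriangulationOf K Q) {u v b q : Pt}
    (h : (u, v, b) ∈ otri K) (hq : q ∈ convexHull ℝ (Q : Set Pt)) (ho : 0 < ori v u q) :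
    ∃ c, (v, u, c) ∈ otri K := by
  have hpos : 0 < ori u v b := (mem_otri.1 h).2
  obtain ⟨m1, m2, m3⟩ := mid_facts hpos
  have hMc : InClosed id (u, v, b) (mid u v) := ⟨m1.le, m2.le, m3.ge⟩
  have hu := hK.mem_Q h
  have hv := hK.mem_Q (otri_rot h)
  have hM : mid u v ∈ convexHull ℝ (Q : Set Pt) :=
    convex_convexHull ℝ _ (subset_convexHull ℝ _ hu) (subset_convexHull ℝ _ hv) (by norm_num)
      (by norm_num) (by norm_num)
  obtain ⟨z, hz, hzM, σ, hσ0, hσ1, hzσ⟩ := hK.approach hM hq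
  have huz := hK.mem_of_pos h hz hMc hzM m1
  have hvz := hK.mem_of_pos (otri_rot h) hz hMc.rot hzM (by simpa only [ori_rot] using m2)
  obtain ⟨c, c', hcc, he, hx⟩ := hK.reorient hz hvz
  have huv := (ne_of_ori hpos).1
  rw [← he] at huz
  simp only [verts, Finset.mem_insert, Finset.mem_singleton] at huz
  rcases huz with rfl | rfl | rfl
  · exact absurd rfl huv
  · exact ⟨c', hcc⟩
  · obtain ⟨-, h2, -⟩ := hx _ hzσ
    simp only [id] at h2
    rw [ori_swap, ori_combo _ _ _ _ (by ring)] at h2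
    have m4 : ori v u (mid u v) = 0 := by
      have : ori v u (mid u v) = - ori u v (mid u v) := by simp only [ori]; ring
      rw [this, m3, neg_zero]
    rw [m4] at h2
    nlinarith

lemma IsTriangulationOf.uniq (hK : IsTriangulationOf K Q) {v a b b' : Pt}
    (h : (v, a, b) ∈ otri K) (h' : (v, a, b') ∈ otri K) : b = b' := by
  have hp : 0 < ori v a b := (mem_otri.1 h).2
  have hp' : 0 < ori v a b' := (mem_otri.1 h').2
  obtain ⟨m1, m2, m3⟩ := mid_facts hp
  obtain ⟨n1, n2, n3⟩ := mid_facts hp'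
  obtain ⟨σ, hσ0, hσ1, hc⟩ := exists_stay (p := id) (y := (v, a, b')) (w := mid v a) (x := b)
    ⟨n1.le, n2.le, n3.ge⟩ (Or.inl n1) (Or.inl n2) (Or.inr hp.le)
  have hσ : 0 < 1 - σ := by linarith
  have hin : Inside id (v, a, b) ((1 - σ) • mid v a + σ • b) := by
    refine ⟨?_, ?_, ?_⟩ <;> simp only [id]
    · rw [ori_combo_left _ _ _ _ (by ring), ori_self_outer]
      have := mul_pos hσ m1
      linarith
    · rw [ori_combo_mid _ _ _ _ (by ring), ori_self_right]
      have := mul_pos hσ m2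
      linarith
    · rw [ori_combo _ _ _ _ (by ring), m3]
      have := mul_pos hσ0 hp
      linarith
  exact ((eq_of_verts hp hp' (hK.verts_eq h h' hin hc).symm)).2

lemma IsTriangulationOf.isFan (hK : IsTriangulationOf K Q) (v : Pt) : IsFan (fan (otri K) v) v :=
  isFan_fan (fun _ _ _ h => otri_rot h) (fun _ _ _ _ h h' => hK.uniq h h') v

lemma otri_pos : Pos (otri K) id := fun _ hx => (mem_otri.1 hx).2

/-- Edges in the same direction are equal. -/
lemma IsTriangulationOf.ray_eq (hK : IsTriangulationOf K Q) {v a a' : Pt} {t : Finset Pt} (ha : a ∈ Q)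
    (ht : t ∈ K) (hv : v ∈ t) (ha' : a' ∈ t) (hav : a ≠ v) {s : ℝ} (hs0 : 0 ≤ s) (hs : s ≤ 1)
    (h : a = (1 - s) • v + s • a') : a = a' := by
  have h1 : a ∈ convexHull ℝ (t : Set Pt) := by
    rw [h]
    exact convex_convexHull ℝ _ (subset_convexHull ℝ _ hv) (subset_convexHull ℝ _ ha')
      (by linarith) hs0 (by ring)
  obtain ⟨c, c', hcc, rfl⟩ := hK.exists_orient ht hv
  have hpos : 0 < ori v c c' := (mem_otri.1 hcc).2
  have h2 := hK.vertex_mem ha hcc ((inClosed_id_iff hpos a).2 h1)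
  have h3 : ori v a' a = 0 := by
    rw [h, ori_combo _ _ _ _ (by ring), ori_self_outer, ori_self_right]; simp
  simp only [verts, Finset.mem_insert, Finset.mem_singleton] at h2 ha'
  rcases ha' with rfl | rfl | rfl
  · exfalso; apply hav; rw [h]; module
  · rcases h2 with rfl | rfl | rfl
    · exact absurd rfl hav
    · rfl
    · exact absurd h3 hpos.ne'
  · rcases h2 with rfl | rfl | rfl
    · exact absurd rfl hav
    · rw [ori_swap] at h3; exact absurd h3 (by linarith)
    · rfl

end

section

variable {K : Finset (Finset Pt)} {Q : Finset Pt}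

lemma exists_smul_of_ori {v a b : Pt} (hav : a ≠ v) (h : ori v a b = 0) :
    ∃ r : ℝ, b = (1 - r) • v + r • a := by
  have h1 := collinear_of_ori h
  rw [collinear_iff_of_mem (p₀ := v) (by simp)] at h1
  obtain ⟨w, hw⟩ := h1
  obtain ⟨r, rfl⟩ := hw a (by simp)
  obtain ⟨s, rfl⟩ := hw b (by simp)
  have hr : r ≠ 0 := by rintro rfl; simp at hav
  refine ⟨s / r, ?_⟩
  have : s = s / r * r := by field_simp
  simp only [vadd_eq_add, smul_add, smul_smul]
  rw [← this]; module

lemma cr_bary (p : Pt → Pt) (d : ℂ) (v a b q : Pt) :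
    ori (p v) (p a) (p b) * cr d (vec p v q) =
      ori (p v) (p q) (p b) * cr d (vec p v a) + ori (p v) (p a) (p q) * cr d (vec p v b) := by
  simp only [ori, cr_eq, vec, toC, Complex.sub_re, Complex.sub_im]; ring

lemma vec_id (v a : Pt) : vec id v a = toC a - toC v := rfl

lemma eventually_inside {v a b : Pt} {d : ℂ} (h : 0 < ori v a b)
    (hs : Separates id d (v, a, b)) :
    ∀ᶠ ε : ℝ in nhdsWithin 0 (Set.Ioi 0), Inside id (v, a, b) (ofC (toC v - ε * d)) := by
  obtain ⟨h1, h2⟩ := hs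
  simp only [vec_id] at h1 h2
  have c : Continuous fun ε : ℝ => ori (ofC (toC v - ε * d)) a b := by
    simp only [ori, ofC, toC]
    simp
    fun_prop
  have h3 := c.tendsto 0
  have e0 : ofC (toC v - ((0 : ℝ) : ℂ) * d) = v := by
    apply toC_injective; rw [toC_ofC]; simp
  rw [e0] at h3
  filter_upwards [nhdsWithin_le_nhds (h3.eventually_const_lt h), self_mem_nhdsWithin] with ε k1 k2
  have k3 : (0 : ℝ) < ε := k2
  have e := toC_ofC (toC v - ε * d)
  refine ⟨k1, ?_, ?_⟩ <;> simp only [id]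
  · rw [ori_eq_im, e]
    have : ((starRingEnd ℂ) (toC v - ε * d - toC v) * (toC b - toC v)).im
        = ε * -(cr d (toC b - toC v)) := by simp [cr]; ring
    rw [this]; exact mul_pos k3 (by linarith)
  · rw [ori_eq_im, e]
    have : ((starRingEnd ℂ) (toC a - toC v) * (toC v - ε * d - toC v)).im
        = ε * (cr d (toC a - toC v)) := by simp [cr]; ring
    rw [this]; exact mul_pos k3 h1

lemma IsTriangulationOf.sepCount_le_one (hK : IsTriangulationOf K Q) (v : Pt) (d : ℂ) :
    sepCount (fan (otri K) v) id d ≤ 1 := by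
  rw [sepCount, Finset.card_le_one]
  rintro ⟨v₁, a, b⟩ hx₀ ⟨v₂, a', b'⟩ hy₀
  obtain ⟨hx₁, hxs⟩ := Finset.mem_filter.1 hx₀
  obtain ⟨hy₁, hys⟩ := Finset.mem_filter.1 hy₀
  obtain ⟨hx, e1⟩ := mem_fan.1 hx₁
  obtain ⟨hy, e2⟩ := mem_fan.1 hy₁
  simp only at e1 e2
  subst e1 e2
  have p1 : 0 < ori v₂ a b := (mem_otri.1 hx).2
  have p2 : 0 < ori v₂ a' b' := (mem_otri.1 hy).2
  obtain ⟨ε, h1, h2⟩ := ((eventually_inside p1 hxs).and (eventually_inside p2 hys)).exists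
  obtain ⟨rfl, rfl⟩ := eq_of_verts p1 p2 (hK.verts_eq hx hy h1 h2.inClosed).symm
  rfl

/-- The convex hull lies to the left of the first edge of a boundary vertex. -/
lemma IsTriangulationOf.start_support (hK : IsTriangulationOf K Q) {v a q : Pt}
    (ha : a ∈ firsts (fan (otri K) v) \ seconds (fan (otri K) v))
    (hq : q ∈ convexHull ℝ (Q : Set Pt)) : 0 ≤ ori v a q := by
  obtain ⟨h1, h2⟩ := Finset.mem_sdiff.1 ha
  obtain ⟨b, hb⟩ := mem_firsts.1 h1
  by_contra! hneg
  obtain ⟨c, hc⟩ := hK.exists_left hb hq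
    (by have : ori a v q = - ori v a q := by simp only [ori]; ring
        linarith)
  exact h2 (mem_seconds.2 ⟨c, otri_rot hc⟩)

lemma IsTriangulationOf.end_support (hK : IsTriangulationOf K Q) {v b q : Pt}
    (hb : b ∈ seconds (fan (otri K) v) \ firsts (fan (otri K) v))
    (hq : q ∈ convexHull ℝ (Q : Set Pt)) : 0 ≤ ori v q b := by
  obtain ⟨h1, h2⟩ := Finset.mem_sdiff.1 hb
  obtain ⟨a, ha⟩ := mem_seconds.1 h1
  by_contra! hneg
  obtain ⟨c, hc⟩ := hK.exists_left (otri_rot (otri_rot ha)) hq (by rw [ori_swap]; linarith)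
  exact h2 (mem_firsts.2 ⟨c, hc⟩)

lemma IsTriangulationOf.starts_le (hK : IsTriangulationOf K Q) (v : Pt) :
    (firsts (fan (otri K) v) \ seconds (fan (otri K) v)).card ≤ 1 := by
  rw [Finset.card_le_one]
  intro a ha a' ha'
  obtain ⟨b, hb⟩ := mem_firsts.1 (Finset.mem_sdiff.1 ha).1
  obtain ⟨b', hb'⟩ := mem_firsts.1 (Finset.mem_sdiff.1 ha').1
  have p1 : 0 < ori v a b := (mem_otri.1 hb).2
  have p2 : 0 < ori v a' b' := (mem_otri.1 hb').2
  have hQ : ∀ q ∈ Q, q ∈ convexHull ℝ (Q : Set Pt) := fun q hq => subset_convexHull ℝ _ hq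
  have haQ := hK.mem_Q (otri_rot hb)
  have haQ' := hK.mem_Q (otri_rot hb')
  have h1 := hK.start_support ha (hQ a' haQ')
  have h2 := hK.start_support ha' (hQ a haQ)
  rw [ori_swap] at h2
  have h0 : ori v a a' = 0 := by linarith
  have n1 := (ne_of_ori p1).1
  have n2 := (ne_of_ori p2).1
  obtain ⟨r, hr⟩ := exists_smul_of_ori n1 h0
  have hv1 : v ∈ verts (v, a, b) := by simp [verts]
  have hv2 : v ∈ verts (v, a', b') := by simp [verts]
  have hv3 : a ∈ verts (v, a, b) := by simp [verts]
  have hv4 : a' ∈ verts (v, a', b') := by simp [verts]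
  rcases le_or_gt r 0 with hr0 | hr0
  · exfalso
    have h3 := hK.start_support ha' (hQ b (hK.mem_Q (otri_rot (otri_rot hb))))
    rw [hr, ori_combo_mid _ _ _ _ (by ring), ori_self_left] at h3
    have : r = 0 := by nlinarith
    apply n2; rw [hr, this]; module
  · rcases le_or_gt r 1 with hr1 | hr1
    · exact (hK.ray_eq haQ' (mem_otri.1 hb).1 hv1 hv3 n2 hr0.le hr1 hr).symm
    · refine hK.ray_eq haQ (mem_otri.1 hb').1 hv2 hv4 n1 (s := r⁻¹) (by positivity)
        (inv_le_one_of_one_le₀ hr1.le) ?_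
      have : r⁻¹ * r = 1 := inv_mul_cancel₀ hr0.ne'
      rw [hr, smul_add, smul_smul, smul_smul, mul_sub, this]; module

lemma IsTriangulationOf.fan_nonempty (hK : IsTriangulationOf K Q) {v : Pt} (hv : v ∈ Q) :
    ∃ a b, (v, a, b) ∈ otri K := by
  obtain ⟨t, ht, hvt⟩ := hK.vertex v hv
  obtain ⟨a, b, hab, -⟩ := hK.exists_orient ht hvt
  exact ⟨a, b, hab⟩

lemma fan_pos (v : Pt) : Pos (fan (otri K) v) id := otri_pos.mono (fan_subset _ v)

lemma IsTriangulationOf.sepCount_closed (hK : IsTriangulationOf K Q) {v : Pt} (hv : v ∈ Q)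
    (hc : firsts (fan (otri K) v) ⊆ seconds (fan (otri K) v)) {d : ℂ}
    (hd : Transverse (fan (otri K) v) id d) : sepCount (fan (otri K) v) id d = 1 := by
  have h1 := (hK.isFan v).angSum_closed (fan_pos v) hd hc
  obtain ⟨a, b, hab⟩ := hK.fan_nonempty hv
  have h2 := angSum_pos (fan_pos (K := K) v) ⟨(v, a, b), mem_fan.2 ⟨hab, rfl⟩⟩
  have h3 := hK.sepCount_le_one v d
  have h4 : sepCount (fan (otri K) v) id d ≠ 0 := by
    intro h0; rw [h1, h0] at h2; simp at h2
  omega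

lemma IsTriangulationOf.angSum_closed (hK : IsTriangulationOf K Q) {v : Pt} (hv : v ∈ Q)
    (hc : firsts (fan (otri K) v) ⊆ seconds (fan (otri K) v)) :
    angSum (fan (otri K) v) id = 2 * π := by
  obtain ⟨d, hd⟩ := exists_transverse (fan_pos (K := K) v)
  rw [(hK.isFan v).angSum_closed (fan_pos v) hd hc, hK.sepCount_closed hv hc hd]; simp

/-- A vertex is on the frontier iff its fan is not closed. -/
lemma IsTriangulationOf.frontier_iff (hK : IsTriangulationOf K Q) {v : Pt} (hv : v ∈ Q) :
    v ∈ frontier (convexHull ℝ (Q : Set Pt)) ↔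
      ¬ firsts (fan (otri K) v) ⊆ seconds (fan (otri K) v) := by
  have hcl : IsClosed (convexHull ℝ (Q : Set Pt)) := (Q.finite_toSet.isCompact_convexHull ℝ).isClosed
  have hvQ : v ∈ convexHull ℝ (Q : Set Pt) := subset_convexHull ℝ _ hv
  rw [hcl.frontier_eq, Set.mem_sdiff, and_iff_right hvQ, not_iff_not]
  constructor
  · intro hinn a ha
    by_contra hcon
    have hst : a ∈ firsts (fan (otri K) v) \ seconds (fan (otri K) v) := Finset.mem_sdiff.2 ⟨ha, hcon⟩
    obtain ⟨b, hb⟩ := mem_firsts.1 ha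
    have p1 : 0 < ori v a b := (mem_otri.1 hb).2
    have hc : Continuous fun ε : ℝ => (1 - (-ε)) • v + (-ε) • b := by fun_prop
    have h1 := hc.tendsto 0
    simp only [neg_zero, sub_zero, one_smul, zero_smul, add_zero] at h1
    have h2 := h1.eventually (mem_interior_iff_mem_nhds.1 hinn)
    obtain ⟨ε, h3, h4⟩ := ((h2.filter_mono (nhdsWithin_le_nhds (s := Set.Ioi 0))).and
      self_mem_nhdsWithin).exists
    have h5 := hK.start_support hst h3
    rw [ori_combo _ _ _ _ (by ring), ori_self_outer] at h5
    have h6 : (0 : ℝ) < ε := h4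
    nlinarith [mul_pos h6 p1]
  · intro hc
    have h1 : ∀ᶠ x in nhds v, ∀ y ∈ fan (otri K) v, 0 < ori x y.2.1 y.2.2 := by
      rw [Filter.eventually_all_finset]
      rintro ⟨w, a, b⟩ hy₀
      obtain ⟨hy, rfl⟩ := mem_fan.1 hy₀
      exact eventually_ori_pos (mem_otri.1 hy).2
    obtain ⟨U, hU, hUo, hvU⟩ := mem_nhds_iff.1 h1
    have hdense := dense_off_lines (((fan (otri K) v).image fun y => (v, y.2.1)) ∪
      ((fan (otri K) v).image fun y => (v, y.2.2))) (by
        intro l hl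
        simp only [Finset.mem_union, Finset.mem_image] at hl
        rcases hl with ⟨⟨w, a, b⟩, hy₀, rfl⟩ | ⟨⟨w, a, b⟩, hy₀, rfl⟩
        · obtain ⟨hy, rfl⟩ := mem_fan.1 hy₀
          exact (ne_of_ori (mem_otri.1 hy).2).1.symm
        · obtain ⟨hy, rfl⟩ := mem_fan.1 hy₀
          exact (ne_of_ori (mem_otri.1 hy).2).2.1.symm)
    rw [mem_interior]
    refine ⟨U, ?_, hUo, hvU⟩
    refine (hdense.open_subset_closure_inter hUo).trans (closure_minimal ?_ hcl)
    rintro x ⟨hxU, hxg⟩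
    have hgen : ∀ y ∈ fan (otri K) v, ori v y.2.1 x ≠ 0 ∧ ori v y.2.2 x ≠ 0 := by
      intro y hy
      constructor
      · refine hxg (v, y.2.1) ?_
        simp only [Finset.mem_union, Finset.mem_image]
        exact Or.inl ⟨y, hy, rfl⟩
      · refine hxg (v, y.2.2) ?_
        simp only [Finset.mem_union, Finset.mem_image]
        exact Or.inr ⟨y, hy, rfl⟩
    have key : ∀ c, cr (-(toC x - toC v)) (toC c - toC v) = ori v c x := by
      intro c; simp [cr_eq, toC, ori]; ring
    have htr : Transverse (fan (otri K) v) id (-(toC x - toC v)) := by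
      rintro ⟨w, a, b⟩ hy₀
      have h2 := hgen _ hy₀
      obtain ⟨hy, rfl⟩ := mem_fan.1 hy₀
      simp only [vec_id, key]
      exact h2
    have h2 := hK.sepCount_closed hv hc htr
    have h2' : 0 < sepCount (fan (otri K) v) id (-(toC x - toC v)) := by omega
    obtain ⟨⟨w, a, b⟩, hy₀⟩ := Finset.card_pos.1 h2'
    obtain ⟨hy₁, hs1, hs2⟩ := Finset.mem_filter.1 hy₀
    have h3 := hU hxU _ hy₁
    obtain ⟨hy, rfl⟩ := mem_fan.1 hy₁
    simp only [vec_id, key] at hs1 hs2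
    rw [ori_swap] at hs2
    have h4 : InClosed id (w, a, b) x := ⟨h3.le, by simp only [id]; linarith, hs1.le⟩
    rw [inClosed_id_iff (mem_otri.1 hy).2] at h4
    exact convexHull_mono (Finset.coe_subset.2 (hK.subset _ (mem_otri.1 hy).1)) h4

end

section

variable {K : Finset (Finset Pt)} {Q : Finset Pt}

lemma sepCount_mono {S T : Finset (Pt × Pt × Pt)} (h : S ⊆ T) (p : Pt → Pt) (d : ℂ) :
    sepCount S p d ≤ sepCount T p d := Finset.card_le_card (Finset.filter_subset_filter _ h)

lemma not_separates {T : Finset (Pt × Pt × Pt)} {p : Pt → Pt} {d : ℂ} (h : sepCount T p d = 0)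
    {x : Pt × Pt × Pt} (hx : x ∈ T) : ¬ Separates p d x :=
  Finset.filter_eq_empty_iff.1 (Finset.card_eq_zero.1 h) hx

/-- If no triangle at `v` meets the line in direction `d`, each side with a triangle has a start. -/
lemma IsTriangulationOf.start_of_side (hK : IsTriangulationOf K Q) {v : Pt} {d : ℂ}
    (hd : Transverse (fan (otri K) v) id d) (h0 : sepCount (fan (otri K) v) id d = 0)
    (h0' : sepCount (fan (otri K) v) id (-d) = 0) {x : Pt × Pt × Pt} (hx : x ∈ fan (otri K) v)
    (hpos : 0 < cr d (vec id v x.2.1)) :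
    ∃ a ∈ firsts (fan (otri K) v) \ seconds (fan (otri K) v), 0 < cr d (vec id v a) := by
  set T := (fan (otri K) v).filter fun y => 0 < cr d (vec id v y.2.1) with hT
  have hsub : T ⊆ fan (otri K) v := Finset.filter_subset _ _
  have hne : T.Nonempty := ⟨x, Finset.mem_filter.2 ⟨hx, hpos⟩⟩
  have hTp : Pos T id := (fan_pos v).mono hsub
  have hstart : ¬ firsts T ⊆ seconds T := by
    intro hc
    have h1 := ((hK.isFan v).mono hsub).angSum_closed hTp (hd.mono hsub) hc
    have h2 := angSum_pos hTp hne
    have h3 : sepCount T id d = 0 := Nat.le_zero.1 (h0 ▸ sepCount_mono hsub id d)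
    rw [h1, h3] at h2
    simp at h2
  obtain ⟨a, ha, ha'⟩ := Finset.not_subset.1 hstart
  obtain ⟨y, hy, rfl⟩ := Finset.mem_image.1 ha
  obtain ⟨hy1, hy2⟩ := Finset.mem_filter.1 hy
  refine ⟨y.2.1, Finset.mem_sdiff.2 ⟨Finset.mem_image.2 ⟨y, hy1, rfl⟩, ?_⟩, hy2⟩
  intro hsec
  obtain ⟨z, hz, hze⟩ := Finset.mem_image.1 hsec
  apply ha'
  refine Finset.mem_image.2 ⟨z, Finset.mem_filter.2 ⟨hz, ?_⟩, hze⟩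
  have hzv : z.1 = v := (mem_fan.1 hz).2
  have h1 := not_separates h0' hz
  simp only [Separates, hzv, cr_neg_left, hze] at h1
  have h2 := (hd z hz).1
  rw [hzv] at h2
  by_contra h3
  exact h1 ⟨by linarith [lt_of_le_of_ne (not_lt.1 h3) h2], by linarith⟩

/-- Locally extreme vertices are globally extreme. -/
lemma IsTriangulationOf.extreme_of_fan (hK : IsTriangulationOf K Q) {v : Pt} (hv : v ∈ Q) {d : ℂ}
    (h : ∀ x ∈ fan (otri K) v, 0 ≤ cr d (vec id v x.2.1) ∧ 0 ≤ cr d (vec id v x.2.2)) {q : Pt}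
    (hq : q ∈ Q) : 0 ≤ cr d (vec id v q) := by
  obtain ⟨a, b, hab, h1, h2⟩ := hK.cone_cover hv (subset_convexHull ℝ _ hq)
  have h3 := h (v, a, b) (mem_fan.2 ⟨hab, rfl⟩)
  have h4 := cr_bary id d v a b q
  have h5 : 0 < ori v a b := (mem_otri.1 hab).2
  simp only [id] at h4 h3
  have : 0 ≤ ori v a b * cr d (vec id v q) := by
    rw [h4]; exact add_nonneg (mul_nonneg h2 h3.1) (mul_nonneg h1 h3.2)
  exact nonneg_of_mul_nonneg_right this h5

lemma IsTriangulationOf.extreme_of_sepCount (hK : IsTriangulationOf K Q) {v : Pt} (hv : v ∈ Q) {d : ℂ}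
    (hd : Transverse (fan (otri K) v) id d) (h0 : sepCount (fan (otri K) v) id d = 0)
    (h0' : sepCount (fan (otri K) v) id (-d) = 0) :
    (∀ q ∈ Q, 0 ≤ cr d (vec id v q)) ∨ (∀ q ∈ Q, 0 ≤ cr (-d) (vec id v q)) := by
  have side : ∀ d', Transverse (fan (otri K) v) id d' → sepCount (fan (otri K) v) id d' = 0 →
      sepCount (fan (otri K) v) id (-d') = 0 → ∀ x ∈ fan (otri K) v, 0 < cr d' (vec id v x.2.2) →
      0 < cr d' (vec id v x.2.1) := by
    intro d' t1 t2 t3 x hx hpos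
    have hxv : x.1 = v := (mem_fan.1 hx).2
    have h1 := not_separates t3 hx
    simp only [Separates, hxv, cr_neg_left] at h1
    have h2 := (t1 x hx).1
    rw [hxv] at h2
    by_contra h3
    exact h1 ⟨by linarith [lt_of_le_of_ne (not_lt.1 h3) h2], by linarith⟩
  by_cases h1 : ∃ x ∈ fan (otri K) v, 0 < cr (-d) (vec id v x.2.1)
  · obtain ⟨x, hx, hxp⟩ := h1
    obtain ⟨a, ha, hap⟩ := hK.start_of_side hd.neg h0' (by rwa [neg_neg]) hx hxp
    right
    have h2 : ∀ y ∈ fan (otri K) v, ¬ 0 < cr d (vec id v y.2.1) := by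
      intro y hy hyp
      obtain ⟨b, hb, hbp⟩ := hK.start_of_side hd h0 h0' hy hyp
      obtain rfl := Finset.card_le_one.1 (hK.starts_le v) a ha b hb
      rw [cr_neg_left] at hap
      linarith
    refine fun q hq => hK.extreme_of_fan hv (fun y hy => ?_) hq
    rw [cr_neg_left, cr_neg_left]
    refine ⟨by linarith [not_lt.1 (h2 y hy)], ?_⟩
    by_contra h3
    exact h2 y hy (side d hd h0 h0' y hy (by linarith))
  · push Not at h1
    left
    refine fun q hq => hK.extreme_of_fan hv (fun y hy => ?_) hq
    have h2 := h1 y hy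
    have hh := h2
    rw [cr_neg_left] at h2
    refine ⟨by linarith, ?_⟩
    by_contra h3
    have := side (-d) hd.neg h0' (by rwa [neg_neg]) y hy (by rw [cr_neg_left]; linarith)
    linarith

lemma IsTriangulationOf.sepCount_add_le (hK : IsTriangulationOf K Q) {v : Pt} {d : ℂ}
    (hd : Transverse (fan (otri K) v) id d)
    (hc : ¬ firsts (fan (otri K) v) ⊆ seconds (fan (otri K) v)) :
    sepCount (fan (otri K) v) id d + sepCount (fan (otri K) v) id (-d) ≤ 1 := by
  obtain ⟨a, ha, ha'⟩ := Finset.not_subset.1 hc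
  have hst := Finset.mem_sdiff.2 ⟨ha, ha'⟩
  obtain ⟨b, hb⟩ := mem_firsts.1 ha
  have hne : cr d (vec id v a) ≠ 0 := (hd (v, a, b) (mem_fan.2 ⟨hb, rfl⟩)).1
  have key : ∀ d', 0 < sepCount (fan (otri K) v) id d' → 0 ≤ cr d' (vec id v a) := by
    intro d' hpos
    obtain ⟨⟨w, a', b'⟩, hy₀⟩ := Finset.card_pos.1 hpos
    obtain ⟨hy₁, hs⟩ := Finset.mem_filter.1 hy₀
    obtain ⟨hy, e⟩ := mem_fan.1 hy₁
    simp only at e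
    subst e
    obtain ⟨ε, h1, h2⟩ := ((eventually_inside (mem_otri.1 hy).2 hs).and self_mem_nhdsWithin).exists
    have h3 := (inClosed_id_iff (mem_otri.1 hy).2 _).1 h1.inClosed
    have h4 := hK.start_support hst
      (convexHull_mono (Finset.coe_subset.2 (hK.subset _ (mem_otri.1 hy).1)) h3)
    rw [ori_eq_im, toC_ofC] at h4
    have : ((starRingEnd ℂ) (toC a - toC w) * (toC w - ε * d' - toC w)).im
        = ε * (cr d' (toC a - toC w)) := by simp [cr]; ring
    rw [this] at h4
    exact nonneg_of_mul_nonneg_right h4 h2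
  have l1 := hK.sepCount_le_one v d
  have l2 := hK.sepCount_le_one v (-d)
  by_contra hcon
  have k1 := key d (by omega)
  have k2 := key (-d) (by omega)
  rw [cr_neg_left] at k2
  exact hne (by linarith)

lemma sepCount_extreme {v : Pt} {d : ℂ} (hK : IsTriangulationOf K Q)
    (h : (∀ q ∈ Q, 0 ≤ cr d (vec id v q)) ∨ (∀ q ∈ Q, 0 ≤ cr (-d) (vec id v q))) :
    sepCount (fan (otri K) v) id d = 0 ∧ sepCount (fan (otri K) v) id (-d) = 0 := by
  have key : ∀ d', (∀ q ∈ Q, 0 ≤ cr d' (vec id v q)) →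
      sepCount (fan (otri K) v) id d' = 0 ∧ sepCount (fan (otri K) v) id (-d') = 0 := by
    intro d' h
    apply sepCount_eq_zero_of_min
    rintro ⟨w, a, b⟩ hx₀
    obtain ⟨hx, e⟩ := mem_fan.1 hx₀
    exact ⟨h _ (hK.mem_Q (otri_rot hx)), h _ (hK.mem_Q (otri_rot (otri_rot hx)))⟩
  rcases h with h | h
  · exact key d h
  · have := key (-d) h
    rw [neg_neg] at this
    exact this.symm

/-- Differences of distinct points of `Q`. -/
def diffs (Q : Finset Pt) : Finset ℂ := ((Q ×ˢ Q).filter fun x => x.1 ≠ x.2).image fun x => toC x.2 - toC x.1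

lemma mem_diffs {u v : Pt} (hu : u ∈ Q) (hv : v ∈ Q) (h : u ≠ v) : toC v - toC u ∈ diffs Q :=
  Finset.mem_image.2 ⟨(u, v), Finset.mem_filter.2 ⟨Finset.mem_product.2 ⟨hu, hv⟩, h⟩, rfl⟩

lemma exists_generic_dir (Q : Finset Pt) :
    ∃ d : ℂ, ∀ u ∈ Q, ∀ v ∈ Q, u ≠ v → cr d (toC v - toC u) ≠ 0 := by
  have h0 : ∀ z ∈ diffs Q, z ≠ 0 := by
    intro z hz
    obtain ⟨⟨u, v⟩, h, rfl⟩ := Finset.mem_image.1 hz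
    exact sub_ne_zero.2 fun e => (Finset.mem_filter.1 h).2 (toC_injective e).symm
  obtain ⟨η, hη⟩ := (eventually_cr_ne one_ne_zero _ h0).exists
  exact ⟨_, fun u hu v hv h => hη _ (mem_diffs hu hv h)⟩

lemma IsTriangulationOf.transverse (hK : IsTriangulationOf K Q) {d : ℂ}
    (hd : ∀ u ∈ Q, ∀ v ∈ Q, u ≠ v → cr d (toC v - toC u) ≠ 0) : Transverse (otri K) id d := by
  rintro ⟨v, a, b⟩ hx
  have h1 := ne_of_ori (mem_otri.1 hx).2
  have h2 := hK.mem_Q hx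
  have h3 := hK.mem_Q (otri_rot hx)
  have h4 := hK.mem_Q (otri_rot (otri_rot hx))
  exact ⟨hd v h2 a h3 h1.1.symm, hd v h2 b h4 h1.2.1.symm⟩

lemma IsTriangulationOf.euler (hK : IsTriangulationOf K Q) (hcol : ¬ Collinear ℝ (Q : Set Pt)) :
    ((otri K).card : ℝ) / 3 + 2 = ∑ v ∈ Q,
      (if firsts (fan (otri K) v) ⊆ seconds (fan (otri K) v) then 2 else 1) := by
  obtain ⟨d, hd⟩ := exists_generic_dir Q
  have htr := hK.transverse hd
  have hne : Q.Nonempty := by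
    rw [Finset.nonempty_iff_ne_empty]; rintro rfl; exact hcol (by simpa using collinear_empty ℝ Pt)
  obtain ⟨m, hm, hmin⟩ := Q.exists_min_image (fun q => cr d (toC q)) hne
  obtain ⟨M, hM, hmax⟩ := Q.exists_max_image (fun q => cr d (toC q)) hne
  have hcr : ∀ u v, cr d (toC v - toC u) = cr d (toC v) - cr d (toC u) := by
    intro u v; simp [cr_eq]; ring
  have hmM : m ≠ M := by
    rintro rfl
    obtain ⟨a, b, hab⟩ := hK.fan_nonempty hm
    have haQ := hK.mem_Q (otri_rot hab)
    have := hd m hm a haQ (ne_of_ori (mem_otri.1 hab).2).1.symm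
    rw [hcr] at this
    exact this (by linarith [hmin a haQ, hmax a haQ])
  have hext : ∀ v ∈ Q, ((∀ q ∈ Q, 0 ≤ cr d (vec id v q)) ∨ (∀ q ∈ Q, 0 ≤ cr (-d) (vec id v q))) ↔
      (v = m ∨ v = M) := by
    intro v hv
    simp only [vec_id, cr_neg_left, hcr]
    constructor
    · rintro (h | h)
      · left
        by_contra hne
        have h1 := hd v hv m hm hne
        rw [hcr] at h1
        exact h1 (by linarith [h m hm, hmin v hv])
      · right
        by_contra hne
        have h1 := hd v hv M hM hne
        rw [hcr] at h1
        exact h1 (by linarith [h M hM, hmax v hv])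
    · rintro (rfl | rfl)
      · exact Or.inl fun q hq => by linarith [hmin q hq]
      · exact Or.inr fun q hq => by linarith [hmax q hq]
  have hterm : ∀ v ∈ Q, ((sepCount (fan (otri K) v) id d : ℝ) + sepCount (fan (otri K) v) id (-d)) =
      (if firsts (fan (otri K) v) ⊆ seconds (fan (otri K) v) then 2 else 1) -
        ((if v = m then 1 else 0) + (if v = M then 1 else 0)) := by
    intro v hv
    have htv := htr.mono (fan_subset (otri K) v)
    by_cases hx : v = m ∨ v = M
    · have h1 := sepCount_extreme hK ((hext v hv).2 hx)
      have h2 : ¬ firsts (fan (otri K) v) ⊆ seconds (fan (otri K) v) := fun hc => by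
        have := hK.sepCount_closed hv hc htv
        omega
      rw [h1.1, h1.2, if_neg h2]
      rcases hx with rfl | rfl
      · rw [if_pos rfl, if_neg hmM]; norm_num
      · rw [if_pos rfl, if_neg hmM.symm]; norm_num
    · have hx' := hx
      push Not at hx'
      rw [if_neg hx'.1, if_neg hx'.2]
      split_ifs with hc
      · rw [hK.sepCount_closed hv hc htv, hK.sepCount_closed hv hc htv.neg]; norm_num
      · have h1 := hK.sepCount_add_le htv hc
        have h2 : sepCount (fan (otri K) v) id d + sepCount (fan (otri K) v) id (-d) ≠ 0 := by
          intro h0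
          exact hx ((hext v hv).1 (hK.extreme_of_sepCount hv htv (by omega) (by omega)))
        have h3 : sepCount (fan (otri K) v) id d + sepCount (fan (otri K) v) id (-d) = 1 := by omega
        have h4 : ((sepCount (fan (otri K) v) id d : ℝ) + sepCount (fan (otri K) v) id (-d)) = 1 := by
          exact_mod_cast h3
        rw [h4]; norm_num
  have hs := sum_sepCount_linear (fun _ _ _ h => otri_rot h) (fun _ _ _ h => hK.mem_Q h) htr
  rw [← hs, Finset.sum_congr rfl hterm, Finset.sum_sub_distrib, Finset.sum_add_distrib,
    Finset.sum_ite_eq' Q m, Finset.sum_ite_eq' Q M, if_pos hm, if_pos hM]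
  ring

lemma IsTriangulationOf.disk (hK : IsTriangulationOf K Q) (hcol : ¬ Collinear ℝ (Q : Set Pt)) :
    DiskComplex Q (otri K) :=
  ⟨fun _ _ _ h => otri_rot h, fun _ _ _ _ h h' => hK.uniq h h', fun _ _ _ h => hK.mem_Q h,
    fun _ hv => hK.fan_nonempty hv, hK.starts_le, hK.euler hcol⟩

end

section

variable {K : Finset (Finset Pt)} {Q : Finset Pt}

/-- The edge opposite to the first vertex. -/
def oedge (x : Pt × Pt × Pt) : Finset Pt := {x.2.1, x.2.2}

lemma row_fiber {x : Pt × Pt × Pt} (hx : x ∈ otri K) :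
    (otri K).filter (fun y => verts y = verts x) =
      {x, (x.2.1, x.2.2, x.1), (x.2.2, x.1, x.2.1)} := by
  obtain ⟨v, a, b⟩ := x
  have hx1 := otri_rot hx
  have hx2 := otri_rot hx1
  have p0 := (mem_otri.1 hx).2
  have p1 := (mem_otri.1 hx1).2
  have p2 := (mem_otri.1 hx2).2
  ext ⟨u, c, d⟩
  simp only [Finset.mem_filter, Finset.mem_insert, Finset.mem_singleton]
  constructor
  · rintro ⟨hy, he⟩
    have py := (mem_otri.1 hy).2
    have hu : u ∈ verts (v, a, b) := by rw [← he]; simp [verts]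
    simp only [verts, Finset.mem_insert, Finset.mem_singleton] at hu
    rcases hu with rfl | rfl | rfl
    · obtain ⟨rfl, rfl⟩ := eq_of_verts py p0 he
      exact Or.inl rfl
    · obtain ⟨rfl, rfl⟩ := eq_of_verts py p1 (he.trans (verts_rot _ _ _).symm)
      exact Or.inr (Or.inl rfl)
    · obtain ⟨rfl, rfl⟩ := eq_of_verts py p2
        (he.trans ((verts_rot _ _ _).symm.trans (verts_rot _ _ _).symm))
      exact Or.inr (Or.inr rfl)
  · rintro (h | h | h) <;> simp only [Prod.mk.injEq] at h <;> obtain ⟨rfl, rfl, rfl⟩ := h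
    · exact ⟨hx, rfl⟩
    · exact ⟨hx1, verts_rot _ _ _⟩
    · exact ⟨hx2, (verts_rot _ _ _).trans (verts_rot _ _ _)⟩

lemma sum_row {x : Pt × Pt × Pt} (hx : x ∈ otri K) (F : Pt × Pt × Pt → ℝ) :
    ∑ y ∈ otri K with verts y = verts x, F y =
      F x + F (x.2.1, x.2.2, x.1) + F (x.2.2, x.1, x.2.1) := by
  have h := ne_of_ori (mem_otri.1 hx).2
  obtain ⟨v, a, b⟩ := x
  simp only at h
  rw [row_fiber hx, Finset.sum_insert, Finset.sum_pair, add_assoc]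
  · simp only [ne_eq, Prod.mk.injEq, not_and]
    intro h1; exact absurd h1 h.2.2
  · simp only [Finset.mem_insert, Finset.mem_singleton, Prod.mk.injEq, not_or, not_and]
    exact ⟨fun h1 => absurd h1.symm h.1, fun h1 => absurd h1.symm h.2.1⟩

lemma IsTriangulationOf.exists_verts (hK : IsTriangulationOf K Q) {t : Finset Pt} (ht : t ∈ K) :
    ∃ x ∈ otri K, t = verts x := by
  have h3 := hK.card3 t ht
  obtain ⟨v, hv⟩ : t.Nonempty := Finset.card_pos.1 (by omega)
  obtain ⟨a, b, h, h'⟩ := hK.exists_orient ht hv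
  exact ⟨_, h, h'⟩

lemma sum_rows (F : Pt × Pt × Pt → ℝ) :
    ∑ t ∈ K, ∑ y ∈ otri K with verts y = t, F y = ∑ y ∈ otri K, F y :=
  Finset.sum_fiberwise_of_maps_to (fun _ hx => (mem_otri.1 hx).1) _

lemma IsTriangulationOf.card_otri (hK : IsTriangulationOf K Q) :
    ((otri K).card : ℝ) = 3 * K.card := by
  rw [Finset.card_eq_sum_ones, Nat.cast_sum, ← sum_rows, Finset.card_eq_sum_ones, Nat.cast_sum,
    Finset.mul_sum]
  refine Finset.sum_congr rfl fun t ht => ?_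
  obtain ⟨x, hx, rfl⟩ := hK.exists_verts ht
  rw [sum_row hx]; norm_num

lemma mem_edgesOf {S : Finset (Finset Pt)} {e : Finset Pt} :
    e ∈ edgesOf S ↔ ∃ t ∈ S, e ⊆ t ∧ e.card = 2 := by
  simp [edgesOf, Finset.mem_powersetCard]

lemma oedge_card {x : Pt × Pt × Pt} (hx : x ∈ otri K) : (oedge x).card = 2 :=
  Finset.card_pair (ne_of_ori (mem_otri.1 hx).2).2.2

lemma oedge_subset (x : Pt × Pt × Pt) : oedge x ⊆ verts x := Finset.subset_insert _ _

lemma verts_eq_insert (x : Pt × Pt × Pt) : verts x = insert x.1 (oedge x) := rfl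

lemma fst_notMem_oedge {x : Pt × Pt × Pt} (hx : x ∈ otri K) : x.1 ∉ oedge x := by
  have h := ne_of_ori (mem_otri.1 hx).2
  simp only [oedge, Finset.mem_insert, Finset.mem_singleton, not_or]
  exact ⟨h.1.symm, h.2.1.symm⟩

lemma verts_sdiff {x : Pt × Pt × Pt} (hx : x ∈ otri K) : verts x \ oedge x = {x.1} := by
  rw [verts_eq_insert, Finset.insert_sdiff_of_notMem _ (fst_notMem_oedge hx), Finset.sdiff_self]
  rfl

lemma oedge_mem {S : Finset (Finset Pt)} {x : Pt × Pt × Pt} (hx : x ∈ otri K) (hS : verts x ∈ S) :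
    oedge x ∈ edgesOf S := mem_edgesOf.2 ⟨_, hS, oedge_subset x, oedge_card hx⟩

/-- Every side of a triangle of `K` is opposite to one of its vertices. -/
lemma IsTriangulationOf.exists_opp (hK : IsTriangulationOf K Q) {t e : Finset Pt} (ht : t ∈ K)
    (he : e ⊆ t) (h2 : e.card = 2) : ∃ x ∈ otri K, verts x = t ∧ oedge x = e := by
  have h3 := hK.card3 t ht
  have h1 : (t \ e).card = 1 := by rw [Finset.card_sdiff_of_subset he]; omega
  obtain ⟨v, hv⟩ := Finset.card_eq_one.1 h1
  have hvt : v ∈ t \ e := by rw [hv]; exact Finset.mem_singleton_self v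
  obtain ⟨a, b, hx, hxt⟩ := hK.exists_orient ht (Finset.mem_sdiff.1 hvt).1
  refine ⟨_, hx, hxt.symm, ?_⟩
  have h4 := verts_sdiff hx
  rw [← hxt] at h4
  have h5 : t \ (t \ e) = e := Finset.sdiff_sdiff_eq_self he
  have h6 : t \ (t \ oedge (v, a, b)) = oedge (v, a, b) :=
    Finset.sdiff_sdiff_eq_self (hxt ▸ oedge_subset _)
  rw [← h5, ← h6, h4, hv]

lemma IsTriangulationOf.exists_oedge (hK : IsTriangulationOf K Q) {S : Finset (Finset Pt)}
    (hS : S ⊆ K) {e : Finset Pt} (he : e ∈ edgesOf S) :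
    ∃ x ∈ otri K, verts x ∈ S ∧ oedge x = e := by
  obtain ⟨t, ht, het, h2⟩ := mem_edgesOf.1 he
  obtain ⟨x, hx, rfl, h⟩ := hK.exists_opp (hS ht) het h2
  exact ⟨x, hx, ht, h⟩

lemma oppAngle_pair {v a b : Pt} (h : a ≠ b) :
    oppAngle v {a, b} = EuclideanGeometry.angle a v b := by
  have h1 : ({a, b} : Finset Pt).erase a = {b} := by
    ext x; simp only [Finset.mem_erase, Finset.mem_insert, Finset.mem_singleton]
    constructor
    · rintro ⟨h1, h2 | h2⟩
      · exact absurd h2 h1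
      · exact h2
    · rintro rfl; exact ⟨h.symm, Or.inr rfl⟩
  have h2 : ({a, b} : Finset Pt).erase b = {a} := by
    ext x; simp only [Finset.mem_erase, Finset.mem_insert, Finset.mem_singleton]
    constructor
    · rintro ⟨h1, h2 | h2⟩
      · exact h2
      · exact absurd h2 h1
    · rintro rfl; exact ⟨h, Or.inl rfl⟩
  rw [oppAngle, Finset.sum_pair h, h1, h2, Finset.sum_singleton, Finset.sum_singleton,
    EuclideanGeometry.angle_comm b v a]
  ring

lemma oppAngle_oedge {x : Pt × Pt × Pt} (hx : x ∈ otri K) :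
    oppAngle x.1 (oedge x) = sang x.1 x.2.1 x.2.2 := by
  have h := (mem_otri.1 hx).2
  rw [oedge, oppAngle_pair (ne_of_ori h).2.2, angle_eq_sang h]

lemma otri_ext {x y : Pt × Pt × Pt} (hx : x ∈ otri K) (hy : y ∈ otri K) (h : verts x = verts y)
    (h1 : x.1 = y.1) : x = y := by
  obtain ⟨v, a, b⟩ := x
  obtain ⟨v', a', b'⟩ := y
  obtain rfl : v = v' := h1
  obtain ⟨rfl, rfl⟩ := eq_of_verts (mem_otri.1 hx).2 (mem_otri.1 hy).2 h
  rfl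

lemma IsTriangulationOf.dihedral_eq (hK : IsTriangulationOf K Q) {e : Finset Pt}
    (he : e ∈ edgesOf K) :
    dihedral K e = ∑ x ∈ otri K with oedge x = e, sang x.1 x.2.1 x.2.2 := by
  obtain ⟨_, -, -, h2⟩ := mem_edgesOf.1 he
  rw [dihedral, eq_comm]
  refine Finset.sum_bij_ne_zero (fun x _ _ => verts x) ?_ ?_ ?_ ?_
  · rintro x hxf -
    obtain ⟨hx, rfl⟩ := Finset.mem_filter.1 hxf
    exact Finset.mem_filter.2 ⟨(mem_otri.1 hx).1, oedge_subset x⟩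
  · rintro x hxf - y hyf - h
    obtain ⟨hx, rfl⟩ := Finset.mem_filter.1 hxf
    obtain ⟨hy, hye⟩ := Finset.mem_filter.1 hyf
    refine otri_ext hx hy h ?_
    have h1 := verts_sdiff hx
    rw [h, ← hye, verts_sdiff hy] at h1
    exact (Finset.singleton_injective h1).symm
  · intro t htf _
    obtain ⟨ht, het⟩ := Finset.mem_filter.1 htf
    obtain ⟨x, hx, rfl, rfl⟩ := hK.exists_opp ht het h2
    exact ⟨x, Finset.mem_filter.2 ⟨hx, rfl⟩, (sang_pos (mem_otri.1 hx).2).1.ne', rfl⟩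
  · rintro x hxf -
    obtain ⟨hx, rfl⟩ := Finset.mem_filter.1 hxf
    rw [verts_sdiff hx, Finset.sum_singleton, oppAngle_oedge hx]

lemma verts_erase {x : Pt × Pt × Pt} (hx : x ∈ otri K) : (verts x).erase x.1 = oedge x := by
  rw [verts_eq_insert, Finset.erase_insert (fst_notMem_oedge hx)]

lemma IsTriangulationOf.bdryAngle_eq (hK : IsTriangulationOf K Q) (q : Pt) :
    bdryAngle K q = angSum (fan (otri K) q) id := by
  rw [bdryAngle, angSum, eq_comm]
  refine Finset.sum_bij (fun x _ => verts x) ?_ ?_ ?_ ?_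
  · intro x hxf
    obtain ⟨hx, rfl⟩ := mem_fan.1 hxf
    exact Finset.mem_filter.2 ⟨(mem_otri.1 hx).1, Finset.mem_insert_self _ _⟩
  · intro x hxf y hyf h
    obtain ⟨hx, hxq⟩ := mem_fan.1 hxf
    obtain ⟨hy, hyq⟩ := mem_fan.1 hyf
    exact otri_ext hx hy h (hxq.trans hyq.symm)
  · intro t htf
    obtain ⟨ht, hq⟩ := Finset.mem_filter.1 htf
    obtain ⟨a, b, hx, rfl⟩ := hK.exists_orient ht hq
    exact ⟨_, mem_fan.2 ⟨hx, rfl⟩, rfl⟩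
  · intro x hxf
    obtain ⟨hx, rfl⟩ := mem_fan.1 hxf
    rw [verts_erase hx, oppAngle_oedge hx]; rfl

/-- A sum over edges of sums over opposite vertices is a sum over triangles. -/
lemma IsTriangulationOf.sum_edges (F : Pt × Pt × Pt → ℝ)
    (p : Finset Pt → Prop) [DecidablePred p] [DecidablePred fun x => p (oedge x)] :
    ∑ e ∈ edgesOf K with p e, ∑ x ∈ otri K with oedge x = e, F x =
      ∑ x ∈ otri K with p (oedge x), F x := by
  rw [← Finset.sum_fiberwise_of_maps_to (s := (otri K).filter fun x => p (oedge x))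
    (t := (edgesOf K).filter p) (g := oedge)]
  · refine Finset.sum_congr rfl fun e he => Finset.sum_congr ?_ fun _ _ => rfl
    ext x
    simp only [Finset.mem_filter]
    constructor
    · rintro ⟨h, rfl⟩; exact ⟨⟨h, (Finset.mem_filter.1 he).2⟩, rfl⟩
    · rintro ⟨⟨h, -⟩, rfl⟩; exact ⟨h, rfl⟩
  · intro x hx
    obtain ⟨hx, hp⟩ := Finset.mem_filter.1 hx
    exact Finset.mem_filter.2 ⟨oedge_mem hx (mem_otri.1 hx).1, hp⟩

/-- The angles opposite to the edges at `q` are the angles at the other two vertices of the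
triangles at `q`. -/
lemma sum_opp_fan (F : Pt × Pt × Pt → ℝ) (q : Pt) :
    ∑ x ∈ otri K with q ∈ oedge x, F x =
      ∑ x ∈ fan (otri K) q, (F (x.2.1, x.2.2, x.1) + F (x.2.2, x.1, x.2.1)) := by
  have rot : ∀ v a b, (v, a, b) ∈ otri K → (a, b, v) ∈ otri K := fun _ _ _ h => otri_rot h
  have h1 : ∑ x ∈ otri K with q ∈ oedge x, F x =
      ∑ x ∈ otri K, ((if x.2.2 = q then F x else 0) + (if x.2.1 = q then F x else 0)) := by
    rw [Finset.sum_filter]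
    refine Finset.sum_congr rfl fun x hx => ?_
    have h := (ne_of_ori (mem_otri.1 hx).2).2.2
    by_cases h1 : x.2.1 = q
    · have h2 : x.2.2 ≠ q := fun h' => h (h1.trans h'.symm)
      simp [oedge, h1, h2]
    · by_cases h2 : x.2.2 = q
      · simp [oedge, h1, h2]
      · simp [oedge, h1, h2, Ne.symm h1, Ne.symm h2]
  rw [h1, Finset.sum_add_distrib, card_filter_rot rot (fun x => if x.2.2 = q then F x else 0),
    card_filter_rot rot (fun x => if x.2.1 = q then F x else 0),
    card_filter_rot rot (fun x => if (x.2.1, x.2.2, x.1).2.1 = q then F (x.2.1, x.2.2, x.1) else 0),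
    Finset.sum_add_distrib, fan, Finset.sum_filter, Finset.sum_filter]

lemma IsTriangulationOf.card_edges_at (hK : IsTriangulationOf K Q)
    (hcol : ¬ Collinear ℝ (Q : Set Pt)) (q : Pt) :
    (((edgesOf K).filter fun e => q ∈ e).card : ℝ) = (fan (otri K) q).card +
      (if firsts (fan (otri K) q) ⊆ seconds (fan (otri K) q) then 0 else 1) := by
  have hD := hK.disk hcol
  have hf := hK.isFan q
  set T := fan (otri K) q with hT
  have h1 : ((edgesOf K).filter fun e => q ∈ e).card = (firsts T ∪ seconds T).card := by
    refine (Finset.card_bij (fun a _ => ({q, a} : Finset Pt)) ?_ ?_ ?_).symm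
    · intro a ha
      refine Finset.mem_filter.2 ⟨?_, Finset.mem_insert_self _ _⟩
      rcases Finset.mem_union.1 ha with ha | ha
      · obtain ⟨b, hb⟩ := mem_firsts.1 ha
        have := oedge_mem (otri_rot (otri_rot hb)) (mem_otri.1 (otri_rot (otri_rot hb))).1
        exact this
      · obtain ⟨b, hb⟩ := mem_seconds.1 ha
        have := oedge_mem (otri_rot hb) (mem_otri.1 (otri_rot hb)).1
        rwa [oedge, Finset.pair_comm] at this
    · intro a ha b hb h
      have hne : ∀ c ∈ firsts T ∪ seconds T, c ≠ q := by
        intro c hc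
        rcases Finset.mem_union.1 hc with hc | hc
        · obtain ⟨d, hd⟩ := mem_firsts.1 hc
          exact (ne_of_ori (mem_otri.1 hd).2).1
        · obtain ⟨d, hd⟩ := mem_seconds.1 hc
          exact (ne_of_ori (mem_otri.1 hd).2).2.1
      have h3 : a ∈ ({q, b} : Finset Pt) := by
        rw [← h]; exact Finset.mem_insert_of_mem (Finset.mem_singleton_self _)
      simp only [Finset.mem_insert, Finset.mem_singleton] at h3
      exact h3.resolve_left (hne a ha)
    · intro e he
      obtain ⟨he, hq⟩ := Finset.mem_filter.1 he
      obtain ⟨x, hx, -, rfl⟩ := hK.exists_oedge subset_rfl he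
      simp only [oedge, Finset.mem_insert, Finset.mem_singleton] at hq
      rcases hq with rfl | rfl
      · exact ⟨x.2.2, Finset.mem_union_left _ (mem_firsts.2 ⟨x.1, otri_rot hx⟩), rfl⟩
      · exact ⟨x.2.1, Finset.mem_union_right _ (mem_seconds.2 ⟨x.1, otri_rot (otri_rot hx)⟩),
          Finset.pair_comm _ _⟩
  have h2 : (firsts T).card = T.card := Finset.card_image_of_injOn
    fun x hx y hy h => hf.inj₁ x hx y hy h
  have h3 : (seconds T \ firsts T).card = if firsts T ⊆ seconds T then 0 else 1 := by
    rw [hf.card_sdiff]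
    split_ifs with h
    · rw [Finset.card_eq_zero, Finset.sdiff_eq_empty_iff_subset]; exact h
    · obtain ⟨a, b, ha, -⟩ := hD.exists_ends h
      rw [ha, Finset.card_singleton]
  rw [h1, ← Finset.union_sdiff_self_eq_union, Finset.card_union_of_disjoint Finset.disjoint_sdiff,
    h2, h3]
  split_ifs <;> simp

lemma sang_sum {v a b : Pt} (h : 0 < ori v a b) : sang v a b + sang a b v + sang b v a = π := by
  obtain ⟨h1, h2, h3⟩ := ne_of_ori h
  have ha : 0 < ori a b v := by rwa [ori_rot]
  have hb : 0 < ori b v a := by rwa [ori_rot]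
  rw [← angle_eq_sang h, ← angle_eq_sang ha, ← angle_eq_sang hb]
  have := EuclideanGeometry.angle_add_angle_add_angle_eq_pi (p₁ := a) (p₂ := v) b h1.symm
  rw [EuclideanGeometry.angle_comm v b a] at this
  rw [EuclideanGeometry.angle_comm b a v, EuclideanGeometry.angle_comm v b a]
  linarith [EuclideanGeometry.angle_comm v b a, EuclideanGeometry.angle_comm b a v, EuclideanGeometry.angle_comm a b v]

end

section

variable {K : Finset (Finset Pt)} {Q : Finset Pt}

/-- `v` and `u` are joined by an edge of `K`. -/
def Nbr (K : Finset (Finset Pt)) (v u : Pt) : Prop := ∃ b, (v, u, b) ∈ otri K ∨ (u, v, b) ∈ otri K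

lemma Nbr.symm {v u : Pt} (h : Nbr K v u) : Nbr K u v := by
  obtain ⟨b, h⟩ := h
  exact ⟨b, h.symm⟩

lemma Nbr.tri {v u : Pt} (h : Nbr K v u) : ∃ z ∈ otri K, v ∈ verts z ∧ u ∈ verts z ∧ u ≠ v := by
  obtain ⟨b, h | h⟩ := h
  · exact ⟨_, h, by simp [verts], by simp [verts], (ne_of_ori (mem_otri.1 h).2).1⟩
  · exact ⟨_, h, by simp [verts], by simp [verts], (ne_of_ori (mem_otri.1 h).2).1.symm⟩

lemma IsTriangulationOf.nbr_mem (hK : IsTriangulationOf K Q) {v u : Pt} (h : Nbr K v u) :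
    v ∈ Q ∧ u ∈ Q := by
  obtain ⟨z, hz, hv, hu, -⟩ := h.tri
  exact ⟨hK.subset _ (mem_otri.1 hz).1 hv, hK.subset _ (mem_otri.1 hz).1 hu⟩

lemma IsTriangulationOf.cone_disjoint (hK : IsTriangulationOf K Q) {v u y w : Pt}
    (h : (v, u, y) ∈ otri K) (hw : Nbr K v w) (h1 : 0 < ori v u w) (h2 : 0 < ori v w y) : False := by
  have hpos : 0 < ori v u y := (mem_otri.1 h).2
  obtain ⟨z, hz, hvz, hwz, hne⟩ := hw.tri
  have hs : Separates id (toC v - toC w) (v, u, y) := by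
    have e1 := ori_eq_cr id v u w
    have e2 := ori_eq_cr id v w y
    simp only [id, vec] at e1 e2
    rw [e1, cr_eq] at h1
    rw [e2, cr_eq] at h2
    constructor
    · simp only [vec, id, cr_eq, Complex.sub_re, Complex.sub_im] at h1 ⊢; linarith
    · simp only [vec, id, cr_eq, Complex.sub_re, Complex.sub_im] at h2 ⊢; linarith
  have hev := (eventually_inside hpos hs).and
    (Ioo_mem_nhdsGT (show (0 : ℝ) < 1 by norm_num))
  obtain ⟨ε, hin, hε0, hε1⟩ := hev.exists
  have hcl : InClosed id z (ofC (toC v - ε * (toC v - toC w))) := by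
    rw [inClosed_id_iff (mem_otri.1 hz).2]
    have : ofC (toC v - ε * (toC v - toC w)) = (1 - ε) • v + ε • w := by
      apply toC_injective
      rw [toC_ofC]
      apply Complex.ext <;> simp [toC] <;> ring
    rw [this]
    exact (convex_convexHull ℝ _) (subset_convexHull ℝ _ hvz) (subset_convexHull ℝ _ hwz)
      (by linarith) hε0.le (by ring)
  have he := hK.verts_eq h hz hin hcl
  rw [he] at hwz
  simp only [verts, Finset.mem_insert, Finset.mem_singleton] at hwz
  rcases hwz with rfl | rfl | rfl
  · exact hne rfl
  · rw [ori_self_right] at h1; exact lt_irrefl _ h1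
  · rw [ori_self_right] at h2; exact lt_irrefl _ h2

lemma IsTriangulationOf.nbr_ray (hK : IsTriangulationOf K Q) {v u w : Pt} (hu : Nbr K v u)
    (hw : Nbr K v w) {d : ℂ} (h : ori v u w = 0) (h1 : cr d (vec id v u) < 0)
    (h2 : cr d (vec id v w) < 0) : u = w := by
  obtain ⟨z, hz, hvz, huz, hne⟩ := hu.tri
  obtain ⟨z', hz', hvz', hwz, hne'⟩ := hw.tri
  obtain ⟨r, hr⟩ := exists_smul_of_ori hne h
  have hr' : vec id v w = r * vec id v u := by
    simp only [vec, id, hr]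
    apply Complex.ext <;> simp [toC] <;> ring
  have hcr : cr d (vec id v w) = r * cr d (vec id v u) := by
    rw [hr']; simp [cr_eq]; ring
  have hr0 : 0 < r := by
    by_contra h3
    push Not at h3
    nlinarith
  rcases le_total r 1 with h3 | h3
  · exact (hK.ray_eq (hK.nbr_mem hw).2 (mem_otri.1 hz).1 hvz huz hne' hr0.le h3 hr).symm
  · refine hK.ray_eq (hK.nbr_mem hu).2 (mem_otri.1 hz').1 hvz' hwz hne (s := r⁻¹)
      (inv_pos.2 hr0).le (inv_le_one_of_one_le₀ h3) ?_
    rw [hr, smul_add, smul_smul, smul_smul, inv_mul_cancel₀ hr0.ne', one_smul, ← add_assoc,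
      ← add_smul]
    have : 1 - r⁻¹ + r⁻¹ * (1 - r) = 0 := by field_simp; ring
    rw [this, zero_smul, zero_add]

/-- The slope of `z` relative to `d`. -/
def slope' (d z : ℂ) : ℝ := (d.re * z.re + d.im * z.im) / cr d z

lemma cr_pos_iff_slope {d z w : ℂ} (hz : cr d z < 0) (hw : cr d w < 0) :
    0 < cr z w ↔ slope' d w < slope' d z := by
  have hd : 0 < d.re * d.re + d.im * d.im := by
    by_contra h
    have h1 : d.re = 0 := by nlinarith [mul_self_nonneg d.re, mul_self_nonneg d.im]
    have h2 : d.im = 0 := by nlinarith [mul_self_nonneg d.re, mul_self_nonneg d.im]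
    rw [cr_eq, h1, h2] at hz
    simp at hz
  have key : (d.re * d.re + d.im * d.im) * cr z w =
      cr d z * cr d w * (slope' d z - slope' d w) := by
    rw [slope', slope']
    have : cr d z * cr d w * ((d.re * z.re + d.im * z.im) / cr d z -
        (d.re * w.re + d.im * w.im) / cr d w) =
        cr d w * (d.re * z.re + d.im * z.im) - cr d z * (d.re * w.re + d.im * w.im) := by
      field_simp [hz.ne, hw.ne]
    rw [this]
    simp only [cr_eq]; ring
  have hp : 0 < cr d z * cr d w := mul_pos_of_neg_of_neg hz hw
  constructor
  · intro h
    have := mul_pos hd h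
    rw [key] at this
    linarith [(mul_pos_iff_of_pos_left hp).1 this]
  · intro h
    have := mul_pos hp (sub_pos.2 h)
    rw [← key] at this
    exact (mul_pos_iff_of_pos_left hd).1 this

/-- A direction not parallel to any line through two points of `Q`. -/
def GenericDir (Q : Finset Pt) (d : ℂ) : Prop :=
  ∀ u ∈ Q, ∀ v ∈ Q, u ≠ v → cr d (toC v - toC u) ≠ 0

lemma cr_vec_neg_iff {d : ℂ} {v u : Pt} :
    cr d (vec id v u) < 0 ↔ cr d (toC u) < cr d (toC v) := by
  simp only [vec, id, cr_eq, Complex.sub_re, Complex.sub_im]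
  constructor <;> intro h <;> linarith

lemma GenericDir.inj {d : ℂ} (hd : GenericDir Q d) {u v : Pt} (hu : u ∈ Q) (hv : v ∈ Q)
    (h : cr d (toC u) = cr d (toC v)) : u = v := by
  by_contra hne
  apply hd u hu v hv hne
  simp only [cr_eq, Complex.sub_re, Complex.sub_im] at h ⊢
  linarith

/-- A quantity that agrees on consecutive neighbors to the left of `v` is constant on the neighbors
to the left of `v`. -/
lemma IsTriangulationOf.const_of_left (hK : IsTriangulationOf K Q) {d : ℂ} (hd : GenericDir Q d)
    {A : Type*} {v : Pt} {k : Pt → A}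
    (hk : ∀ u y, (v, u, y) ∈ otri K → cr d (vec id v u) < 0 → cr d (vec id v y) < 0 → k u = k y)
    {u w : Pt} (hu : Nbr K v u) (hul : cr d (vec id v u) < 0) (hw : Nbr K v w)
    (hwl : cr d (vec id v w) < 0) : k u = k w := by
  classical
  set L := Q.filter fun x => Nbr K v x ∧ cr d (vec id v x) < 0 with hL
  have memL : ∀ x, x ∈ L ↔ Nbr K v x ∧ cr d (vec id v x) < 0 := fun x => by
    rw [hL, Finset.mem_filter]
    exact ⟨fun h => h.2, fun h => ⟨(hK.nbr_mem h.1).2, h⟩⟩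
  obtain ⟨m, hm, hmin⟩ := L.exists_min_image (fun x => slope' d (vec id v x))
    ⟨u, (memL u).2 ⟨hu, hul⟩⟩
  have all : ∀ x ∈ L, k x = k m := by
    by_contra hcon
    push Not at hcon
    obtain ⟨x₁, hx₁, hbad₁⟩ := hcon
    obtain ⟨x, hx, hxmin⟩ := (L.filter fun x => k x ≠ k m).exists_min_image
      (fun x => slope' d (vec id v x)) ⟨x₁, Finset.mem_filter.2 ⟨hx₁, hbad₁⟩⟩
    obtain ⟨hxL, hbad⟩ := Finset.mem_filter.1 hx
    obtain ⟨hxn, hxl⟩ := (memL x).1 hxL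
    obtain ⟨hmn, hml⟩ := (memL m).1 hm
    have hlt : slope' d (vec id v m) < slope' d (vec id v x) := by
      refine lt_of_le_of_ne (hmin x hxL) fun heq => hbad ?_
      have h1 : ¬ 0 < cr (vec id v x) (vec id v m) := by
        rw [cr_pos_iff_slope hxl hml]; exact heq.not_lt
      have h2 : ¬ 0 < cr (vec id v m) (vec id v x) := by
        rw [cr_pos_iff_slope hml hxl]; exact heq.not_gt
      have h3 : ori v x m = 0 := by
        have e1 := ori_eq_cr id v x m
        have e2 := ori_eq_cr id v m x
        simp only [id] at e1 e2
        rw [← e1] at h1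
        rw [← e2, ori_swap] at h2
        linarith
      rw [hK.nbr_ray hxn hmn h3 hxl hml]
    have hxm : 0 < ori v x m := by
      have e := ori_eq_cr id v x m
      simp only [id] at e
      rw [e]
      exact (cr_pos_iff_slope hxl hml).2 hlt
    obtain ⟨y, hy⟩ : ∃ y, (v, x, y) ∈ otri K := by
      obtain ⟨b, hb | hb⟩ := hxn
      · exact ⟨b, hb⟩
      · exact hK.exists_left hb (subset_convexHull ℝ _ (hK.nbr_mem hmn).2) hxm
    have hypos : 0 < ori v x y := (mem_otri.1 hy).2
    have hyn : Nbr K v y := ⟨x, Or.inr (otri_rot (otri_rot hy))⟩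
    have hyl : cr d (vec id v y) < 0 := by
      by_contra hcy
      have hyne : cr d (vec id v y) ≠ 0 :=
        hd v (hK.nbr_mem hyn).1 y (hK.nbr_mem hyn).2 (ne_of_ori hypos).2.1.symm
      have hyp : 0 < cr d (vec id v y) := lt_of_le_of_ne (not_lt.1 hcy) hyne.symm
      have hb := cr_bary id d v x y m
      simp only [id] at hb
      refine hK.cone_disjoint hy hmn hxm ?_
      have h1 : ori v x y * cr d (vec id v m) < 0 := mul_neg_of_pos_of_neg hypos hml
      have h2 : 0 < ori v x m * cr d (vec id v y) := mul_pos hxm hyp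
      have h3 : ori v m y * cr d (vec id v x) < 0 := by linarith
      by_contra h4
      exact absurd (mul_nonneg_of_nonpos_of_nonpos (not_lt.1 h4) hxl.le) (not_le.2 h3)
    have hys : slope' d (vec id v y) < slope' d (vec id v x) := by
      rw [← cr_pos_iff_slope hxl hyl]
      have e := ori_eq_cr id v x y
      simp only [id] at e
      rwa [← e]
    have hyk : k y = k m := by
      by_contra hne
      exact absurd (hxmin y (Finset.mem_filter.2 ⟨(memL y).2 ⟨hyn, hyl⟩, hne⟩)) (not_le.2 hys)
    exact hbad ((hk x y hy hxl hyl).trans hyk)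
  rw [all u ((memL u).2 ⟨hu, hul⟩), all w ((memL w).2 ⟨hw, hwl⟩)]

/-- Every vertex which is not leftmost has a neighbor to its left. -/
lemma IsTriangulationOf.exists_left_nbr (hK : IsTriangulationOf K Q) {d : ℂ} {v q : Pt}
    (hv : v ∈ Q) (hq : q ∈ Q) (h : cr d (toC q) < cr d (toC v)) :
    ∃ u, Nbr K v u ∧ cr d (toC u) < cr d (toC v) := by
  obtain ⟨a, b, hab, h1, h2⟩ := hK.cone_cover hv (subset_convexHull ℝ _ hq)
  have hpos : 0 < ori v a b := (mem_otri.1 hab).2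
  have hb := cr_bary id d v a b q
  rw [← cr_vec_neg_iff] at h
  simp only [id] at hb
  have h3 := mul_neg_of_pos_of_neg hpos h
  by_contra hcon
  push Not at hcon
  have ha : 0 ≤ cr d (vec id v a) := not_lt.1 fun h' =>
    absurd (cr_vec_neg_iff.1 h') (not_lt.2 (hcon a ⟨b, Or.inl hab⟩))
  have hb' : 0 ≤ cr d (vec id v b) := not_lt.1 fun h' =>
    absurd (cr_vec_neg_iff.1 h') (not_lt.2 (hcon b ⟨a, Or.inr (otri_rot (otri_rot hab))⟩))
  have h4 := mul_nonneg h2 ha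
  have h5 := mul_nonneg h1 hb'
  linarith

/-- Every closed discrete one-form on the edges of `K` is exact. -/
theorem IsTriangulationOf.exists_potential (hK : IsTriangulationOf K Q) {A : Type*} [AddCommGroup A]
    {c : Pt → Pt → A} (hanti : ∀ a b, c b a = -c a b)
    (hc : ∀ v a b, (v, a, b) ∈ otri K → c v a + c a b + c b v = 0) :
    ∃ h : Pt → A, ∀ u w, Nbr K u w → c u w = h w - h u := by
  classical
  obtain ⟨d, hd⟩ := exists_generic_dir Q
  replace hd : GenericDir Q d := hd
  suffices H : ∀ S : Finset Pt, S ⊆ Q →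
      (∀ q ∈ Q, ∀ s ∈ S, cr d (toC q) ≤ cr d (toC s) → q ∈ S) →
      ∃ h : Pt → A, ∀ u ∈ S, ∀ w ∈ S, Nbr K u w → c u w = h w - h u by
    obtain ⟨h, hh⟩ := H Q subset_rfl fun q hq _ _ _ => hq
    exact ⟨h, fun u w hn => hh u (hK.nbr_mem hn).1 w (hK.nbr_mem hn).2 hn⟩
  intro S
  induction S using Finset.induction_on_max_value (fun q => cr d (toC q)) with
  | empty => exact fun _ _ => ⟨0, by simp⟩
  | insert v S hvS hmax ih =>
    intro hSQ hlow
    have hvQ : v ∈ Q := hSQ (Finset.mem_insert_self _ _)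
    have hSQ' : S ⊆ Q := fun x hx => hSQ (Finset.mem_insert_of_mem hx)
    have hlt : ∀ x ∈ S, cr d (toC x) < cr d (toC v) := fun x hx =>
      lt_of_le_of_ne (hmax x hx) fun h => hvS ((hd.inj (hSQ' hx) hvQ h) ▸ hx)
    obtain ⟨h, hh⟩ := ih hSQ' fun q hq s hs hle => by
      rcases Finset.mem_insert.1 (hlow q hq s (Finset.mem_insert_of_mem hs) hle) with rfl | h'
      · exact absurd (hlt s hs) (not_lt.2 hle)
      · exact h'
    have left_mem : ∀ u, Nbr K v u → cr d (vec id v u) < 0 → u ∈ S := by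
      intro u hu hul
      rw [cr_vec_neg_iff] at hul
      rcases Finset.mem_insert.1 (hlow u (hK.nbr_mem hu).2 v (Finset.mem_insert_self _ _) hul.le)
        with rfl | h'
      · exact absurd hul (lt_irrefl _)
      · exact h'
    have hconst : ∀ u w, Nbr K v u → u ∈ S → Nbr K v w → w ∈ S → h u + c u v = h w + c w v := by
      intro u w hu huS hw hwS
      refine hK.const_of_left hd (k := fun x => h x + c x v) ?_ hu (cr_vec_neg_iff.2 (hlt u huS)) hw
        (cr_vec_neg_iff.2 (hlt w hwS))
      intro u y hty hul hyl
      have hyn : Nbr K v y := ⟨u, Or.inr (otri_rot (otri_rot hty))⟩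
      have e1 := hh u (left_mem u ⟨y, Or.inl hty⟩ hul) y (left_mem y hyn hyl)
        ⟨v, Or.inl (otri_rot hty)⟩
      have e2 := hc v u y hty
      rw [e1, hanti u v] at e2
      have e3 : c y v - c u v = h u - h y := by
        rw [← sub_eq_zero, ← e2]; abel
      have e4 : h u + c u v = h y + c y v := by
        rw [← sub_eq_zero]
        have : h u + c u v - (h y + c y v) = (h u - h y) - (c y v - c u v) := by abel
        rw [this, e3, sub_self]
      exact e4
    obtain ⟨k, hk⟩ : ∃ k : A, ∀ u, Nbr K v u → u ∈ S → h u + c u v = k := by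
      by_cases hex : ∃ u, Nbr K v u ∧ u ∈ S
      · obtain ⟨u, hu, huS⟩ := hex
        exact ⟨h u + c u v, fun w hw hwS => hconst w u hw hwS hu huS⟩
      · exact ⟨0, fun u hu huS => absurd ⟨u, hu, huS⟩ hex⟩
    refine ⟨fun x => if x = v then k else h x, ?_⟩
    have hne : ∀ x ∈ S, x ≠ v := fun x hx h' => hvS (h' ▸ hx)
    intro u hu' w hw' hn
    rcases Finset.mem_insert.1 hu' with rfl | hu <;> rcases Finset.mem_insert.1 hw' with rfl | hw
    · obtain ⟨_, _, _, _, h'⟩ := hn.tri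
      exact absurd rfl h'
    · simp only [if_pos, if_neg (hne w hw)]
      rw [← hk w hn hw, hanti w u]; abel
    · simp only [if_pos, if_neg (hne u hu)]
      rw [← hk u hn.symm hu]; abel
    · simp only [if_neg (hne u hu), if_neg (hne w hw)]
      exact hh u hu w hw hn

end

section

variable {K : Finset (Finset Pt)} {Q : Finset Pt}

lemma IsTriangulationOf.not_closed_of_edge (hK : IsTriangulationOf K Q)
    {u w b : Pt} (h : (u, w, b) ∈ otri K) (h' : ∀ c, (w, u, c) ∉ otri K) :
    ¬ firsts (fan (otri K) u) ⊆ seconds (fan (otri K) u) ∧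
      ¬ firsts (fan (otri K) w) ⊆ seconds (fan (otri K) w) := by
  constructor
  · intro hc
    obtain ⟨c, hc⟩ := mem_seconds.1 (hc (mem_firsts.2 ⟨b, h⟩))
    exact h' c (otri_rot (otri_rot hc))
  · intro hc
    have h1 := (hK.isFan w).card_sdiff
    rw [Finset.card_eq_zero.2 (Finset.sdiff_eq_empty_iff_subset.2 hc), Finset.card_eq_zero,
      Finset.sdiff_eq_empty_iff_subset] at h1
    obtain ⟨c, hc⟩ := mem_firsts.1 (h1 (mem_seconds.2 ⟨b, otri_rot h⟩))
    exact h' c hc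

/-- A boundary vertex which is not leftmost has a boundary edge going to the left. -/
lemma IsTriangulationOf.exists_left_boundary (hK : IsTriangulationOf K Q)
    (hcol : ¬ Collinear ℝ (Q : Set Pt)) {d : ℂ} (hd : GenericDir Q d) {v q : Pt} (hv : v ∈ Q)
    (hq : q ∈ Q) (hlt : cr d (toC q) < cr d (toC v))
    (hc : ¬ firsts (fan (otri K) v) ⊆ seconds (fan (otri K) v)) :
    ∃ u b, cr d (toC u) < cr d (toC v) ∧
      (((u, v, b) ∈ otri K ∧ ∀ c, (v, u, c) ∉ otri K) ∨
        ((v, u, b) ∈ otri K ∧ ∀ c, (u, v, c) ∉ otri K)) := by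
  obtain ⟨a, b, ha, hb⟩ := (hK.disk hcol).exists_ends hc
  have ha' : a ∈ firsts (fan (otri K) v) \ seconds (fan (otri K) v) := by
    rw [ha]; exact Finset.mem_singleton_self a
  have hb' : b ∈ seconds (fan (otri K) v) \ firsts (fan (otri K) v) := by
    rw [hb]; exact Finset.mem_singleton_self b
  have sa := fun q (hq : q ∈ Q) => hK.start_support ha' (subset_convexHull ℝ _ hq)
  have sb := fun q (hq : q ∈ Q) => hK.end_support hb' (subset_convexHull ℝ _ hq)
  obtain ⟨ha1, ha2⟩ := Finset.mem_sdiff.1 ha'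
  obtain ⟨hb1, hb2⟩ := Finset.mem_sdiff.1 hb'
  obtain ⟨x, hx⟩ := mem_firsts.1 ha1
  obtain ⟨y, hy⟩ := mem_seconds.1 hb1
  by_cases hal : cr d (toC a) < cr d (toC v)
  · exact ⟨a, x, hal, Or.inr ⟨hx, fun c hc => ha2 (mem_seconds.2 ⟨c, otri_rot hc⟩)⟩⟩
  by_cases hbl : cr d (toC b) < cr d (toC v)
  · exact ⟨b, y, hbl, Or.inl ⟨otri_rot (otri_rot hy), fun c hc => hb2 (mem_firsts.2 ⟨c, hc⟩)⟩⟩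
  exfalso
  have haQ : a ∈ Q := hK.mem_Q (otri_rot hx)
  have hbQ : b ∈ Q := hK.mem_Q (otri_rot (otri_rot hy))
  have hxQ : x ∈ Q := hK.mem_Q (otri_rot (otri_rot hx))
  have pos : ∀ c ∈ Q, c ≠ v → ¬ cr d (toC c) < cr d (toC v) → 0 < cr d (vec id v c) := by
    intro c hc hcv hn
    rw [← cr_vec_neg_iff] at hn
    exact lt_of_le_of_ne (not_lt.1 hn) (hd v hv c hc hcv.symm).symm
  have pa := pos a haQ (ne_of_ori (mem_otri.1 hx).2).1 hal
  have pb := pos b hbQ (ne_of_ori (mem_otri.1 hy).2).2.1 hbl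
  have eq := cr_bary id d v a b q
  have ex := cr_bary id d v a b x
  simp only [id] at eq ex
  rw [← cr_vec_neg_iff] at hlt
  have h1 := mul_nonneg (sb q hq) pa.le
  have h2 := mul_nonneg (sa q hq) pb.le
  have hxp : 0 < ori v a x := (mem_otri.1 hx).2
  have h3 := mul_pos hxp pb
  have h4 := mul_nonneg (sb x hxQ) pa.le
  rcases (sa b hbQ).eq_or_lt with h5 | h5
  · rw [← h5, zero_mul] at ex
    linarith
  · have := mul_neg_of_pos_of_neg h5 hlt
    linarith

/-- A function which is constant along boundary edges is constant on the boundary. -/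
lemma IsTriangulationOf.const_boundary (hK : IsTriangulationOf K Q)
    (hcol : ¬ Collinear ℝ (Q : Set Pt)) {A : Type*} {h : Pt → A}
    (hb : ∀ u w b, (u, w, b) ∈ otri K → (∀ c, (w, u, c) ∉ otri K) → h u = h w) :
    ∃ k, ∀ v ∈ Q, ¬ firsts (fan (otri K) v) ⊆ seconds (fan (otri K) v) → h v = k := by
  obtain ⟨d, hd⟩ := exists_generic_dir Q
  replace hd : GenericDir Q d := hd
  by_cases hne : (Q.filter fun v => ¬ firsts (fan (otri K) v) ⊆ seconds (fan (otri K) v)).Nonempty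
  swap
  · refine ⟨h 0, fun v hv hc => absurd ⟨v, Finset.mem_filter.2 ⟨hv, hc⟩⟩ hne⟩
  obtain ⟨m, hm, hmin⟩ := Finset.exists_min_image _ (fun v => cr d (toC v)) hne
  obtain ⟨hmQ, hmc⟩ := Finset.mem_filter.1 hm
  refine ⟨h m, ?_⟩
  by_contra hcon
  push Not at hcon
  obtain ⟨v₁, hv₁, hc₁, hbad₁⟩ := hcon
  obtain ⟨v, hv, hvmin⟩ := (Q.filter fun v => ¬ firsts (fan (otri K) v) ⊆ seconds (fan (otri K) v) ∧
    h v ≠ h m).exists_min_image (fun v => cr d (toC v))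
    ⟨v₁, Finset.mem_filter.2 ⟨hv₁, hc₁, hbad₁⟩⟩
  obtain ⟨hvQ, hvc, hbad⟩ := Finset.mem_filter.1 hv
  have hlt : cr d (toC m) < cr d (toC v) :=
    lt_of_le_of_ne (hmin v (Finset.mem_filter.2 ⟨hvQ, hvc⟩)) fun he =>
      hbad (by rw [hd.inj hmQ hvQ he])
  obtain ⟨u, b, hul, hu⟩ := hK.exists_left_boundary hcol hd hvQ hmQ hlt hvc
  have key : u ∈ Q ∧ ¬ firsts (fan (otri K) u) ⊆ seconds (fan (otri K) u) ∧ h u = h v := by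
    rcases hu with ⟨h1, h2⟩ | ⟨h1, h2⟩
    · exact ⟨hK.mem_Q h1, (hK.not_closed_of_edge h1 h2).1, hb u v b h1 h2⟩
    · exact ⟨hK.mem_Q (otri_rot h1), (hK.not_closed_of_edge h1 h2).2, (hb v u b h1 h2).symm⟩
  exact absurd (hvmin u (Finset.mem_filter.2 ⟨key.1, key.2.1, fun h' => hbad (key.2.2 ▸ h')⟩))
    (not_le.2 hul)

/-- A property shared by adjacent triangles at `v` is shared by all triangles at `v`. -/
lemma IsTriangulationOf.fan_const (hK : IsTriangulationOf K Q) {v : Pt}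
    {p : Pt × Pt × Pt → Prop} (hp : ∀ x ∈ fan (otri K) v, ∀ y ∈ fan (otri K) v, x.2.1 = y.2.2 →
      (p x ↔ p y)) {x y : Pt × Pt × Pt} (hx : x ∈ fan (otri K) v) (hy : y ∈ fan (otri K) v)
    (hpx : p x) : p y := by
  by_contra hpy
  set T := fan (otri K) v with hT
  obtain ⟨d, hd⟩ := exists_transverse (fan_pos (K := K) v)
  have hf := hK.isFan v
  have hstart : ∀ r : Pt × Pt × Pt → Prop,
      (∀ x ∈ T, ∀ y ∈ T, x.2.1 = y.2.2 → (r x ↔ r y)) → ∀ a,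
      a ∈ firsts (T.filter r) → a ∉ seconds (T.filter r) → a ∈ firsts T \ seconds T := by
    intro r hr a ha ha'
    obtain ⟨z, hz, rfl⟩ := Finset.mem_image.1 ha
    obtain ⟨hzT, hzr⟩ := Finset.mem_filter.1 hz
    refine Finset.mem_sdiff.2 ⟨Finset.mem_image.2 ⟨z, hzT, rfl⟩, fun hs => ha' ?_⟩
    obtain ⟨w, hw, hwe⟩ := Finset.mem_image.1 hs
    exact Finset.mem_image.2 ⟨w, Finset.mem_filter.2 ⟨hw, (hr z hzT w hw hwe.symm).1 hzr⟩, hwe⟩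
  have hclosed : ∀ r : Pt × Pt × Pt → Prop, (T.filter r).Nonempty →
      firsts (T.filter r) ⊆ seconds (T.filter r) → ∀ d', Transverse T id d' →
      1 ≤ sepCount (T.filter r) id d' := by
    intro r hne hc d' hd'
    have hsub := Finset.filter_subset r T
    have hpos : Pos (T.filter r) id := (fan_pos v).mono hsub
    have h1 := (hf.mono hsub).angSum_closed hpos (hd'.mono hsub) hc
    have h2 := angSum_pos hpos hne
    by_contra h3
    have h4 : sepCount (T.filter r) id d' = 0 := by omega
    rw [h1, h4] at h2
    simp at h2
  obtain ⟨n, hn⟩ : ∃ n : Pt × Pt × Pt → Prop, ∀ z, n z ↔ ¬ p z := ⟨_, fun _ => Iff.rfl⟩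
  have hp' : ∀ x ∈ T, ∀ y ∈ T, x.2.1 = y.2.2 → (n x ↔ n y) := fun x hx y hy h => by
    rw [hn, hn, hp x hx y hy h]
  have hA : (T.filter p).Nonempty := ⟨x, Finset.mem_filter.2 ⟨hx, hpx⟩⟩
  have hB : (T.filter n).Nonempty := ⟨y, Finset.mem_filter.2 ⟨hy, (hn y).2 hpy⟩⟩
  have mixed : ∀ r r' : Pt × Pt × Pt → Prop, (T.filter r).Nonempty →
      (∀ x ∈ T, ∀ y ∈ T, x.2.1 = y.2.2 → (r' x ↔ r' y)) →
      firsts (T.filter r) ⊆ seconds (T.filter r) →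
      ¬ firsts (T.filter r') ⊆ seconds (T.filter r') → False := by
    intro r r' hne hr' hc hc'
    obtain ⟨a, ha, ha'⟩ := Finset.not_subset.1 hc'
    have h1 := Finset.mem_sdiff.1 (hstart r' hr' a ha ha')
    have h2 : ¬ firsts T ⊆ seconds T := fun h => h1.2 (h h1.1)
    have h3 : sepCount T id d + sepCount T id (-d) ≤ 1 := hK.sepCount_add_le hd h2
    have h4 := (hclosed r hne hc d hd).trans (sepCount_mono (Finset.filter_subset r T) id d)
    have h5 := (hclosed r hne hc (-d) hd.neg).trans
      (sepCount_mono (Finset.filter_subset r T) id (-d))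
    omega
  by_cases hcA : firsts (T.filter p) ⊆ seconds (T.filter p)
  · by_cases hcB : firsts (T.filter n) ⊆ seconds (T.filter n)
    · have h1 := hclosed p hA hcA d hd
      have h2 := hclosed n hB hcB d hd
      have h3 : sepCount T id d ≤ 1 := hK.sepCount_le_one v d
      have h4 : sepCount T id d = sepCount (T.filter p) id d +
          sepCount (T.filter n) id d := by
        rw [sepCount, sepCount, sepCount, ← Finset.card_union_of_disjoint]
        · congr 1
          ext z
          simp only [Finset.mem_union, Finset.mem_filter, hn]
          tauto
        · rw [Finset.disjoint_left]
          intro z hz hz'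
          simp only [Finset.mem_filter, hn] at hz hz'
          tauto
      omega
    · exact mixed p n hA hp' hcA hcB
  · by_cases hcB : firsts (T.filter n) ⊆ seconds (T.filter n)
    · exact mixed n p hB hp hcB hcA
    · obtain ⟨a, ha, ha'⟩ := Finset.not_subset.1 hcA
      obtain ⟨b, hb, hb'⟩ := Finset.not_subset.1 hcB
      have h1 := hstart p hp a ha ha'
      have h2 := hstart n hp' b hb hb'
      have hab := Finset.card_le_one.1 (hK.starts_le v) a h1 b h2
      subst hab
      obtain ⟨z, hz, hze⟩ := Finset.mem_image.1 ha
      obtain ⟨w, hw, hwe⟩ := Finset.mem_image.1 hb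
      obtain ⟨hz1, hz2⟩ := Finset.mem_filter.1 hz
      obtain ⟨hw1, hw2⟩ := Finset.mem_filter.1 hw
      rw [hf.inj₁ z hz1 w hw1 (hze.trans hwe.symm)] at hz2
      exact (hn w).1 hw2 hz2

/-- A nonempty set of triangles closed under adjacency contains all triangles. -/
lemma IsTriangulationOf.eq_of_adj_closed (hK : IsTriangulationOf K Q) {S : Finset (Finset Pt)}
    (hS : S ⊆ K) (hne : S.Nonempty)
    (hcl : ∀ x ∈ otri K, oedge x ∈ edgesOf S → verts x ∈ S) : S = K := by
  have hshare : ∀ x y : Pt × Pt × Pt, x ∈ otri K → y ∈ otri K → x.1 = y.1 → x.2.1 = y.2.2 →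
      (verts x ∈ S ↔ verts y ∈ S) := by
    rintro ⟨v, a, b⟩ ⟨v', c, a'⟩ hx hy h1 h2
    obtain rfl : v = v' := h1
    obtain rfl : a = a' := h2
    have hy' := otri_rot hy
    have hx' := otri_rot (otri_rot hx)
    have hva := (ne_of_ori (mem_otri.1 hx).2).1
    constructor
    · intro h
      rw [← verts_rot v c a]
      refine hcl _ hy' (mem_edgesOf.2 ⟨_, h, ?_, oedge_card hy'⟩)
      simp only [oedge, verts]
      intro z hz
      simp only [Finset.mem_insert, Finset.mem_singleton] at hz ⊢
      tauto
    · intro h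
      rw [← verts_rot v a b, ← verts_rot a b v]
      refine hcl _ hx' (mem_edgesOf.2 ⟨_, h, ?_, oedge_card hx'⟩)
      simp only [oedge, verts]
      intro z hz
      simp only [Finset.mem_insert, Finset.mem_singleton] at hz ⊢
      tauto
  have hfan : ∀ x ∈ otri K, ∀ y ∈ otri K, x.1 = y.1 → verts x ∈ S → verts y ∈ S := by
    intro x hx y hy h hxS
    refine hK.fan_const (v := y.1) (p := fun z => verts z ∈ S) ?_ (mem_fan.2 ⟨hx, h⟩)
      (mem_fan.2 ⟨hy, rfl⟩) hxS
    intro z hz w hw he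
    obtain ⟨hz1, hz2⟩ := mem_fan.1 hz
    obtain ⟨hw1, hw2⟩ := mem_fan.1 hw
    exact hshare z w hz1 hw1 (hz2.trans hw2.symm) he
  have hvert : ∀ t ∈ K, ∀ t' ∈ K, ∀ v, v ∈ t → v ∈ t' → t ∈ S → t' ∈ S := by
    intro t ht t' ht' v hv hv' htS
    obtain ⟨a, b, hx, rfl⟩ := hK.exists_orient ht hv
    obtain ⟨a', b', hx', rfl⟩ := hK.exists_orient ht' hv'
    exact hfan _ hx _ hx' rfl htS
  obtain ⟨d, hd⟩ := exists_generic_dir Q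
  replace hd : GenericDir Q d := hd
  obtain ⟨t₀, ht₀⟩ := hne
  have hK3 := hK.card3 t₀ (hS ht₀)
  obtain ⟨v₀, hv₀⟩ : t₀.Nonempty := Finset.card_pos.1 (by omega)
  obtain ⟨m, hm, hmin⟩ := Q.exists_min_image (fun q => cr d (toC q))
    ⟨v₀, hK.subset t₀ (hS ht₀) hv₀⟩
  have down : ∀ p : Pt → Prop, (∀ u w, Nbr K u w → (p u ↔ p w)) → ∀ v ∈ Q, (p v ↔ p m) := by
    intro p hp
    by_contra hcon
    push Not at hcon
    obtain ⟨v₁, hv₁, hbad₁⟩ := hcon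
    obtain ⟨v, hv, hvmin⟩ := (Q.filter fun v => ¬ (p v ↔ p m)).exists_min_image
      (fun v => cr d (toC v)) ⟨v₁, Finset.mem_filter.2 ⟨hv₁, by tauto⟩⟩
    obtain ⟨hvQ, hbad⟩ := Finset.mem_filter.1 hv
    have hlt : cr d (toC m) < cr d (toC v) :=
      lt_of_le_of_ne (hmin v hvQ) fun he => hbad (by rw [hd.inj hm hvQ he])
    obtain ⟨u, hu, hul⟩ := hK.exists_left_nbr hvQ hm hlt
    refine absurd (hvmin u (Finset.mem_filter.2 ⟨(hK.nbr_mem hu).2, fun h => hbad ?_⟩))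
      (not_le.2 hul)
    exact (hp v u hu).trans h
  have hall := down (fun v => ∃ t ∈ S, v ∈ t) (by
    have one : ∀ u w, Nbr K u w → (∃ t ∈ S, u ∈ t) → ∃ t ∈ S, w ∈ t := by
      rintro u w hn ⟨t, ht, hut⟩
      obtain ⟨z, hz, huz, hwz, -⟩ := hn.tri
      exact ⟨verts z, hvert t (hS ht) _ (mem_otri.1 hz).1 u hut huz ht, hwz⟩
    exact fun u w hn => ⟨one u w hn, one w u hn.symm⟩)
  refine Finset.Subset.antisymm hS fun t ht => ?_
  have h3 := hK.card3 t ht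
  obtain ⟨v, hv⟩ : t.Nonempty := Finset.card_pos.1 (by omega)
  obtain ⟨t', ht', hv'⟩ := (hall v (hK.subset t ht hv)).2
    ((hall v₀ (hK.subset t₀ (hS ht₀) hv₀)).1 ⟨t₀, ht₀, hv₀⟩)
  exact hvert t' (hS ht') t ht v hv' hv ht'

end

section

variable {K : Finset (Finset Pt)} {Q : Finset Pt}

/-- `F` assigns to each triangle three angles that sum to `π`. -/
def RowPi (K : Finset (Finset Pt)) (F : Pt × Pt × Pt → ℝ) : Prop :=
  ∀ x ∈ otri K, F x + F (x.2.1, x.2.2, x.1) + F (x.2.2, x.1, x.2.1) = π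

lemma rowPi_sang (K : Finset (Finset Pt)) : RowPi K fun x => sang x.1 x.2.1 x.2.2 :=
  fun _ hx => sang_sum (mem_otri.1 hx).2

lemma IsTriangulationOf.sum_edges_at (hK : IsTriangulationOf K Q)
    (hcol : ¬ Collinear ℝ (Q : Set Pt)) {F : Pt × Pt × Pt → ℝ} (hF : RowPi K F)
    {Δ : Finset Pt → ℝ} (hΔ : ∀ e ∈ edgesOf K, ∑ x ∈ otri K with oedge x = e, F x = Δ e) (q : Pt) :
    ∑ e ∈ edgesOf K with q ∈ e, (π - Δ e) = ∑ x ∈ fan (otri K) q, F x +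
      (if firsts (fan (otri K) q) ⊆ seconds (fan (otri K) q) then 0 else π) := by
  have h1 : ∑ e ∈ edgesOf K with q ∈ e, Δ e =
      ∑ e ∈ edgesOf K with q ∈ e, ∑ x ∈ otri K with oedge x = e, F x :=
    Finset.sum_congr rfl fun e he => (hΔ e (Finset.mem_filter.1 he).1).symm
  have h2 : ∑ x ∈ fan (otri K) q, (F (x.2.1, x.2.2, x.1) + F (x.2.2, x.1, x.2.1)) =
      ∑ x ∈ fan (otri K) q, (π - F x) :=
    Finset.sum_congr rfl fun x hx => by linarith [hF x (mem_fan.1 hx).1]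
  rw [Finset.sum_sub_distrib, h1, IsTriangulationOf.sum_edges F (fun e => q ∈ e), sum_opp_fan F q,
    h2, Finset.sum_sub_distrib, Finset.sum_const, Finset.sum_const, nsmul_eq_mul, nsmul_eq_mul,
    hK.card_edges_at hcol q]
  split_ifs <;> ring

lemma RowPi.sum_filter (hK : IsTriangulationOf K Q) {F : Pt × Pt × Pt → ℝ} (hF : RowPi K F)
    {S : Finset (Finset Pt)} (hS : S ⊆ K) : ∑ x ∈ otri K with verts x ∈ S, F x = π * S.card := by
  rw [← Finset.sum_fiberwise_of_maps_to (s := (otri K).filter fun x => verts x ∈ S)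
    (t := S) (g := verts) (fun x hx => (Finset.mem_filter.1 hx).2), mul_comm, ← nsmul_eq_mul,
    ← Finset.sum_const]
  refine Finset.sum_congr rfl fun t ht => ?_
  obtain ⟨x, hx, rfl⟩ := hK.exists_verts (hS ht)
  rw [← hF x hx, ← sum_row hx]
  refine Finset.sum_congr ?_ fun _ _ => rfl
  ext y
  simp only [Finset.mem_filter]
  constructor
  · rintro ⟨⟨h1, -⟩, h2⟩; exact ⟨h1, h2⟩
  · rintro ⟨h1, h2⟩; exact ⟨⟨h1, h2 ▸ ht⟩, h2⟩

lemma RowPi.sum_eq (hK : IsTriangulationOf K Q) {F : Pt × Pt × Pt → ℝ} (hF : RowPi K F) :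
    ∑ x ∈ otri K, F x = π * K.card := by
  rw [← hF.sum_filter hK subset_rfl, Finset.filter_true_of_mem]
  exact fun x hx => (mem_otri.1 hx).1

lemma IsTriangulationOf.euler' (hK : IsTriangulationOf K Q) (hcol : ¬ Collinear ℝ (Q : Set Pt)) :
    (K.card : ℝ) + 2 = 2 * Q.card -
      (Q.filter fun v => ¬ firsts (fan (otri K) v) ⊆ seconds (fan (otri K) v)).card := by
  have h1 := hK.euler hcol
  rw [hK.card_otri] at h1
  have h2 : ∑ v ∈ Q, (if firsts (fan (otri K) v) ⊆ seconds (fan (otri K) v) then (2 : ℝ) else 1) =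
      2 * Q.card -
      (Q.filter fun v => ¬ firsts (fan (otri K) v) ⊆ seconds (fan (otri K) v)).card := by
    rw [Finset.card_eq_sum_ones, Finset.card_eq_sum_ones, Finset.sum_filter]
    push_cast
    rw [Finset.mul_sum, ← Finset.sum_sub_distrib]
    refine Finset.sum_congr rfl fun v _ => ?_
    split_ifs <;> norm_num
  rw [← h2, ← h1]; ring

lemma IsTriangulationOf.filter_frontier (hK : IsTriangulationOf K Q) :
    Q.filter (fun q => q ∈ frontier (convexHull ℝ (Q : Set Pt))) =
      Q.filter fun v => ¬ firsts (fan (otri K) v) ⊆ seconds (fan (otri K) v) :=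
  Finset.filter_congr fun _ hv => hK.frontier_iff hv

lemma IsTriangulationOf.sum_boundary (hK : IsTriangulationOf K Q)
    (hcol : ¬ Collinear ℝ (Q : Set Pt)) :
    ∑ q ∈ Q with q ∈ frontier (convexHull ℝ (Q : Set Pt)), (π - angSum (fan (otri K) q) id) =
      2 * π := by
  have h1 := hK.euler' hcol
  have h2 := (rowPi_sang K).sum_eq hK
  rw [← sum_fan (Q := Q) (fun _ _ _ h => hK.mem_Q h)] at h2
  rw [← Finset.sum_filter_add_sum_filter_not Q
    (fun v => ¬ firsts (fan (otri K) v) ⊆ seconds (fan (otri K) v))] at h2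
  have h3 : ∑ v ∈ Q with ¬ ¬ firsts (fan (otri K) v) ⊆ seconds (fan (otri K) v),
      ∑ x ∈ fan (otri K) v, sang x.1 x.2.1 x.2.2 =
      ∑ v ∈ Q with ¬ ¬ firsts (fan (otri K) v) ⊆ seconds (fan (otri K) v), 2 * π :=
    Finset.sum_congr rfl fun v hv => hK.angSum_closed (Finset.mem_filter.1 hv).1
      (not_not.1 (Finset.mem_filter.1 hv).2)
  have h4 := Finset.card_filter_add_card_filter_not (s := Q)
    (fun v => ¬ firsts (fan (otri K) v) ⊆ seconds (fan (otri K) v))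
  have h4' : (((Q.filter fun v => ¬ firsts (fan (otri K) v) ⊆ seconds (fan (otri K) v)).card : ℝ) +
    (Q.filter fun v => ¬ ¬ firsts (fan (otri K) v) ⊆ seconds (fan (otri K) v)).card) = Q.card := by
    exact_mod_cast h4
  rw [h3, Finset.sum_const, nsmul_eq_mul] at h2
  have h5 : ∑ v ∈ Q with ¬ firsts (fan (otri K) v) ⊆ seconds (fan (otri K) v),
      angSum (fan (otri K) v) id = ∑ v ∈ Q with ¬ firsts (fan (otri K) v) ⊆ seconds (fan (otri K) v),
      ∑ x ∈ fan (otri K) v, sang x.1 x.2.1 x.2.2 := rfl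
  rw [hK.filter_frontier, Finset.sum_sub_distrib, h5, Finset.sum_const, nsmul_eq_mul]
  generalize (∑ v ∈ Q with ¬ firsts (fan (otri K) v) ⊆ seconds (fan (otri K) v),
      ∑ x ∈ fan (otri K) v, sang x.1 x.2.1 x.2.2) = A at *
  generalize ((Q.filter fun v => ¬ firsts (fan (otri K) v) ⊆ seconds (fan (otri K) v)).card : ℝ)
    = B at *
  generalize ((Q.filter fun v => ¬ ¬ firsts (fan (otri K) v) ⊆ seconds (fan (otri K) v)).card : ℝ)
    = C at *
  have h6 : (K.card : ℝ) = 2 * (B + C) - B - 2 := by rw [h4']; linarith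
  rw [h6] at h2
  linear_combination -h2

lemma IsTriangulationOf.excess_pos (hK : IsTriangulationOf K Q) {F : Pt × Pt × Pt → ℝ}
    (hF : RowPi K F) (hpos : ∀ x ∈ otri K, 0 < F x) {Δ : Finset Pt → ℝ}
    (hΔ : ∀ e ∈ edgesOf K, ∑ x ∈ otri K with oedge x = e, F x = Δ e) {S : Finset (Finset Pt)}
    (hS : S ⊆ K) (hne : S.Nonempty) (hSK : S ≠ K) : π * S.card < ∑ e ∈ edgesOf S, Δ e := by
  have hsub : edgesOf S ⊆ edgesOf K := fun e he => by
    obtain ⟨t, ht, h⟩ := mem_edgesOf.1 he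
    exact mem_edgesOf.2 ⟨t, hS ht, h⟩
  have h1 : ∑ e ∈ edgesOf S, Δ e = ∑ x ∈ otri K with oedge x ∈ edgesOf S, F x := by
    rw [← IsTriangulationOf.sum_edges F (fun e => e ∈ edgesOf S)]
    have : (edgesOf K).filter (fun e => e ∈ edgesOf S) = edgesOf S := by
      ext e
      simp only [Finset.mem_filter]
      exact ⟨fun h => h.2, fun h => ⟨hsub h, h⟩⟩
    rw [this]
    exact Finset.sum_congr rfl fun e he => (hΔ e (hsub he)).symm
  rw [h1, ← hF.sum_filter hK hS]
  have hex : ∃ x ∈ otri K, oedge x ∈ edgesOf S ∧ verts x ∉ S := by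
    by_contra hcon
    push Not at hcon
    exact hSK (hK.eq_of_adj_closed hS hne hcon)
  obtain ⟨x, hx, hx1, hx2⟩ := hex
  refine Finset.sum_lt_sum_of_subset (i := x) ?_ (Finset.mem_filter.2 ⟨hx, hx1⟩)
    (fun h => hx2 (Finset.mem_filter.1 h).2) (hpos x hx)
    fun y hy _ => (hpos y (Finset.mem_filter.1 hy).1).le
  intro y hy
  obtain ⟨hy1, hy2⟩ := Finset.mem_filter.1 hy
  exact Finset.mem_filter.2 ⟨hy1, oedge_mem hy1 hy2⟩

/-- The vertex conditions determine the total sum of the edge weights. -/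
lemma IsTriangulationOf.total (hK : IsTriangulationOf K Q) (hcol : ¬ Collinear ℝ (Q : Set Pt))
    {Δ : Finset Pt → ℝ} {Λ : Pt → ℝ}
    (h1 : ∀ q ∈ Q, q ∉ frontier (convexHull ℝ (Q : Set Pt)) →
        ∑ e ∈ (edgesOf K).filter (fun e => q ∈ e), (π - Δ e) = 2 * π)
    (h2 : ∀ q ∈ Q, q ∈ frontier (convexHull ℝ (Q : Set Pt)) →
        (∑ e ∈ (edgesOf K).filter (fun e => q ∈ e), (π - Δ e)) + (π - Λ q) = 2 * π)
    (h3 : ∑ q ∈ Q.filter (fun q => q ∈ frontier (convexHull ℝ (Q : Set Pt))), (π - Λ q)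
        = 2 * π) : ∑ e ∈ edgesOf K, Δ e = π * K.card := by
  have dbl : ∀ f : Finset Pt → ℝ, ∑ q ∈ Q, ∑ e ∈ edgesOf K with q ∈ e, f e =
      2 * ∑ e ∈ edgesOf K, f e := by
    intro f
    simp only [Finset.sum_filter]
    rw [Finset.sum_comm, Finset.mul_sum]
    refine Finset.sum_congr rfl fun e he => ?_
    obtain ⟨t, ht, het, hc⟩ := mem_edgesOf.1 he
    rw [← Finset.sum_filter, Finset.sum_const, nsmul_eq_mul]
    have : Q.filter (fun q => q ∈ e) = e := by
      ext q
      simp only [Finset.mem_filter]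
      exact ⟨fun h => h.2, fun h => ⟨hK.subset t ht (het h), h⟩⟩
    rw [this, hc]; norm_num
  have e1 := dbl (fun e => π - Δ e)
  have e2 := dbl (fun _ => 1)
  have e3 : ∑ q ∈ Q, ∑ e ∈ edgesOf K with q ∈ e, (π - Δ e) = 2 * π * Q.card - 2 * π := by
    have : ∀ q ∈ Q, ∑ e ∈ edgesOf K with q ∈ e, (π - Δ e) = 2 * π -
        if q ∈ frontier (convexHull ℝ (Q : Set Pt)) then π - Λ q else 0 := by
      intro q hq
      split_ifs with h
      · linarith [h2 q hq h]
      · linarith [h1 q hq h]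
    rw [Finset.sum_congr rfl this, Finset.sum_sub_distrib, ← Finset.sum_filter, h3, Finset.sum_const,
      nsmul_eq_mul]
    ring
  have e4 : ∑ q ∈ Q, ∑ e ∈ edgesOf K with q ∈ e, (1 : ℝ) = 3 * K.card +
      (Q.filter fun v => ¬ firsts (fan (otri K) v) ⊆ seconds (fan (otri K) v)).card := by
    have : ∀ q ∈ Q, ∑ e ∈ edgesOf K with q ∈ e, (1 : ℝ) = ∑ x ∈ fan (otri K) q, 1 +
        if ¬ firsts (fan (otri K) q) ⊆ seconds (fan (otri K) q) then 1 else 0 := by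
      intro q _
      have := hK.card_edges_at hcol q
      rw [Finset.sum_const, Finset.sum_const, nsmul_eq_mul, nsmul_eq_mul, this]
      split_ifs <;> simp
    rw [Finset.sum_congr rfl this, Finset.sum_add_distrib,
      sum_fan (Q := Q) (fun _ _ _ h => hK.mem_Q h) (fun _ => (1 : ℝ)), ← Finset.sum_filter,
      Finset.sum_const, Finset.sum_const, nsmul_eq_mul, nsmul_eq_mul, hK.card_otri]
    ring
  have e5 := hK.euler' hcol
  rw [e3, Finset.sum_sub_distrib, Finset.sum_const, nsmul_eq_mul] at e1
  rw [e4, Finset.sum_const, nsmul_eq_mul] at e2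
  generalize ((Q.filter fun v => ¬ firsts (fan (otri K) v) ⊆ seconds (fan (otri K) v)).card : ℝ)
    = B at *
  have e6 : (B : ℝ) = 2 * Q.card - K.card - 2 := by linarith
  have e7 : ((edgesOf K).card : ℝ) = K.card + Q.card - 1 := by linarith
  rw [e7] at e1
  linarith

end

section

variable {K D : Finset (Finset Pt)} {Q P : Finset Pt}

lemma IsTriangulationOf.card_fan (hK : IsTriangulationOf K Q) (q : Pt) :
    (fan (otri K) q).card = (K.filter fun t => q ∈ t).card := by
  refine Finset.card_bij (fun x _ => verts x) ?_ ?_ ?_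
  · intro x hxf
    obtain ⟨hx, rfl⟩ := mem_fan.1 hxf
    exact Finset.mem_filter.2 ⟨(mem_otri.1 hx).1, Finset.mem_insert_self _ _⟩
  · intro x hxf y hyf h
    obtain ⟨hx, hxq⟩ := mem_fan.1 hxf
    obtain ⟨hy, hyq⟩ := mem_fan.1 hyf
    exact otri_ext hx hy h (hxq.trans hyq.symm)
  · intro t htf
    obtain ⟨ht, hq⟩ := Finset.mem_filter.1 htf
    obtain ⟨a, b, hx, rfl⟩ := hK.exists_orient ht hq
    exact ⟨_, mem_fan.2 ⟨hx, rfl⟩, rfl⟩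

/-- A vertex is on the frontier iff it is incident to more edges than triangles. -/
lemma IsTriangulationOf.frontier_iff_card (hK : IsTriangulationOf K Q)
    (hcol : ¬ Collinear ℝ (Q : Set Pt)) {q : Pt} (hq : q ∈ Q) :
    q ∈ frontier (convexHull ℝ (Q : Set Pt)) ↔
      ((edgesOf K).filter fun e => q ∈ e).card ≠ (K.filter fun t => q ∈ t).card := by
  have h := hK.card_edges_at hcol q
  rw [hK.card_fan] at h
  rw [hK.frontier_iff hq, not_iff_not]
  split_ifs at h with hc
  · exact iff_of_true hc (by exact_mod_cast (h.trans (add_zero _)))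
  · refine iff_of_false hc fun h' => ?_
    rw [h'] at h
    linarith

lemma IsTriangulationOf.noncollinear (hK : IsTriangulationOf K Q) {t : Finset Pt} (ht : t ∈ K) :
    ¬ Collinear ℝ (Q : Set Pt) := by
  intro h
  obtain ⟨x, hx, rfl⟩ := hK.exists_verts ht
  refine (mem_otri.1 hx).2.ne' (ori_of_collinear (h.subset ?_))
  have := hK.subset _ ht
  intro y hy
  refine this ?_
  simpa [verts] using hy

/-- `φ` maps the triangles of `K` bijectively to those of `D`. -/
structure IsIso (K D : Finset (Finset Pt)) (Q : Finset Pt) (φ : Pt → Pt) : Prop where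
  inj : Set.InjOn φ Q
  sub : ∀ t ∈ K, t ⊆ Q
  tri : D = K.image (Finset.image φ)

variable {φ : Pt → Pt}

lemma IsIso.image_inj (h : IsIso K D Q φ) {s t : Finset Pt} (hs : s ⊆ Q) (ht : t ⊆ Q)
    (hst : s.image φ = t.image φ) : s = t :=
  (Finset.image_eq_image_iff_of_injOn h.inj hs ht).1 hst

lemma IsIso.edge_sub (h : IsIso K D Q φ) {e : Finset Pt} (he : e ∈ edgesOf K) : e ⊆ Q := by
  obtain ⟨t, ht, het, -⟩ := mem_edgesOf.1 he
  exact het.trans (h.sub t ht)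

lemma IsIso.mono (h : IsIso K D Q φ) {S : Finset (Finset Pt)} (hS : S ⊆ K) :
    IsIso S (S.image (Finset.image φ)) Q φ :=
  ⟨h.inj, fun t ht => h.sub t (hS ht), rfl⟩

lemma IsIso.edges (h : IsIso K D Q φ) : edgesOf D = (edgesOf K).image (Finset.image φ) := by
  ext e
  simp only [Finset.mem_image, mem_edgesOf, h.tri]
  constructor
  · rintro ⟨_, ⟨t, ht, rfl⟩, he, hc⟩
    obtain ⟨e', he', rfl⟩ := Finset.subset_image_iff.1 he
    refine ⟨e', ⟨t, ht, he', ?_⟩, rfl⟩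
    rwa [Finset.card_image_of_injOn (h.inj.mono (he'.trans (h.sub t ht)))] at hc
  · rintro ⟨e', ⟨t, ht, he', hc⟩, rfl⟩
    refine ⟨_, ⟨t, ht, rfl⟩, Finset.image_subset_image he', ?_⟩
    rwa [Finset.card_image_of_injOn (h.inj.mono (he'.trans (h.sub t ht)))]

lemma IsIso.mem_image_iff (h : IsIso K D Q φ) {s : Finset Pt} (hs : s ⊆ Q) {q : Pt} (hq : q ∈ Q) :
    φ q ∈ s.image φ ↔ q ∈ s := by
  refine ⟨fun h' => ?_, fun h' => Finset.mem_image_of_mem _ h'⟩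
  obtain ⟨a, ha, hb⟩ := Finset.mem_image.1 h'
  rwa [← h.inj (hs ha) hq hb]

lemma IsIso.sum_edges (h : IsIso K D Q φ) (f : Finset Pt → ℝ) :
    ∑ e ∈ edgesOf D, f e = ∑ e ∈ edgesOf K, f (e.image φ) := by
  rw [h.edges, Finset.sum_image]
  exact fun s hs t ht => h.image_inj (h.edge_sub hs) (h.edge_sub ht)

lemma IsIso.sum_edges_at (h : IsIso K D Q φ) (f : Finset Pt → ℝ) {q : Pt} (hq : q ∈ Q) :
    ∑ e ∈ edgesOf D with φ q ∈ e, f e = ∑ e ∈ edgesOf K with q ∈ e, f (e.image φ) := by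
  rw [Finset.sum_filter, Finset.sum_filter, h.sum_edges]
  refine Finset.sum_congr rfl fun e he => ?_
  simp only [h.mem_image_iff (h.edge_sub he) hq]

lemma IsIso.card_edges_at (h : IsIso K D Q φ) {q : Pt} (hq : q ∈ Q) :
    ((edgesOf D).filter fun e => φ q ∈ e).card = ((edgesOf K).filter fun e => q ∈ e).card := by
  have := h.sum_edges_at (fun _ => 1) hq
  simp only [Finset.sum_const, nsmul_eq_mul, mul_one] at this
  exact_mod_cast this

lemma IsIso.card_tri_at (h : IsIso K D Q φ) {q : Pt} (hq : q ∈ Q) :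
    (D.filter fun e => φ q ∈ e).card = (K.filter fun e => q ∈ e).card := by
  rw [Finset.card_filter, Finset.card_filter, h.tri, Finset.sum_image]
  · refine Finset.sum_congr rfl fun e he => ?_
    simp only [h.mem_image_iff (h.sub e he) hq]
  · exact fun s hs t ht => h.image_inj (h.sub s hs) (h.sub t ht)

lemma isIso_of_bijOn (hK : IsTriangulationOf K Q) (hD : IsTriangulationOf D P)
    (hφ : Set.BijOn φ (Q : Set Pt) (P : Set Pt))
    (h : ∀ a b c : Pt, a ∈ Q → b ∈ Q → c ∈ Q →
        (({a, b, c} : Finset Pt) ∈ K ↔ ({φ a, φ b, φ c} : Finset Pt) ∈ D)) : IsIso K D Q φ := by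
  refine ⟨hφ.injOn, hK.subset, ?_⟩
  ext t
  rw [Finset.mem_image]
  constructor
  · intro ht
    obtain ⟨x, y, z, -, -, -, rfl⟩ := Finset.card_eq_three.1 (hD.card3 t ht)
    have hsub := hD.subset _ ht
    obtain ⟨a, ha, rfl⟩ := hφ.surjOn (Finset.mem_coe.2 (hsub (by simp : x ∈ _)))
    obtain ⟨b, hb, rfl⟩ := hφ.surjOn (Finset.mem_coe.2 (hsub (by simp : y ∈ _)))
    obtain ⟨c, hc, rfl⟩ := hφ.surjOn (Finset.mem_coe.2 (hsub (by simp : z ∈ _)))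
    exact ⟨{a, b, c}, (h a b c ha hb hc).2 ht, by simp [Finset.image_insert]⟩
  · rintro ⟨s, hs, rfl⟩
    obtain ⟨a, b, c, -, -, -, rfl⟩ := Finset.card_eq_three.1 (hK.card3 s hs)
    have hsub := hK.subset _ hs
    have := (h a b c (hsub (by simp)) (hsub (by simp)) (hsub (by simp))).1 hs
    simpa [Finset.image_insert] using this

lemma IsIso.frontier_iff (h : IsIso K D Q φ) (hK : IsTriangulationOf K Q)
    (hD : IsTriangulationOf D P) (hQ : ¬ Collinear ℝ (Q : Set Pt))
    (hP : ¬ Collinear ℝ (P : Set Pt)) {q : Pt} (hq : q ∈ Q) (hq' : φ q ∈ P) :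
    φ q ∈ frontier (convexHull ℝ (P : Set Pt)) ↔ q ∈ frontier (convexHull ℝ (Q : Set Pt)) := by
  rw [hK.frontier_iff_card hQ hq, hD.frontier_iff_card hP hq', h.card_edges_at hq, h.card_tri_at hq]

/-- The angle conditions are necessary. -/
theorem necessity (hK : IsTriangulationOf K Q) (hcol : ¬ Collinear ℝ (Q : Set Pt))
    (hD : IsTriangulationOf D P) (hφ : Set.BijOn φ (Q : Set Pt) (P : Set Pt))
    (hiso : IsIso K D Q φ) {Δ : Finset Pt → ℝ} {Λ : Pt → ℝ}
    (hΔ : ∀ e ∈ edgesOf K, dihedral D (e.image φ) = Δ e)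
    (hΛ : ∀ q ∈ Q, q ∈ frontier (convexHull ℝ (Q : Set Pt)) → bdryAngle D (φ q) = Λ q) :
    (∀ q ∈ Q, q ∉ frontier (convexHull ℝ (Q : Set Pt)) →
        ∑ e ∈ (edgesOf K).filter (fun e => q ∈ e), (π - Δ e) = 2 * π) ∧
     (∀ q ∈ Q, q ∈ frontier (convexHull ℝ (Q : Set Pt)) →
        (∑ e ∈ (edgesOf K).filter (fun e => q ∈ e), (π - Δ e)) + (π - Λ q) = 2 * π) ∧
     (∑ q ∈ Q.filter (fun q => q ∈ frontier (convexHull ℝ (Q : Set Pt))), (π - Λ q)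
        = 2 * π) ∧
     (∀ S : Finset (Finset Pt), S ⊆ K → S.Nonempty → S ≠ K →
        π * S.card < ∑ e ∈ edgesOf S, Δ e) := by
  have hP : ¬ Collinear ℝ (P : Set Pt) := by
    have hQ : Q.Nonempty := by
      rw [Finset.nonempty_iff_ne_empty]
      rintro rfl
      exact hcol (by simpa using collinear_empty ℝ Pt)
    obtain ⟨q, hq⟩ := hQ
    obtain ⟨t, ht, -⟩ := hK.vertex q hq
    exact hD.noncollinear (hiso.tri ▸ Finset.mem_image_of_mem _ ht)
  have hdih : ∀ e ∈ edgesOf D, ∑ x ∈ otri D with oedge x = e, sang x.1 x.2.1 x.2.2 = dihedral D e :=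
    fun e he => (hD.dihedral_eq he).symm
  have hat : ∀ q ∈ Q, ∑ e ∈ edgesOf K with q ∈ e, (π - Δ e) = angSum (fan (otri D) (φ q)) id +
      (if firsts (fan (otri D) (φ q)) ⊆ seconds (fan (otri D) (φ q)) then 0 else π) := by
    intro q hq
    have h1 := hD.sum_edges_at hP (rowPi_sang D) hdih (φ q)
    rw [hiso.sum_edges_at _ hq] at h1
    refine (Finset.sum_congr rfl fun e he => ?_).trans h1
    rw [hΔ e (Finset.mem_filter.1 he).1]
  have hfr : ∀ q ∈ Q, (q ∈ frontier (convexHull ℝ (Q : Set Pt)) ↔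
      ¬ firsts (fan (otri D) (φ q)) ⊆ seconds (fan (otri D) (φ q))) := fun q hq => by
    rw [← hiso.frontier_iff hK hD hcol hP hq (hφ.mapsTo hq), hD.frontier_iff (hφ.mapsTo hq)]
  refine ⟨fun q hq hf => ?_, fun q hq hf => ?_, ?_, fun S hS hne hSK => ?_⟩
  · have hc := not_not.1 (mt (hfr q hq).2 hf)
    rw [hat q hq, if_pos hc, hD.angSum_closed (hφ.mapsTo hq) hc, add_zero]
  · rw [hat q hq, if_neg ((hfr q hq).1 hf), ← hΛ q hq hf, hD.bdryAngle_eq]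
    ring
  · rw [← hD.sum_boundary hP]
    have himg : P = Q.image φ := by
      apply Finset.coe_injective
      rw [Finset.coe_image, hφ.image_eq]
    rw [Finset.sum_filter, Finset.sum_filter, himg, Finset.sum_image hiso.inj]
    refine Finset.sum_congr rfl fun q hq => ?_
    rw [← himg]
    have := hiso.frontier_iff hK hD hcol hP hq (hφ.mapsTo hq)
    by_cases hf : q ∈ frontier (convexHull ℝ (Q : Set Pt))
    · rw [if_pos hf, if_pos (this.2 hf), ← hΛ q hq hf, hD.bdryAngle_eq]
    · rw [if_neg hf, if_neg (mt this.1 hf)]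
  · have hiS := hiso.mono hS
    have h1 := hD.excess_pos (rowPi_sang D) (fun x hx => (sang_pos (mem_otri.1 hx).2).1) hdih
      (S := S.image (Finset.image φ)) (hiso.tri ▸ Finset.image_subset_image hS) (hne.image _) ?_
    · rw [hiS.sum_edges, Finset.card_image_of_injOn
        fun s hs t ht => hiso.image_inj (hiS.sub s hs) (hiS.sub t ht)] at h1
      refine h1.trans_le (Finset.sum_congr rfl fun e he => hΔ e ?_).le
      obtain ⟨t, ht, h⟩ := mem_edgesOf.1 he
      exact mem_edgesOf.2 ⟨t, hS ht, h⟩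
    · intro h
      rw [hiso.tri] at h
      refine hSK (Finset.Subset.antisymm hS fun t ht => ?_)
      have h2 : t.image φ ∈ S.image (Finset.image φ) := h ▸ Finset.mem_image_of_mem _ ht
      obtain ⟨s, hs, hst⟩ := Finset.mem_image.1 h2
      rwa [← hiso.image_inj (hiS.sub s hs) (hiso.sub t ht) hst]

end

section

/-- A vector orthogonal to every covector vanishing on the range of `A` is in that range. -/
lemma exists_eq_of_orthogonal {I V : Type*} [Fintype I] [AddCommGroup V] [Module ℝ V]
    (A : V →ₗ[ℝ] (I → ℝ)) (β : I → ℝ)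
    (h : ∀ y : I → ℝ, (∀ ψ, ∑ i, y i * A ψ i = 0) → ∑ i, y i * β i = 0) : ∃ ψ, A ψ = β := by
  by_contra hβ
  obtain ⟨f, hf, hker⟩ := Submodule.exists_le_ker_of_notMem (p := LinearMap.range A) (v := β)
    (fun ⟨ψ, hψ⟩ => hβ ⟨ψ, hψ⟩)
  have key : ∀ z : I → ℝ, f z = ∑ i, f (Pi.single i 1) * z i := by
    intro z
    rw [LinearMap.pi_apply_eq_sum_univ f z]
    refine Finset.sum_congr rfl fun i _ => ?_
    rw [smul_eq_mul, mul_comm]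
    congr 2
    ext j
    simp [Pi.single_apply, eq_comm]
  refine hf ?_
  rw [key]
  refine h _ fun ψ => ?_
  rw [← key]
  exact hker ⟨ψ, rfl⟩

lemma exists_pos_le {α : Type*} (s : Finset α) (f : α → ℝ) (h : ∀ a ∈ s, 0 < f a) :
    ∃ δ > 0, ∀ a ∈ s, δ ≤ f a := by
  rcases s.eq_empty_or_nonempty with rfl | hs
  · exact ⟨1, one_pos, by simp⟩
  · obtain ⟨a, ha, hmin⟩ := s.exists_min_image f hs
    exact ⟨f a, h a ha, hmin⟩

section Feasible

variable {ι R E : Type*} [Fintype ι] {r : ι → R} {c : ι → E} {Δ : E → ℝ}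

/-- The excess of the column `e`. -/
def exc (c : ι → E) (Δ : E → ℝ) (α : ι → ℝ) (e : E) : ℝ := ∑ y with c y = e, α y - Δ e

/-- Matrices with entries at least `ε` and row sums `π`. -/
def rowSet (r : ι → R) (ε : ℝ) : Set (ι → ℝ) :=
  {α | (∀ x, ε ≤ α x) ∧ ∀ x, ∑ y with r y = r x, α y = π}

lemma le_pi_of_row {α : ι → ℝ} (h0 : ∀ x, 0 ≤ α x) {x : ι} (h : ∑ y with r y = r x, α y = π) :
    α x ≤ π := by
  rw [← h]
  exact Finset.single_le_sum (f := α) (fun i _ => h0 i) (Finset.mem_filter.2 ⟨mem_univ x, rfl⟩)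

lemma rowSet_compact {ε : ℝ} (hε : 0 ≤ ε) : IsCompact (rowSet r ε) := by
  refine IsCompact.of_isClosed_subset (isCompact_Icc (a := fun _ : ι => (0 : ℝ)) (b := fun _ => π))
    ?_ ?_
  · have : rowSet r ε = (⋂ x, {α : ι → ℝ | ε ≤ α x}) ∩
        ⋂ x, {α : ι → ℝ | ∑ y with r y = r x, α y = π} := by
      ext; simp [rowSet]
    rw [this]
    exact (isClosed_iInter fun x => isClosed_le continuous_const (continuous_apply x)).inter
      (isClosed_iInter fun x => isClosed_eq
        (continuous_finsetSum _ fun y _ => continuous_apply y) continuous_const)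
  · intro α hα
    have h0 : ∀ x, 0 ≤ α x := fun x => hε.trans (hα.1 x)
    exact ⟨fun x => h0 x, fun x => le_pi_of_row h0 (hα.2 x)⟩

lemma rowSet_nonempty {ε : ℝ} (hε : ε * Fintype.card ι ≤ π) (hε0 : 0 ≤ ε) :
    (rowSet r ε).Nonempty := by
  have hpos : ∀ x, 0 < ((univ.filter fun y => r y = r x).card : ℝ) := fun x =>
    Nat.cast_pos.2 (Finset.card_pos.2 ⟨x, Finset.mem_filter.2 ⟨mem_univ x, rfl⟩⟩)
  refine ⟨fun x => π / (univ.filter fun y => r y = r x).card, fun x => ?_, fun x => ?_⟩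
  · rw [le_div_iff₀ (hpos x)]
    refine le_trans (mul_le_mul_of_nonneg_left ?_ hε0) hε
    exact_mod_cast Finset.card_le_univ _
  · rw [Finset.sum_congr rfl (g := fun _ => π / (univ.filter fun y => r y = r x).card)
      fun y hy => by simp only [(Finset.mem_filter.1 hy).2], Finset.sum_const, nsmul_eq_mul]
    field_simp [(hpos x).ne']

lemma sum_transfer (p : ι → Prop) (α : ι → ℝ) {x y : ι} (s : ℝ) :
    ∑ z with p z, (α z + ((if z = y then s else 0) - if z = x then s else 0)) =
      ∑ z with p z, α z + ((if p y then s else 0) - if p x then s else 0) := by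
  rw [Finset.sum_add_distrib, Finset.sum_sub_distrib, Finset.sum_ite_eq', Finset.sum_ite_eq']
  simp

lemma exc_le_of_min {ε : ℝ} {α : ι → ℝ} (hα : α ∈ rowSet r ε)
    (hmin : ∀ β ∈ rowSet r ε, ∑ e ∈ univ.image c, exc c Δ α e ^ 2 ≤
      ∑ e ∈ univ.image c, exc c Δ β e ^ 2)
    {x y : ι} (hxy : r x = r y) (hx : ε < α x) : exc c Δ α (c x) ≤ exc c Δ α (c y) := by
  by_contra! hlt
  have hne : c x ≠ c y := fun h => by rw [h] at hlt; exact lt_irrefl _ hlt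
  have hxy' : x ≠ y := fun h => hne (h ▸ rfl)
  set d := exc c Δ α (c x) - exc c Δ α (c y) with hd
  obtain ⟨s, hs0, hs1, hs2⟩ : ∃ s > 0, s ≤ α x - ε ∧ s < d :=
    ⟨min (α x - ε) (d / 2), lt_min (by linarith) (by linarith), min_le_left _ _,
      (min_le_right _ _).trans_lt (by linarith)⟩
  have h1 := hmin (fun z => α z + ((if z = y then s else 0) - if z = x then s else 0)) ?_
  · have h2 : ∀ e ∈ univ.image c,
        exc c Δ (fun z => α z + ((if z = y then s else 0) - if z = x then s else 0)) e ^ 2 =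
        exc c Δ α e ^ 2 + ((if e = c y then 2 * s * exc c Δ α (c y) + s ^ 2 else 0) +
          if e = c x then - 2 * s * exc c Δ α (c x) + s ^ 2 else 0) := by
      intro e _
      rw [exc, sum_transfer]
      by_cases hey : e = c y
      · have hex : e ≠ c x := fun h => hne (h.symm.trans hey)
        rw [if_pos hey, if_neg hex, if_pos hey.symm, if_neg hex.symm, ← hey]; simp only [exc]; ring
      · by_cases hex : e = c x
        · rw [if_pos hex, if_neg hey, if_pos hex.symm, if_neg (Ne.symm hey), ← hex]; simp only [exc]; ring
        · rw [if_neg hex, if_neg hey, if_neg (Ne.symm hex), if_neg (Ne.symm hey), exc]; ring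
    rw [Finset.sum_congr rfl h2, Finset.sum_add_distrib, Finset.sum_add_distrib,
      Finset.sum_ite_eq', Finset.sum_ite_eq', if_pos (Finset.mem_image_of_mem _ (mem_univ _)),
      if_pos (Finset.mem_image_of_mem _ (mem_univ _))] at h1
    nlinarith
  · refine ⟨fun z => ?_, fun z => ?_⟩
    · have := hα.1 z
      by_cases hzx : z = x
      · subst hzx
        simp only [if_neg hxy', if_pos]
        linarith
      · simp only [if_neg hzx]
        split_ifs <;> linarith
    · rw [sum_transfer, hα.2 z, hxy]
      simp

/-- The excess conditions imply the existence of a positive feasible point. -/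
lemma exists_feasible (hΔ : ∀ x, 0 < Δ (c x))
    (htot : ∑ e ∈ univ.image c, Δ e = π * (univ.image r).card)
    (hexc : ∀ S ⊆ univ.image r, S.Nonempty → S ≠ univ.image r →
      π * S.card < ∑ e ∈ (univ.filter fun x => r x ∈ S).image c, Δ e) :
    ∃ α : ι → ℝ, (∀ x, 0 < α x) ∧ (∀ x, ∑ y with r y = r x, α y = π) ∧
      ∀ x, ∑ y with c y = c x, α y = Δ (c x) := by
  obtain ⟨δ₁, hδ₁, h1⟩ := exists_pos_le univ (fun x => Δ (c x)) fun x _ => hΔ x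
  obtain ⟨δ₂, hδ₂, h2⟩ := exists_pos_le
    (((univ.image r).powerset.filter fun S => S.Nonempty ∧ S ≠ univ.image r))
    (fun S => ∑ e ∈ (univ.filter fun x => r x ∈ S).image c, Δ e - π * S.card) fun S hS => by
      obtain ⟨hS1, hS2, hS3⟩ := Finset.mem_filter.1 hS
      exact sub_pos.2 (hexc S (Finset.mem_powerset.1 hS1) hS2 hS3)
  set n : ℝ := (Fintype.card ι : ℝ) with hn
  have hn0 : 0 ≤ n := Nat.cast_nonneg _
  obtain ⟨ε, hε0, hε1, hε2, hε3⟩ : ∃ ε > 0, ε * n ≤ π ∧ ε * n ≤ δ₁ ∧ ε * n ≤ δ₂ := by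
    have hm : 0 < min π (min δ₁ δ₂) := lt_min pi_pos (lt_min hδ₁ hδ₂)
    have hle : min π (min δ₁ δ₂) / (n + 1) * n ≤ min π (min δ₁ δ₂) := by
      rw [div_mul_eq_mul_div, div_le_iff₀ (by linarith)]
      nlinarith
    exact ⟨min π (min δ₁ δ₂) / (n + 1), by positivity, hle.trans (min_le_left _ _),
      hle.trans ((min_le_right _ _).trans (min_le_left _ _)),
      hle.trans ((min_le_right _ _).trans (min_le_right _ _))⟩
  obtain ⟨α, hα, hmin⟩ := (rowSet_compact (r := r) hε0.le).exists_isMinOn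
    (rowSet_nonempty hε1 hε0.le) (f := fun α => ∑ e ∈ univ.image c, exc c Δ α e ^ 2)
    (Continuous.continuousOn (continuous_finsetSum _ fun e _ => by unfold exc; fun_prop))
  have hle := fun {x y} => exc_le_of_min (x := x) (y := y) hα hmin
  have hrows : ∀ S ⊆ univ.image r, ∑ x with r x ∈ S, α x = π * S.card := by
    intro S hS
    rw [← Finset.sum_fiberwise_of_maps_to (s := univ.filter fun x => r x ∈ S)
      (t := S) (g := r) (fun x hx => (Finset.mem_filter.1 hx).2), mul_comm, ← nsmul_eq_mul,
      ← Finset.sum_const]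
    refine Finset.sum_congr rfl fun t ht => ?_
    obtain ⟨x, -, rfl⟩ := Finset.mem_image.1 (hS ht)
    rw [← hα.2 x]
    refine Finset.sum_congr ?_ fun _ _ => rfl
    ext y
    simp only [Finset.mem_filter, mem_univ, true_and]
    exact ⟨fun h => h.2, fun h => ⟨h ▸ ht, h⟩⟩
  have hcols : ∀ F ⊆ univ.image c, ∑ e ∈ F, ∑ y with c y = e, α y = ∑ x with c x ∈ F, α x := by
    intro F _
    rw [← Finset.sum_fiberwise_of_maps_to (s := univ.filter fun x => c x ∈ F)
      (t := F) (g := c) (fun x hx => (Finset.mem_filter.1 hx).2)]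
    refine Finset.sum_congr rfl fun t ht => Finset.sum_congr ?_ fun _ _ => rfl
    ext y
    simp only [Finset.mem_filter, mem_univ, true_and]
    exact ⟨fun h => ⟨h ▸ ht, h⟩, fun h => h.2⟩
  have hall_r : ∀ x, r x ∈ univ.image r := fun x => Finset.mem_image_of_mem _ (mem_univ _)
  have hall_c : ∀ x, c x ∈ univ.image c := fun x => Finset.mem_image_of_mem _ (mem_univ _)
  have hsum0 : ∑ e ∈ univ.image c, exc c Δ α e = 0 := by
    simp only [exc]
    rw [Finset.sum_sub_distrib, htot, hcols _ subset_rfl, ← hrows _ subset_rfl, sub_eq_zero]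
    refine Finset.sum_congr ?_ fun _ _ => rfl
    ext x
    simp
  suffices hz : ∀ e ∈ univ.image c, exc c Δ α e ≤ 0 by
    refine ⟨α, fun x => hε0.trans_le (hα.1 x), hα.2, fun x => ?_⟩
    have := (Finset.sum_eq_zero_iff_of_nonpos hz).1 hsum0 (c x) (hall_c x)
    exact sub_eq_zero.1 this
  by_contra! hpos
  obtain ⟨e₀, he₀, hpos⟩ := hpos
  obtain ⟨e₁, he₁, hmax⟩ := (univ.image c).exists_max_image (exc c Δ α) ⟨e₀, he₀⟩
  set m := exc c Δ α e₁ with hm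
  have hm0 : 0 < m := hpos.trans_le (hmax e₀ he₀)
  obtain ⟨F, hF⟩ : ∃ F : Finset E, ∀ e, e ∈ F ↔ e ∈ univ.image c ∧ exc c Δ α e = m :=
    ⟨(univ.image c).filter fun e => exc c Δ α e = m, fun e => Finset.mem_filter⟩
  obtain ⟨S, hS⟩ : ∃ S : Finset R, ∀ t, t ∈ S ↔ t ∈ univ.image r ∧ ∀ x, r x = t → c x ∈ F :=
    ⟨(univ.image r).filter fun t => ∀ x, r x = t → c x ∈ F, fun t => Finset.mem_filter⟩
  have hFsub : F ⊆ univ.image c := fun e he => ((hF e).1 he).1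
  have hSsub : S ⊆ univ.image r := fun e he => ((hS e).1 he).1
  have hsmall : ∀ x, c x ∈ F → r x ∉ S → α x ≤ ε := by
    intro x hx hxS
    by_contra! hlt
    refine hxS ((hS _).2 ⟨hall_r x, fun y hy => (hF _).2 ⟨hall_c y, ?_⟩⟩)
    refine le_antisymm (hmax _ (hall_c y)) ?_
    rw [← ((hF _).1 hx).2]
    exact hle hy.symm hlt
  have hup : ∑ x with c x ∈ F, α x ≤ π * S.card + ε * n := by
    calc ∑ x with c x ∈ F, α x ≤ ∑ x, ((if r x ∈ S then α x else 0) + ε) := by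
          rw [Finset.sum_filter]
          refine Finset.sum_le_sum fun x _ => ?_
          have := hα.1 x
          by_cases hc : c x ∈ F
          · by_cases hr : r x ∈ S
            · rw [if_pos hc, if_pos hr]; linarith
            · rw [if_pos hc, if_neg hr]; linarith [hsmall x hc hr]
          · rw [if_neg hc]
            split_ifs <;> linarith
      _ = π * S.card + ε * n := by
          rw [Finset.sum_add_distrib, ← Finset.sum_filter, hrows S hSsub, Finset.sum_const,
            nsmul_eq_mul, mul_comm ε, Finset.card_univ]
  have hlow : ∑ e ∈ F, Δ e + F.card * m = ∑ x with c x ∈ F, α x := by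
    rw [← hcols F hFsub, ← nsmul_eq_mul, ← Finset.sum_const, ← Finset.sum_add_distrib]
    refine Finset.sum_congr rfl fun e he => ?_
    rw [← ((hF e).1 he).2, exc]; ring
  have he₁F : e₁ ∈ F := (hF e₁).2 ⟨he₁, rfl⟩
  have hFm : 0 < F.card * m := mul_pos (by exact_mod_cast Finset.card_pos.2 ⟨e₁, he₁F⟩) hm0
  have hΔF : ∀ e ∈ univ.image c, 0 < Δ e := fun e he => by
    obtain ⟨x, -, rfl⟩ := Finset.mem_image.1 he
    exact hΔ x
  rcases S.eq_empty_or_nonempty with hSe | hSne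
  · rw [hSe] at hup
    have h3 : Δ e₁ ≤ ∑ e ∈ F, Δ e :=
      Finset.single_le_sum (fun e he => (hΔF e (hFsub he)).le) he₁F
    obtain ⟨x, -, hx⟩ := Finset.mem_image.1 he₁
    have h4 := h1 x (mem_univ x)
    rw [hx] at h4
    simp only [Finset.card_empty, Nat.cast_zero, mul_zero, zero_add] at hup
    linarith
  by_cases hSK : S = univ.image r
  · have : ∀ e ∈ univ.image c, 0 < exc c Δ α e := by
      intro e he
      obtain ⟨x, -, rfl⟩ := Finset.mem_image.1 he
      have h3 : r x ∈ S := hSK ▸ hall_r x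
      rw [((hF _).1 (((hS _).1 h3).2 x rfl)).2]
      exact hm0
    exact (Finset.sum_pos this ⟨e₁, he₁⟩).ne' hsum0
  · have h3 := h2 S (Finset.mem_filter.2 ⟨Finset.mem_powerset.2 hSsub, hSne, hSK⟩)
    have h4 : ∑ e ∈ (univ.filter fun x => r x ∈ S).image c, Δ e ≤ ∑ e ∈ F, Δ e := by
      refine Finset.sum_le_sum_of_subset_of_nonneg ?_ fun e he _ => (hΔF e (hFsub he)).le
      intro e he
      obtain ⟨x, hx, rfl⟩ := Finset.mem_image.1 he
      exact ((hS _).1 (Finset.mem_filter.1 hx).2).2 x rfl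
    linarith

end Feasible

end

section

/-- Lobachevsky's function, up to normalization. -/
def lob (x : ℝ) : ℝ := -∫ t in (0 : ℝ)..x, Real.log (Real.sin t)

lemma lob_zero : lob 0 = 0 := by simp [lob]

lemma logSin_integrable (a b : ℝ) :
    IntervalIntegrable (fun t => Real.log (Real.sin t)) MeasureTheory.volume a b :=
  intervalIntegrable_log_sin

lemma lob_sub (a b : ℝ) : lob b - lob a = -∫ t in a..b, Real.log (Real.sin t) := by
  have := intervalIntegral.integral_interval_sub_left (logSin_integrable 0 b) (logSin_integrable 0 a)
  simp only [lob]
  linarith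

lemma continuous_lob : Continuous lob :=
  (intervalIntegral.continuous_primitive logSin_integrable 0).neg

lemma hasDerivAt_lob {x : ℝ} (h0 : 0 < x) (hπ : x < π) :
    HasDerivAt lob (-Real.log (Real.sin x)) x := by
  refine (intervalIntegral.integral_hasDerivAt_right (logSin_integrable 0 x) ?_ ?_).neg
  · exact ((Real.measurable_log.comp Real.measurable_sin).stronglyMeasurable).stronglyMeasurableAtFilter
  · exact (Real.continuousAt_log (Real.sin_pos_of_pos_of_lt_pi h0 hπ).ne').comp
      Real.continuous_sin.continuousAt

lemma lob_add_compl (s : ℝ) : lob s + lob (π - s) = lob π := by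
  have h1 := lob_sub (π - s) π
  have h2 : ∫ t in (π - s)..π, Real.log (Real.sin t) = ∫ t in (0 : ℝ)..s, Real.log (Real.sin t) := by
    have := intervalIntegral.integral_comp_sub_left (a := 0) (b := s)
      (fun t => Real.log (Real.sin t)) π
    simp only [Real.sin_pi_sub, sub_zero] at this
    exact this.symm
  rw [h2] at h1
  simp only [lob] at *
  linarith

lemma lob_add_le {a b : ℝ} (ha : 0 ≤ a) (hb : 0 ≤ b) (hab : a + b ≤ π / 2) :
    lob (a + b) ≤ lob a + lob b := by
  have h1 := lob_sub b (a + b)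
  have h2 : ∫ t in b..(a + b), Real.log (Real.sin t) =
      ∫ t in (0 : ℝ)..a, Real.log (Real.sin (t + b)) := by
    have := intervalIntegral.integral_comp_add_right (a := 0) (b := a)
      (fun t => Real.log (Real.sin t)) b
    rw [zero_add] at this
    exact this.symm
  have h3 : ∫ t in (0 : ℝ)..a, Real.log (Real.sin t) ≤
      ∫ t in (0 : ℝ)..a, Real.log (Real.sin (t + b)) := by
    refine intervalIntegral.integral_mono_on_of_le_Ioo ha (logSin_integrable _ _) ?_ ?_
    · have := (logSin_integrable (0 + b) (a + b)).comp_add_right b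
      simpa using this
    · intro t ht
      refine Real.log_le_log (Real.sin_pos_of_pos_of_lt_pi ht.1 (by linarith [ht.2, pi_pos])) ?_
      exact Real.sin_le_sin_of_le_of_le_pi_div_two (by linarith [ht.1, pi_pos]) (by linarith [ht.2])
        (by linarith)
  rw [h2] at h1
  have h4 : lob a = -∫ t in (0 : ℝ)..a, Real.log (Real.sin t) := rfl
  linarith

lemma lob_sum_le {ι : Type*} (s : Finset ι) (u : ι → ℝ) (h0 : ∀ i ∈ s, 0 ≤ u i)
    (h : ∑ i ∈ s, u i ≤ π / 2) : lob (∑ i ∈ s, u i) ≤ ∑ i ∈ s, lob (u i) := by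
  induction s using Finset.induction_on with
  | empty => simp [lob_zero]
  | insert a s ha ih =>
    rw [Finset.sum_insert ha] at h ⊢
    rw [Finset.sum_insert ha]
    have h1 : 0 ≤ u a := h0 a (Finset.mem_insert_self _ _)
    have h2 : ∀ i ∈ s, 0 ≤ u i := fun i hi => h0 i (Finset.mem_insert_of_mem hi)
    have h3 := Finset.sum_nonneg h2
    linarith [ih h2 (by linarith), lob_add_le h1 h3 h]

lemma neg_mul_log_le_lob {u : ℝ} (h0 : 0 ≤ u) (hu : u ≤ π) : -(u * Real.log u) ≤ lob u := by
  have h1 : ∫ t in (0 : ℝ)..u, Real.log (Real.sin t) ≤ ∫ t in (0 : ℝ)..u, Real.log u := by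
    refine intervalIntegral.integral_mono_on_of_le_Ioo h0 (logSin_integrable _ _)
      intervalIntegrable_const fun t ht => ?_
    refine Real.log_le_log (Real.sin_pos_of_pos_of_lt_pi ht.1 (ht.2.trans_le hu)) ?_
    exact (Real.sin_le ht.1.le).trans ht.2.le
  rw [intervalIntegral.integral_const, smul_eq_mul, sub_zero] at h1
  rw [lob]
  linarith

end

section

open Filter Topology in
/-- `f` is bounded below by a linear function near `0` on the right. -/
def LinearLower (f : ℝ → ℝ) : Prop := ∃ M : ℝ, ∀ᶠ s in 𝓝[>] (0 : ℝ), -M * s ≤ f s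

section Maximum

open Filter Topology

lemma LinearLower.add {f g : ℝ → ℝ} (hf : LinearLower f) (hg : LinearLower g) :
    LinearLower fun s => f s + g s := by
  obtain ⟨M, hM⟩ := hf
  obtain ⟨N, hN⟩ := hg
  refine ⟨M + N, ?_⟩
  filter_upwards [hM, hN] with s h1 h2
  linarith

lemma LinearLower.sum {κ : Type*} (s : Finset κ) (f : κ → ℝ → ℝ) (h : ∀ i ∈ s, LinearLower (f i)) :
    LinearLower fun u => ∑ i ∈ s, f i u := by
  induction s using Finset.induction_on with
  | empty => exact ⟨0, by simp⟩
  | insert a s ha ih =>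
    simp only [Finset.sum_insert ha]
    exact (h a (Finset.mem_insert_self _ _)).add
      (ih fun i hi => h i (Finset.mem_insert_of_mem hi))

lemma linearLower_lob {x : ℝ} (h0 : 0 < x) (hπ : x < π) (v : ℝ) :
    LinearLower fun s => lob (x + s * v) - lob x := by
  have h1 : HasDerivAt (fun s : ℝ => x + s * v) v 0 := by
    simpa using ((hasDerivAt_id (0 : ℝ)).mul_const v).const_add x
  have h2 : HasDerivAt (fun s : ℝ => lob (x + s * v)) (-Real.log (Real.sin x) * v) 0 :=
    HasDerivAt.comp (h₂ := lob) (0 : ℝ) (by simpa using hasDerivAt_lob h0 hπ) h1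
  obtain ⟨C, hC⟩ := h2.isBigO_sub.bound
  refine ⟨C, ?_⟩
  filter_upwards [hC.filter_mono nhdsWithin_le_nhds, self_mem_nhdsWithin] with s hs hs0
  simp only [zero_mul, add_zero, sub_zero, Real.norm_eq_abs, abs_of_pos (Set.mem_Ioi.1 hs0)] at hs
  linarith [neg_abs_le (lob (x + s * v) - lob x)]

lemma eventually_mul_le_lob {a : ℝ} (ha : 0 < a) (M : ℝ) :
    ∀ᶠ s in 𝓝[>] (0 : ℝ), M * s ≤ lob (s * a) := by
  have h1 : Tendsto (fun s : ℝ => s * a) (𝓝[>] 0) (𝓝[>] 0) := by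
    refine tendsto_nhdsWithin_iff.2 ⟨?_, ?_⟩
    · have : Tendsto (fun s : ℝ => s * a) (𝓝 0) (𝓝 (0 * a)) := tendsto_id.mul_const a
      rw [zero_mul] at this
      exact this.mono_left nhdsWithin_le_nhds
    · filter_upwards [self_mem_nhdsWithin] with s hs
      exact mul_pos hs ha
  have h2 := (Real.tendsto_log_nhdsGT_zero.comp h1).eventually_le_atBot (-(M / a))
  have h3 : ∀ᶠ u in 𝓝[>] (0 : ℝ), u < π := nhdsWithin_le_nhds (Iio_mem_nhds pi_pos)
  filter_upwards [h2, h1.eventually h3, self_mem_nhdsWithin] with s hs hsπ hs0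
  have hs0' : 0 < s := hs0
  have h4 := neg_mul_log_le_lob (mul_pos hs0' ha).le hsπ.le
  have h5 : s * a * Real.log (s * a) ≤ s * a * (-(M / a)) :=
    mul_le_mul_of_nonneg_left hs (mul_pos hs0' ha).le
  have h6 : s * a * (-(M / a)) = -(M * s) := by field_simp
  linarith

variable {ι R E : Type*} [Fintype ι] {r : ι → R} {c : ι → E} {Δ : E → ℝ}

/-- Nonnegative matrices with row sums `π` and column sums `Δ`. -/
structure Feas (r : ι → R) (c : ι → E) (Δ : E → ℝ) (α : ι → ℝ) : Prop where
  nonneg : ∀ x, 0 ≤ α x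
  row : ∀ x, ∑ y with r y = r x, α y = π
  col : ∀ x, ∑ y with c y = c x, α y = Δ (c x)

/-- Feasible points of maximal volume. -/
structure MaxFeas (r : ι → R) (c : ι → E) (Δ : E → ℝ) (α : ι → ℝ) : Prop
    extends Feas r c Δ α where
  max : ∀ β, Feas r c Δ β → ∑ x, lob (β x) ≤ ∑ x, lob (α x)

variable {α β : ι → ℝ}

lemma Feas.le_pi (h : Feas r c Δ α) (x : ι) : α x ≤ π := le_pi_of_row h.nonneg (h.row x)

lemma Feas.line (h : Feas r c Δ α) (h' : Feas r c Δ β) {s : ℝ} (hs : 0 ≤ s) (hs1 : s ≤ 1) :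
    Feas r c Δ fun x => α x + s * (β x - α x) := by
  refine ⟨fun x => ?_, fun x => ?_, fun x => ?_⟩
  · nlinarith [h.nonneg x, h'.nonneg x]
  · rw [Finset.sum_add_distrib, ← Finset.mul_sum, Finset.sum_sub_distrib, h.row, h'.row]; ring
  · rw [Finset.sum_add_distrib, ← Finset.mul_sum, Finset.sum_sub_distrib, h.col, h'.col]; ring

lemma exists_maxFeas (h : Feas r c Δ β) : ∃ α, MaxFeas r c Δ α := by
  have hc : IsCompact {α | Feas r c Δ α} := by
    have : {α | Feas r c Δ α} = rowSet r 0 ∩ ⋂ x, {α | ∑ y with c y = c x, α y = Δ (c x)} := by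
      ext α
      simp only [Set.mem_ofPred_eq, rowSet, Set.mem_inter_iff, Set.mem_iInter]
      exact ⟨fun h => ⟨⟨h.1, h.2⟩, h.3⟩, fun h => ⟨h.1.1, h.1.2, h.2⟩⟩
    rw [this]
    exact (rowSet_compact le_rfl).inter_right (isClosed_iInter fun x => isClosed_eq
        (continuous_finsetSum _ fun y _ => continuous_apply y) continuous_const)
  obtain ⟨α, hα, hmax⟩ := hc.exists_isMaxOn ⟨β, h⟩ (f := fun α => ∑ x, lob (α x))
    (Continuous.continuousOn (continuous_finsetSum _ fun x _ =>
      continuous_lob.comp (continuous_apply x)))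
  exact ⟨α, hα, fun β hβ => hmax hβ⟩

lemma Feas.eq_zero_of_pi (h : Feas r c Δ α) {x y : ι} (hx : α x = π) (hxy : r y = r x)
    (hne : y ≠ x) : α y = 0 := by
  refine le_antisymm ?_ (h.nonneg y)
  have h1 := h.row x
  have hmem : x ∈ univ.filter fun y => r y = r x := Finset.mem_filter.2 ⟨mem_univ x, rfl⟩
  rw [← Finset.add_sum_erase _ _ hmem, hx] at h1
  have h2 : α y ≤ ∑ z ∈ (univ.filter fun y => r y = r x).erase x, α z :=
    Finset.single_le_sum (f := α) (fun z _ => h.nonneg z)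
      (Finset.mem_erase.2 ⟨hne, Finset.mem_filter.2 ⟨mem_univ y, hxy⟩⟩)
  linarith

lemma Feas.row_lower_of_pi (h : Feas r c Δ α) (h' : Feas r c Δ β) {x : ι} (hx : α x = π) :
    LinearLower fun s => ∑ y with r y = r x, (lob (α y + s * (β y - α y)) - lob (α y)) := by
  refine ⟨0, ?_⟩
  have h3 : ∀ᶠ u in 𝓝[>] (0 : ℝ), u < 1 / 2 := nhdsWithin_le_nhds (Iio_mem_nhds (by norm_num))
  filter_upwards [h3, self_mem_nhdsWithin] with s hs hs0
  have hs0' : 0 < s := hs0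
  have hmem : x ∈ univ.filter fun y => r y = r x := Finset.mem_filter.2 ⟨mem_univ x, rfl⟩
  have h1 := h'.row x
  rw [← Finset.add_sum_erase _ _ hmem] at h1 ⊢
  set U := (univ.filter fun y => r y = r x).erase x with hU
  have h2 : ∀ y ∈ U, lob (α y + s * (β y - α y)) - lob (α y) = lob (s * β y) := by
    intro y hy
    obtain ⟨hne, hy⟩ := Finset.mem_erase.1 hy
    rw [h.eq_zero_of_pi hx (Finset.mem_filter.1 hy).2 hne, lob_zero]
    simp
  have hsum : ∑ y ∈ U, s * β y = s * (π - β x) := by rw [← Finset.mul_sum]; congr 1; linarith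
  have hβ := h'.nonneg x
  have h4 := lob_sum_le U (fun y => s * β y) (fun y _ => mul_nonneg hs0'.le (h'.nonneg y))
    (by rw [hsum]; nlinarith [pi_pos])
  have h5 := lob_add_compl (s * (π - β x))
  rw [Finset.sum_congr rfl h2, hx]
  have h6 : π + s * (β x - π) = π - s * (π - β x) := by ring
  rw [h6]
  rw [hsum] at h4
  linarith

lemma MaxFeas.exists_pi_of_zero (h : MaxFeas r c Δ α) (h' : Feas r c Δ β) (hβ : ∀ x, 0 < β x)
    {x : ι} (hx : α x = 0) : ∃ y, r y = r x ∧ α y = π := by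
  by_contra! hcon
  set d : ι → ℝ → ℝ := fun y s => lob (α y + s * (β y - α y)) - lob (α y) with hd
  have hone : ∀ y, α y ≠ π → LinearLower (d y) := by
    intro y hy
    rcases (h.nonneg y).eq_or_lt with h0 | h0
    · refine ⟨0, ?_⟩
      filter_upwards [eventually_mul_le_lob (hβ y) 0] with s hs
      simp only [hd, ← h0, lob_zero, sub_zero, zero_add]
      linarith
    · exact linearLower_lob h0 ((h.le_pi y).lt_of_ne hy) _
  have hmem : x ∈ univ.filter fun y => r y = r x := Finset.mem_filter.2 ⟨mem_univ x, rfl⟩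
  have hrest : LinearLower fun s => ∑ y ∈ (univ.filter fun y => r y = r x).erase x, d y s +
      ∑ t ∈ (univ.image r).erase (r x), ∑ y with r y = t, d y s := by
    refine (LinearLower.sum _ _ fun y hy => hone y ?_).add (LinearLower.sum _ _ fun t ht => ?_)
    · exact hcon y (Finset.mem_filter.1 (Finset.mem_erase.1 hy).2).2
    · obtain ⟨z, -, rfl⟩ := Finset.mem_image.1 (Finset.mem_erase.1 ht).2
      by_cases hz : ∃ w, r w = r z ∧ α w = π
      · obtain ⟨w, hw, hwπ⟩ := hz
        rw [← hw]
        exact h.toFeas.row_lower_of_pi h' hwπ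
      · push Not at hz
        exact LinearLower.sum _ _ fun y hy => hone y (hz y (Finset.mem_filter.1 hy).2)
  obtain ⟨M, hM⟩ := hrest
  have h3 : ∀ᶠ u in 𝓝[>] (0 : ℝ), u < 1 := nhdsWithin_le_nhds (Iio_mem_nhds (by norm_num))
  obtain ⟨s, hs1, hs2, hs3, hs0⟩ :=
    (hM.and ((eventually_mul_le_lob (hβ x) (M + 1)).and (h3.and self_mem_nhdsWithin))).exists
  have hs0' : 0 < s := hs0
  have htot : ∑ y, d y s = lob (s * β x) + (∑ y ∈ (univ.filter fun y => r y = r x).erase x, d y s +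
      ∑ t ∈ (univ.image r).erase (r x), ∑ y with r y = t, d y s) := by
    rw [← Finset.sum_fiberwise_of_maps_to (s := univ) (t := univ.image r) (g := r)
      (fun y _ => Finset.mem_image_of_mem _ (mem_univ _)),
      ← Finset.add_sum_erase _ _ (Finset.mem_image_of_mem r (mem_univ x)),
      ← Finset.add_sum_erase _ _ hmem, add_assoc]
    congr 1
    simp [hd, hx, lob_zero]
  have hle := h.max _ (h.toFeas.line h' hs0'.le hs3.le)
  have hsum : ∑ y, d y s = ∑ y, lob (α y + s * (β y - α y)) - ∑ y, lob (α y) := by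
    simp only [hd, Finset.sum_sub_distrib]
  linarith

/-- A self-map of a nonempty finite set restricts to a bijection of a nonempty subset. -/
lemma exists_invariant {κ : Type*} {Z : Finset κ} (hZ : Z.Nonempty) {T : κ → κ}
    (hT : ∀ x ∈ Z, T x ∈ Z) : ∃ C ⊆ Z, C.Nonempty ∧ C.image T = C ∧ Set.InjOn T C := by
  obtain ⟨C, hC, hmin⟩ := (Z.powerset.filter fun C => C.Nonempty ∧ C.image T ⊆ C).exists_min_image
    Finset.card ⟨Z, Finset.mem_filter.2 ⟨Finset.mem_powerset.2 subset_rfl, hZ,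
      Finset.image_subset_iff.2 hT⟩⟩
  obtain ⟨h1, h2, h3⟩ := Finset.mem_filter.1 hC
  have h4 := hmin (C.image T) (Finset.mem_filter.2 ⟨Finset.mem_powerset.2
    (h3.trans (Finset.mem_powerset.1 h1)), h2.image _, Finset.image_subset_image h3⟩)
  have h5 := Finset.eq_of_subset_of_card_le h3 h4
  exact ⟨C, Finset.mem_powerset.1 h1, h2, h5, Finset.card_image_iff.1 (by rw [h5])⟩

/-- Maximal feasible points have no zero entries. -/
lemma MaxFeas.pos (h : MaxFeas r c Δ α) (h' : Feas r c Δ β) (hβ : ∀ x, 0 < β x)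
    (hΔ : ∀ x, Δ (c x) ≤ π) (hrow : ∀ x y, ∃ z, r z = r x ∧ z ≠ x ∧ z ≠ y) (x : ι) : 0 < α x := by
  refine (h.nonneg x).lt_of_ne' fun hx => ?_
  have hnext : ∀ x, α x = π → ∃ y, (c y = c x ∧ α y = 0) ∧ ∃ x', r x' = r y ∧ α x' = π := by
    intro x hx
    have hmem : x ∈ univ.filter fun y => c y = c x := Finset.mem_filter.2 ⟨mem_univ x, rfl⟩
    have hcα := h.col x
    have hcβ := h'.col x
    rw [← Finset.add_sum_erase _ _ hmem] at hcα hcβ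
    have hβx : β x < π := by
      obtain ⟨z, hz, hzx, -⟩ := hrow x x
      by_contra! hge
      have := h'.eq_zero_of_pi (le_antisymm (h'.le_pi x) hge) hz hzx
      exact (hβ z).ne' this
    have hα0 : 0 ≤ ∑ y ∈ (univ.filter fun y => c y = c x).erase x, α y :=
      Finset.sum_nonneg fun y _ => h.nonneg y
    have hΔx := hΔ x
    have hne : ((univ.filter fun y => c y = c x).erase x).Nonempty := by
      rw [Finset.nonempty_iff_ne_empty]
      intro he
      rw [he, Finset.sum_empty] at hcβ
      linarith
    obtain ⟨y, hy⟩ := hne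
    have hαy : α y = 0 := by
      refine (Finset.sum_eq_zero_iff_of_nonneg fun y _ => h.nonneg y).1 ?_ y hy
      linarith
    exact ⟨y, ⟨(Finset.mem_filter.1 (Finset.mem_erase.1 hy).2).2, hαy⟩,
      h.exists_pi_of_zero h' hβ hαy⟩
  choose! y hy T hT using hnext
  obtain ⟨x₀, -, hx₀⟩ := h.exists_pi_of_zero h' hβ hx
  obtain ⟨C, hCZ, hCne, hCT, hinj⟩ := exists_invariant (Z := univ.filter fun x => α x = π)
    ⟨x₀, Finset.mem_filter.2 ⟨mem_univ _, hx₀⟩⟩ (T := T)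
    (fun x hx => Finset.mem_filter.2 ⟨mem_univ _, (hT x (Finset.mem_filter.1 hx).2).2⟩)
  have hC : ∀ x ∈ C, α x = π := fun x hx => (Finset.mem_filter.1 (hCZ hx)).2
  have huniq : ∀ x x', α x = π → α x' = π → r x = r x' → x = x' := by
    intro x x' hx hx' hr
    by_contra hne
    have := h.toFeas.eq_zero_of_pi hx' hr hne
    rw [hx] at this
    exact pi_pos.ne' this
  have hyinj : Set.InjOn y C := by
    intro a ha b hb hab
    refine hinj ha hb (huniq _ _ (hT a (hC a ha)).2 (hT b (hC b hb)).2 ?_)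
    rw [(hT a (hC a ha)).1, (hT b (hC b hb)).1, hab]
  have hyC : ∀ a ∈ C, y a ∉ C := fun a ha hyC => by
    have := hC _ hyC
    rw [(hy a (hC a ha)).2] at this
    exact pi_pos.ne this
  obtain ⟨γ, hγ⟩ : ∃ γ : ι → ℝ, ∀ z, γ z = α z +
      ((if z ∈ C.image y then π / 2 else 0) - if z ∈ C then π / 2 else 0) := ⟨_, fun _ => rfl⟩
  have hγC : ∀ z ∈ C, γ z = π / 2 := fun z hz => by
    have : z ∉ C.image y := fun hz' => by
      obtain ⟨a, ha, rfl⟩ := Finset.mem_image.1 hz'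
      exact hyC a ha hz
    rw [hγ, if_neg this, if_pos hz, hC z hz]; ring
  have hγy : ∀ z ∈ C, γ (y z) = π / 2 := fun z hz => by
    rw [hγ, if_pos (Finset.mem_image_of_mem _ hz), if_neg (hyC z hz), (hy z (hC z hz)).2]; ring
  have hγ0 : ∀ z, z ∉ C → z ∉ C.image y → γ z = α z := fun z h1 h2 => by
    rw [hγ, if_neg h1, if_neg h2]; ring
  have hsum : ∀ p : ι → Prop, ∑ z with p z, γ z = ∑ z with p z, α z +
      π / 2 * (∑ a ∈ C, (if p (y a) then 1 else 0) - ∑ a ∈ C, (if p a then 1 else 0)) := by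
    intro p
    rw [Finset.sum_congr rfl fun z _ => hγ z, Finset.sum_add_distrib, Finset.sum_sub_distrib]
    congr 1
    rw [mul_sub, Finset.mul_sum, Finset.mul_sum,
      ← Finset.sum_image (f := fun z => π / 2 * (if p z then 1 else 0)) hyinj]
    simp only [mul_ite, mul_one, mul_zero]
    rw [← Finset.sum_filter, ← Finset.sum_filter, ← Finset.sum_filter, ← Finset.sum_filter]
    congr 1
    · refine Finset.sum_congr ?_ fun _ _ => rfl
      ext z; simp [and_comm]
    · refine Finset.sum_congr ?_ fun _ _ => rfl
      ext z; simp [and_comm]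
  have hγF : Feas r c Δ γ := by
    refine ⟨fun z => ?_, fun z => ?_, fun z => ?_⟩
    · by_cases h1 : z ∈ C
      · rw [hγC z h1]; exact pi_div_two_pos.le
      · by_cases h2 : z ∈ C.image y
        · obtain ⟨a, ha, rfl⟩ := Finset.mem_image.1 h2
          rw [hγy a ha]; exact pi_div_two_pos.le
        · rw [hγ0 z h1 h2]; exact h.nonneg z
    · rw [hsum (fun w => r w = r z), h.row]
      have : ∑ a ∈ C, (if r (y a) = r z then (1 : ℝ) else 0) =
          ∑ a ∈ C, if r a = r z then (1 : ℝ) else 0 := by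
        conv_rhs => rw [← hCT, Finset.sum_image hinj]
        refine Finset.sum_congr rfl fun a ha => ?_
        rw [(hT a (hC a ha)).1]
      rw [this]; ring
    · rw [hsum (fun w => c w = c z), h.col]
      have : ∑ a ∈ C, (if c (y a) = c z then (1 : ℝ) else 0) =
          ∑ a ∈ C, if c a = c z then (1 : ℝ) else 0 :=
        Finset.sum_congr rfl fun a ha => by rw [(hy a (hC a ha)).1]
      rw [this]; ring
  have hV : ∑ z, lob (γ z) = ∑ z, lob (α z) := by
    have h1 : ∀ z, lob (γ z) = lob (α z) + ((if z ∈ C.image y then lob (π / 2) else 0) +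
        if z ∈ C then lob (π / 2) - lob π else 0) := by
      intro z
      by_cases h1 : z ∈ C
      · have : z ∉ C.image y := fun hz' => by
          obtain ⟨a, ha, rfl⟩ := Finset.mem_image.1 hz'
          exact hyC a ha h1
        rw [hγC z h1, hC z h1, if_neg this, if_pos h1]; ring
      · by_cases h2 : z ∈ C.image y
        · rw [if_pos h2, if_neg h1]
          obtain ⟨a, ha, rfl⟩ := Finset.mem_image.1 h2
          rw [hγy a ha, (hy a (hC a ha)).2, lob_zero]; ring
        · rw [hγ0 z h1 h2, if_neg h1, if_neg h2]; ring
    rw [Finset.sum_congr rfl fun z _ => h1 z, Finset.sum_add_distrib, Finset.sum_add_distrib,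
      ← Finset.sum_filter, ← Finset.sum_filter, Finset.filter_mem_eq_inter,
      Finset.filter_mem_eq_inter, Finset.univ_inter, Finset.univ_inter, Finset.sum_const,
      Finset.sum_const, Finset.card_image_of_injOn hyinj, ← smul_add]
    have h2 := lob_add_compl (π / 2)
    rw [sub_half] at h2
    rw [← h2]
    simp
  have hγM : MaxFeas r c Δ γ := ⟨hγF, fun δ hδ => (h.max δ hδ).trans_eq hV.symm⟩
  obtain ⟨a, ha⟩ := hCne
  have hTa := hT a (hC a ha)
  have hTC : T a ∈ C := hCT ▸ Finset.mem_image_of_mem _ ha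
  obtain ⟨z, hz, hzT, hzy⟩ := hrow (T a) (y a)
  have hz0 : α z = 0 := h.toFeas.eq_zero_of_pi hTa.2 hz hzT
  have hzC : z ∉ C := fun hzC => pi_pos.ne (hz0.symm.trans (hC z hzC))
  have hzyC : z ∉ C.image y := by
    intro hz'
    obtain ⟨b, hb, rfl⟩ := Finset.mem_image.1 hz'
    have hTb := hT b (hC b hb)
    exact hzy (congrArg y (hinj hb ha (huniq _ _ hTb.2 hTa.2 (hTb.1.trans hz))))
  obtain ⟨w, hw, hwπ⟩ := hγM.exists_pi_of_zero h' hβ ((hγ0 z hzC hzyC).trans hz0)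
  have hpi := pi_pos
  have hwT : T a ≠ w := fun h => by
    rw [← h, hγC _ hTC] at hwπ
    linarith
  have := hγF.eq_zero_of_pi hwπ (hz.symm.trans hw.symm) hwT
  rw [hγC _ hTC] at this
  linarith

/-- At an interior maximum the logarithms of the sines split as a row term plus a column term. -/
lemma MaxFeas.exists_multipliers (h : MaxFeas r c Δ α) (hpos : ∀ x, 0 < α x ∧ α x < π) :
    ∃ (l : R → ℝ) (m : E → ℝ), ∀ x, Real.log (Real.sin (α x)) = l (r x) + m (c x) := by
  suffices H : ∃ ψ, LinearMap.coprod (LinearMap.funLeft ℝ ℝ r) (LinearMap.funLeft ℝ ℝ c) ψ =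
      fun x => Real.log (Real.sin (α x)) by
    obtain ⟨⟨l, m⟩, hlm⟩ := H
    exact ⟨l, m, fun x => (congrFun hlm x).symm⟩
  refine exists_eq_of_orthogonal _ _ ?_
  intro v hv
  have hv1 : ∀ t, ∑ x with r x = t, v x = 0 := by
    intro t
    have := hv (fun t' => if t' = t then 1 else 0, 0)
    simpa [LinearMap.funLeft_apply, Finset.sum_filter] using this
  have hv2 : ∀ e, ∑ x with c x = e, v x = 0 := by
    intro e
    have := hv (0, fun e' => if e' = e then 1 else 0)
    simpa [LinearMap.funLeft_apply, Finset.sum_filter] using this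
  have hd1 : ∀ x, HasDerivAt (fun s : ℝ => lob (α x + s * v x))
      (-Real.log (Real.sin (α x)) * v x) 0 := by
    intro x
    have h1 : HasDerivAt (fun s : ℝ => α x + s * v x) (v x) 0 := by
      simpa using ((hasDerivAt_id (0 : ℝ)).mul_const (v x)).const_add (α x)
    exact HasDerivAt.comp (h₂ := lob) (0 : ℝ)
      (by simpa using hasDerivAt_lob (hpos x).1 (hpos x).2) h1
  have hd : HasDerivAt (fun s : ℝ => ∑ x, lob (α x + s * v x))
      (∑ x, -Real.log (Real.sin (α x)) * v x) 0 :=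
    HasDerivAt.fun_sum fun x _ => hd1 x
  have hev : ∀ᶠ s in 𝓝 (0 : ℝ), ∀ x, 0 ≤ α x + s * v x := by
    refine eventually_all.2 fun x => ?_
    have h1 : ContinuousAt (fun s : ℝ => α x + s * v x) 0 := by fun_prop
    have h2 := h1.eventually (lt_mem_nhds (by simpa using (hpos x).1))
    exact h2.mono fun s hs => le_of_lt hs
  have hmax : IsLocalMax (fun s : ℝ => ∑ x, lob (α x + s * v x)) 0 := by
    filter_upwards [hev] with s hs
    simp only [zero_mul, add_zero]
    refine h.max _ ⟨hs, fun x => ?_, fun x => ?_⟩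
    · rw [Finset.sum_add_distrib, ← Finset.mul_sum, hv1, h.row]; ring
    · rw [Finset.sum_add_distrib, ← Finset.mul_sum, hv2, h.col]; ring
  have h0 := hmax.hasDerivAt_eq_zero hd
  rw [← neg_eq_zero, ← h0, ← Finset.sum_neg_distrib]
  exact Finset.sum_congr rfl fun x _ => by ring

theorem exists_critical (hΔ : ∀ x, 0 < Δ (c x) ∧ Δ (c x) ≤ π)
    (hrow : ∀ x y, ∃ z, r z = r x ∧ z ≠ x ∧ z ≠ y)
    (htot : ∑ e ∈ univ.image c, Δ e = π * (univ.image r).card)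
    (hexc : ∀ S ⊆ univ.image r, S.Nonempty → S ≠ univ.image r →
      π * S.card < ∑ e ∈ (univ.filter fun x => r x ∈ S).image c, Δ e) :
    ∃ α : ι → ℝ, (∀ x, 0 < α x ∧ α x < π) ∧ (∀ x, ∑ y with r y = r x, α y = π) ∧
      (∀ x, ∑ y with c y = c x, α y = Δ (c x)) ∧
      ∃ (l : R → ℝ) (m : E → ℝ), ∀ x, Real.log (Real.sin (α x)) = l (r x) + m (c x) := by
  obtain ⟨β, hβ, hβr, hβc⟩ := exists_feasible (r := r) (fun x => (hΔ x).1) htot hexc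
  have hβF : Feas r c Δ β := ⟨fun x => (hβ x).le, hβr, hβc⟩
  obtain ⟨α, hα⟩ := exists_maxFeas hβF
  have hpos := hα.pos hβF hβ (fun x => (hΔ x).2) hrow
  have hlt : ∀ x, α x < π := by
    intro x
    refine (hα.toFeas.le_pi x).lt_of_ne fun hx => ?_
    obtain ⟨z, hz, hzx, -⟩ := hrow x x
    exact (hpos z).ne' (hα.toFeas.eq_zero_of_pi hx hz hzx)
  exact ⟨α, fun x => ⟨hpos x, hlt x⟩, hα.row, hα.col,
    hα.exists_multipliers fun x => ⟨hpos x, hlt x⟩⟩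

end Maximum

end

section

variable {K : Finset (Finset Pt)} {Q : Finset Pt}

/-- The system of angles singled out by the variational problem attached to `K` and `Δ`. -/
lemma IsTriangulationOf.exists_angles (hK : IsTriangulationOf K Q) {Δ : Finset Pt → ℝ}
    (hΔ : ∀ e ∈ edgesOf K, 0 < Δ e ∧ Δ e ≤ π)
    (htot : ∑ e ∈ edgesOf K, Δ e = π * K.card)
    (hexc : ∀ S : Finset (Finset Pt), S ⊆ K → S.Nonempty → S ≠ K →
      π * S.card < ∑ e ∈ edgesOf S, Δ e) :
    ∃ θ : Pt × Pt × Pt → ℝ, (∀ x ∈ otri K, 0 < θ x ∧ θ x < π) ∧ RowPi K θ ∧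
      (∀ e ∈ edgesOf K, ∑ x ∈ otri K with oedge x = e, θ x = Δ e) ∧
      ∃ l m : Finset Pt → ℝ, ∀ x ∈ otri K,
        Real.log (Real.sin (θ x)) = l (verts x) + m (oedge x) := by
  let r : {x // x ∈ otri K} → Finset Pt := fun x => verts x.1
  let c : {x // x ∈ otri K} → Finset Pt := fun x => oedge x.1
  have hedge : ∀ S ⊆ K, (univ.filter fun x => r x ∈ S).image c = edgesOf S := by
    intro S hS
    ext e
    simp only [Finset.mem_image, Finset.mem_filter, Finset.mem_univ, true_and]
    constructor
    · rintro ⟨x, hx, rfl⟩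
      exact oedge_mem x.2 hx
    · intro he
      obtain ⟨x, hx, hxS, rfl⟩ := hK.exists_oedge hS he
      exact ⟨⟨x, hx⟩, hxS, rfl⟩
  have hr : univ.image r = K := by
    ext t
    simp only [Finset.mem_image, Finset.mem_univ, true_and]
    constructor
    · rintro ⟨x, rfl⟩
      exact (mem_otri.1 x.2).1
    · intro ht
      obtain ⟨x, hx, rfl⟩ := hK.exists_verts ht
      exact ⟨⟨x, hx⟩, rfl⟩
  have hc : univ.image c = edgesOf K := by
    rw [← hedge K subset_rfl]
    congr 1
    ext x
    simp only [Finset.mem_univ, Finset.mem_filter, true_and, true_iff]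
    exact (mem_otri.1 x.2).1
  obtain ⟨α, hα, hαr, hαc, l, m, hlm⟩ := exists_critical (r := r) (c := c) (Δ := Δ)
    (fun x => hΔ _ (oedge_mem x.2 (mem_otri.1 x.2).1))
    (by
      rintro ⟨⟨v, a, b⟩, hx⟩ y
      have h1 := otri_rot hx
      have h2 := otri_rot h1
      obtain ⟨d1, d2, d3⟩ := ne_of_ori (mem_otri.1 hx).2
      simp only at d1 d2 d3
      by_cases hy : y = ⟨_, h1⟩
      · refine ⟨⟨_, h2⟩, ?_, ?_, ?_⟩
        · simp only [r]; rw [verts_rot, verts_rot]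
        · intro h
          exact d2 (congrArg (fun z => z.1.1) h)
        · rw [hy]
          intro h
          exact d3 (congrArg (fun z => z.1.1) h).symm
      · refine ⟨⟨_, h1⟩, ?_, ?_, fun h => hy h.symm⟩
        · simp only [r]; rw [verts_rot]
        · intro h
          exact d1 (congrArg (fun z => z.1.1) h))
    (by
      convert htot using 2
      · convert hc
      · congr 2
        convert hr)
    (by
      intro S hS hne hS'
      have hSK : S ⊆ K := by convert hS; convert hr.symm
      have hne' : S ≠ K := by convert hS'; convert hr.symm
      convert hexc S hSK hne hne' using 2
      convert hedge S hSK)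
  let θ : Pt × Pt × Pt → ℝ := fun z => if h : z ∈ otri K then α ⟨z, h⟩ else 0
  have hθ : ∀ x (hx : x ∈ otri K), θ x = α ⟨x, hx⟩ := fun x hx => dif_pos hx
  have hsum : ∀ (g : Pt × Pt × Pt → Finset Pt) (e : Finset Pt),
      ∑ z ∈ otri K with g z = e, θ z = ∑ y : {x // x ∈ otri K} with g y.1 = e, α y := by
    intro g e
    rw [Finset.sum_filter, Finset.sum_filter, ← Finset.sum_coe_sort (otri K)]
    refine Finset.sum_congr rfl fun y _ => ?_
    by_cases hy : g y.1 = e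
    · rw [if_pos hy, if_pos hy, hθ _ y.2]
    · rw [if_neg hy, if_neg hy]
  refine ⟨θ, fun x hx => hθ x hx ▸ hα _, fun x hx => ?_, fun e he => ?_, l, m, fun x hx => ?_⟩
  · rw [← sum_row hx, hsum]
    convert hαr ⟨x, hx⟩
  · obtain ⟨x, hx, -, rfl⟩ := hK.exists_oedge subset_rfl he
    rw [hsum]
    convert hαc ⟨x, hx⟩
  · rw [hθ x hx]
    exact hlm ⟨x, hx⟩

end

section

variable {K : Finset (Finset Pt)} {Q : Finset Pt}

/-- A function on the corners of `K` with vanishing sums over the triangles and around the interior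
vertices is the difference of a function on the edges. -/
lemma IsTriangulationOf.exists_edge_rotation (hK : IsTriangulationOf K Q)
    (hcol : ¬ Collinear ℝ (Q : Set Pt)) {β : Pt × Pt × Pt → ℝ}
    (hrow : ∀ x ∈ otri K, β x + β (x.2.1, x.2.2, x.1) + β (x.2.2, x.1, x.2.1) = 0)
    (hinn : ∀ v ∈ Q, firsts (fan (otri K) v) ⊆ seconds (fan (otri K) v) →
      ∑ x ∈ fan (otri K) v, β x = 0) :
    ∃ ψ : Finset Pt → ℝ, ∀ v a b, (v, a, b) ∈ otri K → ψ {v, b} - ψ {v, a} = β (v, a, b) := by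
  have rot : ∀ v a b, (v, a, b) ∈ otri K → (a, b, v) ∈ otri K := fun _ _ _ h => otri_rot h
  have hβ0 : ∑ x ∈ otri K, β x = 0 := by
    have h3 := sum_rot_three rot β
    rw [Finset.sum_eq_zero hrow] at h3
    linarith
  let A : (Finset Pt → ℝ) →ₗ[ℝ] ({x // x ∈ otri K} → ℝ) :=
    { toFun := fun ψ i => ψ {i.1.1, i.1.2.2} - ψ {i.1.1, i.1.2.1}
      map_add' := fun ψ ψ' => by ext i; simp only [Pi.add_apply]; ring
      map_smul' := fun r ψ => by
        ext i; simp only [Pi.smul_apply, smul_eq_mul, RingHom.id_apply]; ring }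
  obtain ⟨ψ, hψ⟩ := exists_eq_of_orthogonal A (fun i => β i.1) (by
    intro y hy
    let Y : Pt × Pt × Pt → ℝ := fun z => if h : z ∈ otri K then y ⟨z, h⟩ else 0
    have hY : ∀ i : {x // x ∈ otri K}, y i = Y i.1 := fun i => by
      simp only [Y]; rw [dif_pos i.2]
    have horth : ∀ ψ : Finset Pt → ℝ,
        ∑ x ∈ otri K, (Y (x.2.1, x.2.2, x.1) - Y x) * ψ {x.1, x.2.1} = 0 := by
      intro ψ
      have h1 := hy ψ
      simp only [hY] at h1
      have h2 : ∑ x ∈ otri K, Y x * (ψ {x.1, x.2.2} - ψ {x.1, x.2.1}) = 0 := by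
        rw [← h1, ← Finset.sum_coe_sort (otri K)]
        rfl
      have h3 := card_filter_rot rot fun x => Y x * ψ {x.1, x.2.2}
      simp only at h3
      simp only [mul_sub, Finset.sum_sub_distrib] at h2
      simp only [sub_mul, Finset.sum_sub_distrib]
      rw [h3] at h2
      rw [← h2]
      congr 1
      refine Finset.sum_congr rfl fun x _ => ?_
      rw [Finset.pair_comm]
    let g : Pt × Pt × Pt → ℝ := fun x => Y (x.2.1, x.2.2, x.1) - Y x
    let c : Pt → Pt → ℝ := fun u w => ∑ x ∈ otri K with x.1 = u ∧ x.2.1 = w, g x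
    have hc : ∀ v a b, (v, a, b) ∈ otri K → c v a = g (v, a, b) := by
      intro v a b h
      refine Finset.sum_eq_single_of_mem _ (Finset.mem_filter.2 ⟨h, rfl, rfl⟩) ?_
      rintro ⟨v', a', b'⟩ hmem hne
      obtain ⟨hx, h1, h2⟩ := Finset.mem_filter.1 hmem
      simp only at h1 h2
      subst h1 h2
      exact absurd (by rw [hK.uniq hx h]) hne
    have hc0 : ∀ u w, (∀ b, (u, w, b) ∉ otri K) → c u w = 0 := by
      intro u w h
      refine Finset.sum_eq_zero ?_
      rintro ⟨v', a', b'⟩ hmem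
      obtain ⟨hx, h1, h2⟩ := Finset.mem_filter.1 hmem
      simp only at h1 h2
      subst h1 h2
      exact absurd hx (h _)
    have hanti : ∀ u w, c w u = -c u w := by
      intro u w
      by_cases huw : u = w
      · subst huw
        rw [hc0 u u fun b hb => (ne_of_ori (mem_otri.1 hb).2).1 rfl, neg_zero]
      have h1 := horth fun e => if e = {u, w} then 1 else 0
      have h2 : c u w + c w u = 0 := by
        rw [← h1]
        simp only [c, Finset.sum_filter]
        rw [← Finset.sum_add_distrib]
        refine Finset.sum_congr rfl fun x hx => ?_
        obtain ⟨v, a, b⟩ := x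
        have hne := (ne_of_ori (mem_otri.1 hx).2).1
        simp only at hne
        by_cases e1 : v = u ∧ a = w
        · obtain ⟨rfl, rfl⟩ := e1
          simp [huw, g]
        · by_cases e2 : v = w ∧ a = u
          · obtain ⟨rfl, rfl⟩ := e2
            simp [huw, g, Finset.pair_comm]
          · have e3 : ({v, a} : Finset Pt) ≠ {u, w} := by
              intro h
              have hv : v ∈ ({u, w} : Finset Pt) := h ▸ by simp
              have ha : a ∈ ({u, w} : Finset Pt) := h ▸ by simp
              simp only [Finset.mem_insert, Finset.mem_singleton] at hv ha
              rcases hv with rfl | rfl <;> rcases ha with rfl | rfl <;> simp_all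
            simp [e1, e2, e3]
      linarith
    obtain ⟨h, hh⟩ := hK.exists_potential (c := c) hanti (by
      intro v a b hx
      rw [hc _ _ _ hx, hc _ _ _ (rot _ _ _ hx), hc _ _ _ (rot _ _ _ (rot _ _ _ hx))]
      simp only [g]
      ring)
    obtain ⟨k, hk⟩ := hK.const_boundary hcol (h := h) (by
      intro u w b hx hno
      have h1 := hh u w ⟨b, Or.inl hx⟩
      have h2 := hanti w u
      rw [hc0 w u hno] at h2
      linarith)
    have hG : ∀ x ∈ otri K, Y (x.2.1, x.2.2, x.1) - h x.2.1 = Y x - h x.1 := by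
      rintro ⟨v, a, b⟩ hx
      have h1 := hh v a ⟨b, Or.inl hx⟩
      rw [hc _ _ _ hx] at h1
      simp only [g] at h1 ⊢
      linarith
    have s1 : ∑ x ∈ otri K, (Y x - h x.1) * β x = 0 := by
      have h3 := sum_rot_three rot fun x => (Y x - h x.1) * β x
      refine (mul_eq_zero.1 (h3.trans (Finset.sum_eq_zero ?_))).resolve_left (by norm_num)
      rintro ⟨v, a, b⟩ hx
      have e1 := hG _ hx
      have e2 := hG _ (rot _ _ _ hx)
      simp only at e1 e2 ⊢
      rw [e2, e1]
      linear_combination (Y (v, a, b) - h v) * hrow _ hx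
    have s2 : ∑ x ∈ otri K, (h x.1 - k) * β x = 0 := by
      rw [← sum_fan (Q := Q) (fun _ _ _ h => hK.mem_Q h)]
      refine Finset.sum_eq_zero fun v hv => ?_
      have e : ∑ x ∈ fan (otri K) v, (h x.1 - k) * β x =
          (h v - k) * ∑ x ∈ fan (otri K) v, β x := by
        rw [Finset.mul_sum]
        refine Finset.sum_congr rfl fun x hx => ?_
        rw [(mem_fan.1 hx).2]
      rw [e]
      by_cases hcl : firsts (fan (otri K) v) ⊆ seconds (fan (otri K) v)
      · rw [hinn v hv hcl, mul_zero]
      · rw [hk v hv hcl, sub_self, zero_mul]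
    have s3 : ∑ i : {x // x ∈ otri K}, y i * β i.1 = ∑ x ∈ otri K, Y x * β x := by
      rw [← Finset.sum_coe_sort (otri K)]
      exact Finset.sum_congr rfl fun i _ => by rw [hY]
    rw [s3]
    calc ∑ x ∈ otri K, Y x * β x = ∑ x ∈ otri K, (Y x - h x.1) * β x +
          ∑ x ∈ otri K, (h x.1 - k) * β x + k * ∑ x ∈ otri K, β x := by
          rw [Finset.mul_sum, ← Finset.sum_add_distrib, ← Finset.sum_add_distrib]
          exact Finset.sum_congr rfl fun _ _ => by ring
      _ = 0 := by rw [s1, s2, hβ0]; ring)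
  exact ⟨ψ, fun v a b h => congrFun hψ ⟨_, h⟩⟩

lemma dir_eq_dir_mul {v a b : Pt} (h : 0 < ori v a b) :
    (toC b - toC v) / ‖toC b - toC v‖ =
      (toC a - toC v) / ‖toC a - toC v‖ * Complex.exp (sang v a b * Complex.I) := by
  obtain ⟨h1, h2, -⟩ := ne_of_ori h
  have ha : toC a - toC v ≠ 0 := sub_ne_zero.2 fun h => h1 (toC_injective h)
  have hb : toC b - toC v ≠ 0 := sub_ne_zero.2 fun h => h2 (toC_injective h)
  have na : (‖toC a - toC v‖ : ℂ) ≠ 0 := by exact_mod_cast norm_ne_zero_iff.2 ha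
  have nb : (‖toC b - toC v‖ : ℂ) ≠ 0 := by exact_mod_cast norm_ne_zero_iff.2 hb
  have := Complex.norm_mul_exp_arg_mul_I ((toC b - toC v) / (toC a - toC v))
  rw [norm_div, Complex.ofReal_div] at this
  rw [sang]
  generalize Complex.exp _ = w at *
  field_simp at this ⊢
  linear_combination (-1 : ℂ) * this

lemma sin_sum_exp {x y s : ℝ} (h : s = Real.sin (x + y)) :
    (s : ℂ) - Real.sin x * Complex.exp (-(y * Complex.I)) -
      Real.sin y * Complex.exp (x * Complex.I) = 0 := by
  rw [h, Real.sin_add, ← neg_mul, ← Complex.ofReal_neg, Complex.exp_mul_I, Complex.exp_mul_I]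
  push_cast
  rw [Complex.cos_neg, Complex.sin_neg]
  ring

lemma arg_pos_mul_exp {r t : ℝ} (hr : 0 < r) (h0 : 0 < t) (h1 : t < π) :
    Complex.arg (r * Complex.exp (t * Complex.I)) = t := by
  rw [Complex.exp_mul_I]
  exact Complex.arg_mul_cos_add_sin_mul_I hr ⟨by linarith, h1.le⟩

/-- A system of angles satisfying the law of sines, with total angle `2π` at the interior vertices,
is realized by a development in the plane. -/
theorem IsTriangulationOf.exists_development (hK : IsTriangulationOf K Q)
    (hcol : ¬ Collinear ℝ (Q : Set Pt)) {θ : Pt × Pt × Pt → ℝ}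
    (hθ : ∀ x ∈ otri K, 0 < θ x ∧ θ x < π) (hrow : RowPi K θ)
    (hinn : ∀ v ∈ Q, firsts (fan (otri K) v) ⊆ seconds (fan (otri K) v) →
      ∑ x ∈ fan (otri K) v, θ x = 2 * π)
    {l m : Finset Pt → ℝ}
    (hlm : ∀ x ∈ otri K, Real.log (Real.sin (θ x)) = l (verts x) + m (oedge x)) :
    ∃ p : Pt → Pt, ∀ v a b, (v, a, b) ∈ otri K →
      0 < ori (p v) (p a) (p b) ∧ sang (p v) (p a) (p b) = θ (v, a, b) := by
  obtain ⟨ψ, hψ⟩ := hK.exists_edge_rotation hcol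
    (β := fun x => θ x - sang x.1 x.2.1 x.2.2)
    (fun x hx => by
      have h1 := hrow x hx
      have h2 := rowPi_sang K x hx
      simp only at h2 ⊢
      linarith)
    (fun v hv hc => by
      rw [Finset.sum_sub_distrib, hinn v hv hc]
      have := hK.angSum_closed hv hc
      simp only [angSum, id] at this
      rw [this, sub_self])
  let W : Pt → Pt → ℂ := fun a b => Complex.exp (m {a, b}) * Complex.exp (ψ {a, b} * Complex.I) *
    ((toC b - toC a) / ‖toC b - toC a‖)
  have hsin : ∀ x ∈ otri K, 0 < Real.sin (θ x) := fun x hx =>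
    Real.sin_pos_of_pos_of_lt_pi (hθ x hx).1 (hθ x hx).2
  have hsin' : ∀ x ∈ otri K, Real.sin (θ x) = Real.exp (l (verts x)) * Real.exp (m (oedge x)) := by
    intro x hx
    rw [← Real.exp_add, ← hlm x hx, Real.exp_log (hsin x hx)]
  have hW : ∀ v a b, (v, a, b) ∈ otri K → (Real.sin (θ (b, v, a)) : ℂ) * W v b =
      Real.sin (θ (a, b, v)) * Complex.exp (θ (v, a, b) * Complex.I) * W v a := by
    intro v a b hx
    have e0 := (mem_otri.1 hx).2
    have e1 := hsin' _ (otri_rot hx)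
    have e2 := hsin' _ (otri_rot (otri_rot hx))
    simp only [oedge, verts_rot] at e1 e2
    have e3 := hψ v a b hx
    simp only at e3
    have e4 : Complex.exp (θ (v, a, b) * Complex.I) * Complex.exp (ψ {v, a} * Complex.I) =
        Complex.exp (ψ {v, b} * Complex.I) * Complex.exp (sang v a b * Complex.I) := by
      rw [← Complex.exp_add, ← Complex.exp_add]
      congr 1
      have : θ (v, a, b) + ψ {v, a} = ψ {v, b} + sang v a b := by linarith
      have := congrArg (fun r : ℝ => (r : ℂ) * Complex.I) this
      simp only [Complex.ofReal_add] at this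
      linear_combination this
    simp only [W]
    rw [dir_eq_dir_mul e0, e1, e2, Finset.pair_comm b v]
    push_cast
    linear_combination (-Complex.exp (l (verts (v, a, b))) * Complex.exp (m {v, b}) *
      Complex.exp (m {v, a}) * ((toC a - toC v) / ‖toC a - toC v‖)) * e4
  have hanti : ∀ a b, W b a = -W a b := by
    intro a b
    simp only [W]
    rw [Finset.pair_comm b a, ← neg_sub (toC b) (toC a), norm_neg]
    ring
  have hclosed : ∀ v a b, (v, a, b) ∈ otri K → W v a + W a b + W b v = 0 := by
    intro v a b hx
    have h1 := hW v a b hx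
    have h2 := hW a b v (otri_rot hx)
    have hs := hsin _ (otri_rot (otri_rot hx))
    have hs' : (Real.sin (θ (b, v, a)) : ℂ) ≠ 0 := by exact_mod_cast hs.ne'
    have h3 : Real.sin (θ (b, v, a)) = Real.sin (θ (v, a, b) + θ (a, b, v)) := by
      have := hrow _ hx
      simp only at this
      rw [← Real.sin_pi_sub]
      congr 1
      linarith
    have h4 := sin_sum_exp h3
    have h5 : Complex.exp (-(θ (a, b, v) * Complex.I)) * Complex.exp (θ (a, b, v) * Complex.I) = 1 := by
      rw [← Complex.exp_add, neg_add_cancel, Complex.exp_zero]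
    rw [hanti v a] at h2
    rw [hanti v b]
    refine (mul_eq_zero.1 (?_ : (Real.sin (θ (b, v, a)) : ℂ) * _ = 0)).resolve_left hs'
    linear_combination W v a * h4 - h1 - Complex.exp (-(θ (a, b, v) * Complex.I)) * h2 -
      (Real.sin (θ (b, v, a)) : ℂ) * W a b * h5
  obtain ⟨f, hf⟩ := hK.exists_potential hanti hclosed
  refine ⟨fun q => ofC (f q), fun v a b hx => ?_⟩
  have hva : toC (ofC (f a)) - toC (ofC (f v)) = W v a := by
    rw [toC_ofC, toC_ofC, hf v a ⟨b, Or.inl hx⟩]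
  have hvb : toC (ofC (f b)) - toC (ofC (f v)) = W v b := by
    rw [toC_ofC, toC_ofC, hf v b ⟨a, Or.inr (otri_rot (otri_rot hx))⟩]
  have h0 : W v a ≠ 0 := by
    have hne : toC a - toC v ≠ 0 :=
      sub_ne_zero.2 fun h => (ne_of_ori (mem_otri.1 hx).2).1 (toC_injective h)
    have hn : (‖toC a - toC v‖ : ℂ) ≠ 0 := by exact_mod_cast norm_ne_zero_iff.2 hne
    exact mul_ne_zero (mul_ne_zero (Complex.exp_ne_zero _) (Complex.exp_ne_zero _))
      (div_ne_zero hne hn)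
  have hsb := hsin _ (otri_rot (otri_rot hx))
  have hsa := hsin _ (otri_rot hx)
  obtain ⟨t0, t1⟩ := hθ _ hx
  have hratio : W v b / W v a =
      ((Real.sin (θ (a, b, v)) / Real.sin (θ (b, v, a)) : ℝ) : ℂ) *
        Complex.exp (θ (v, a, b) * Complex.I) := by
    have hs' : (Real.sin (θ (b, v, a)) : ℂ) ≠ 0 := by exact_mod_cast hsb.ne'
    rw [Complex.ofReal_div, div_eq_iff h0]
    field_simp
    linear_combination hW v a b hx
  have hsang : sang (ofC (f v)) (ofC (f a)) (ofC (f b)) = θ (v, a, b) := by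
    rw [sang, hva, hvb, hratio, arg_pos_mul_exp (div_pos hsa hsb) t0 t1]
  refine ⟨?_, hsang⟩
  have him : 0 < (W v b / W v a).im := by
    rw [hratio, Complex.im_ofReal_mul, Complex.exp_ofReal_mul_I_im]
    exact mul_pos (div_pos hsa hsb) (hsin _ hx)
  rw [im_div_eq, ← hva, ← hvb, ← ori_eq_im] at him
  exact (div_pos_iff_of_pos_right (Complex.normSq_pos.2 (by rwa [hva]))).1 him

end

section

variable {K : Finset (Finset Pt)} {Q : Finset Pt} {p : Pt → Pt}

/-- The image of an ordered triangle. -/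
def mapTri (p : Pt → Pt) (x : Pt × Pt × Pt) : Pt × Pt × Pt := (p x.1, p x.2.1, p x.2.2)

lemma verts_mapTri (p : Pt → Pt) (x : Pt × Pt × Pt) :
    verts (mapTri p x) = (verts x).image p := by
  simp [verts, mapTri, Finset.image_insert]

lemma oedge_mapTri (p : Pt → Pt) (x : Pt × Pt × Pt) :
    oedge (mapTri p x) = (oedge x).image p := by
  simp [oedge, mapTri, Finset.image_insert]

lemma coe_image_verts (p : Pt → Pt) (y : Pt × Pt × Pt) :
    (((verts y).image p : Finset Pt) : Set Pt) = p '' (verts y : Set Pt) := Finset.coe_image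

lemma mapTri_mem (hpos : Pos (otri K) p) {x : Pt × Pt × Pt} (hx : x ∈ otri K) :
    mapTri p x ∈ otri (K.image (Finset.image p)) := by
  rw [mem_otri, verts_mapTri]
  exact ⟨Finset.mem_image_of_mem _ (mem_otri.1 hx).1, hpos x hx⟩

lemma IsTriangulationOf.otri_image (hK : IsTriangulationOf K Q) (hpos : Pos (otri K) p) :
    otri (K.image (Finset.image p)) = (otri K).image (mapTri p) := by
  ext y
  rw [Finset.mem_image]
  constructor
  · intro hy
    obtain ⟨t, ht, hty⟩ := Finset.mem_image.1 (mem_otri.1 hy).1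
    have h1 : y.1 ∈ t.image p := by rw [hty]; exact Finset.mem_insert_self _ _
    obtain ⟨v, hv, hvy⟩ := Finset.mem_image.1 h1
    obtain ⟨a, b, hx, rfl⟩ := hK.exists_orient ht hv
    exact ⟨_, hx, otri_ext (mapTri_mem hpos hx) hy (by rw [verts_mapTri, hty]) hvy⟩
  · rintro ⟨x, hx, rfl⟩
    exact mapTri_mem hpos hx

lemma IsTriangulationOf.mapTri_injOn (hK : IsTriangulationOf K Q) (hinj : Set.InjOn p (Q : Set Pt)) :
    Set.InjOn (mapTri p) (otri K : Set (Pt × Pt × Pt)) := by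
  rintro ⟨v, a, b⟩ hx ⟨v', a', b'⟩ hy h
  rw [Finset.mem_coe] at hx hy
  simp only [mapTri, Prod.mk.injEq] at h
  rw [hinj (hK.mem_Q hx) (hK.mem_Q hy) h.1,
    hinj (hK.mem_Q (otri_rot hx)) (hK.mem_Q (otri_rot hy)) h.2.1,
    hinj (hK.mem_Q (otri_rot (otri_rot hx))) (hK.mem_Q (otri_rot (otri_rot hy))) h.2.2]

/-- A development of a triangulation is a triangulation. -/
lemma IsTriangulationOf.image (hK : IsTriangulationOf K Q) (hne : K.Nonempty)
    (h : Devel Q (otri K) p) : IsTriangulationOf (K.image (Finset.image p)) (Q.image p) := by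
  have hO : (otri K).Nonempty := by
    obtain ⟨t, ht⟩ := hne
    obtain ⟨x, hx, -⟩ := hK.exists_verts ht
    exact ⟨x, hx⟩
  refine ⟨?_, ?_, ?_, ?_, ?_, ?_⟩
  · intro t' ht'
    obtain ⟨t, ht, rfl⟩ := Finset.mem_image.1 ht'
    rw [Finset.card_image_of_injOn (h.injOn.mono (Finset.coe_subset.2 (hK.subset t ht))),
      hK.card3 t ht]
  · intro t' ht'
    obtain ⟨t, ht, rfl⟩ := Finset.mem_image.1 ht'
    exact Finset.image_subset_image (hK.subset t ht)
  · intro t' ht'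
    obtain ⟨t, ht, rfl⟩ := Finset.mem_image.1 ht'
    obtain ⟨x, hx, rfl⟩ := hK.exists_verts ht
    exact indep_of_ori (h.pos x hx).ne' (verts_mapTri p x).symm
  · ext w
    simp only [Set.mem_iUnion, exists_prop]
    constructor
    · rintro ⟨t', ht', hw⟩
      obtain ⟨t, ht, rfl⟩ := Finset.mem_image.1 ht'
      exact convexHull_mono (Finset.coe_subset.2 (Finset.image_subset_image (hK.subset t ht))) hw
    · intro hw
      rw [Finset.coe_image] at hw
      obtain ⟨y, hy, hwy⟩ := h.cover hO hw
      refine ⟨_, Finset.mem_image_of_mem _ (mem_otri.1 hy).1, ?_⟩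
      rw [coe_image_verts]
      exact (h.inClosed_iff hy w).1 hwy
  · intro t' ht' s' hs' hne'
    obtain ⟨t, ht, rfl⟩ := Finset.mem_image.1 ht'
    obtain ⟨s, hs, rfl⟩ := Finset.mem_image.1 hs'
    obtain ⟨x, hx, rfl⟩ := hK.exists_verts ht
    obtain ⟨y, hy, rfl⟩ := hK.exists_verts hs
    refine Set.Subset.antisymm ?_ ?_
    · rintro w ⟨h1, h2⟩
      rw [coe_image_verts, ← h.inClosed_iff hx] at h1
      rw [coe_image_verts, ← h.inClosed_iff hy] at h2
      refine convexHull_mono ?_ (h.inter hx hy h1 h2)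
      rintro _ ⟨u, hu, rfl⟩
      obtain ⟨hu1, hu2⟩ := Finset.mem_inter.1 hu
      exact Finset.mem_coe.2 (Finset.mem_inter.2
        ⟨Finset.mem_image_of_mem _ hu1, Finset.mem_image_of_mem _ hu2⟩)
    · exact Set.subset_inter (convexHull_mono (Finset.coe_subset.2 Finset.inter_subset_left))
        (convexHull_mono (Finset.coe_subset.2 Finset.inter_subset_right))
  · intro q' hq'
    obtain ⟨q, hq, rfl⟩ := Finset.mem_image.1 hq'
    obtain ⟨t, ht, hqt⟩ := hK.vertex q hq
    exact ⟨_, Finset.mem_image_of_mem _ ht, Finset.mem_image_of_mem _ hqt⟩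

/-- A locally Delaunay development is Delaunay. -/
lemma IsTriangulationOf.emptyCircumdisk_image (hK : IsTriangulationOf K Q)
    (h : Devel Q (otri K) p) (hloc : LocDel (otri K) p) :
    EmptyCircumdisk (K.image (Finset.image p)) (Q.image p) := by
  intro t' ht' z r hr q' hq'
  obtain ⟨t, ht, rfl⟩ := Finset.mem_image.1 ht'
  obtain ⟨q, hq, rfl⟩ := Finset.mem_image.1 hq'
  obtain ⟨x, hx, rfl⟩ := hK.exists_verts ht
  have h0 := h.pow3_nonneg hloc hx hq
  have hd : ∀ u ∈ verts x, dist z (p u) = r := fun u hu => hr _ (Finset.mem_image_of_mem _ hu)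
  rw [pow3_eq_dist (h.pos x hx).ne' (hd _ (by simp [verts])) (hd _ (by simp [verts]))
    (hd _ (by simp [verts]))] at h0
  exact le_of_sq_le_sq (by linarith) dist_nonneg

lemma IsTriangulationOf.dihedral_image (hK : IsTriangulationOf K Q) (hne : K.Nonempty)
    (h : Devel Q (otri K) p) {e : Finset Pt} (he : e ∈ edgesOf K) :
    dihedral (K.image (Finset.image p)) (e.image p) =
      ∑ x ∈ otri K with oedge x = e, sang (p x.1) (p x.2.1) (p x.2.2) := by
  have hiso : IsIso K (K.image (Finset.image p)) Q p := ⟨h.injOn, hK.subset, rfl⟩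
  rw [(hK.image hne h).dihedral_eq (by rw [hiso.edges]; exact Finset.mem_image_of_mem _ he),
    hK.otri_image h.pos, Finset.sum_filter, Finset.sum_image (hK.mapTri_injOn h.injOn),
    Finset.sum_filter]
  refine Finset.sum_congr rfl fun x hx => ?_
  have hiff : oedge (mapTri p x) = e.image p ↔ oedge x = e := by
    rw [oedge_mapTri]
    exact ⟨fun h' => hiso.image_inj (hiso.edge_sub (oedge_mem hx (mem_otri.1 hx).1))
      (hiso.edge_sub he) h', fun h' => by rw [h']⟩
  simp only [hiff]
  rfl

lemma IsTriangulationOf.bdryAngle_image (hK : IsTriangulationOf K Q) (hne : K.Nonempty)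
    (h : Devel Q (otri K) p) {q : Pt} (hq : q ∈ Q) :
    bdryAngle (K.image (Finset.image p)) (p q) = angSum (fan (otri K) q) p := by
  rw [(hK.image hne h).bdryAngle_eq, angSum, angSum, fan, fan, hK.otri_image h.pos,
    Finset.sum_filter, Finset.sum_image (hK.mapTri_injOn h.injOn), Finset.sum_filter]
  refine Finset.sum_congr rfl fun x hx => ?_
  have hiff : (mapTri p x).1 = p q ↔ x.1 = q :=
    ⟨fun h' => h.injOn (hK.mem_Q hx) hq h', fun h' => by rw [← h']; rfl⟩
  simp only [hiff]
  rfl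

/-- The angle conditions are sufficient. -/
theorem sufficiency (hK : IsTriangulationOf K Q) (hcol : ¬ Collinear ℝ (Q : Set Pt))
    {Δ : Finset Pt → ℝ} {Λ : Pt → ℝ} (hΔ : ∀ e ∈ edgesOf K, 0 < Δ e ∧ Δ e ≤ π)
    (hΛ : ∀ q ∈ Q, q ∈ frontier (convexHull ℝ (Q : Set Pt)) → 0 < Λ q ∧ Λ q ≤ π)
    (h1 : ∀ q ∈ Q, q ∉ frontier (convexHull ℝ (Q : Set Pt)) →
        ∑ e ∈ (edgesOf K).filter (fun e => q ∈ e), (π - Δ e) = 2 * π)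
    (h2 : ∀ q ∈ Q, q ∈ frontier (convexHull ℝ (Q : Set Pt)) →
        (∑ e ∈ (edgesOf K).filter (fun e => q ∈ e), (π - Δ e)) + (π - Λ q) = 2 * π)
    (h3 : ∑ q ∈ Q.filter (fun q => q ∈ frontier (convexHull ℝ (Q : Set Pt))), (π - Λ q)
        = 2 * π)
    (h4 : ∀ S : Finset (Finset Pt), S ⊆ K → S.Nonempty → S ≠ K →
        π * S.card < ∑ e ∈ edgesOf S, Δ e) :
    ∃ p : Pt → Pt, IsDelaunay (K.image (Finset.image p)) (Q.image p) ∧ Set.InjOn p (Q : Set Pt) ∧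
      (∀ e ∈ edgesOf K, dihedral (K.image (Finset.image p)) (e.image p) = Δ e) ∧
      ∀ q ∈ Q, q ∈ frontier (convexHull ℝ (Q : Set Pt)) →
        bdryAngle (K.image (Finset.image p)) (p q) = Λ q := by
  have hne : K.Nonempty := by
    rw [Finset.nonempty_iff_ne_empty]
    rintro rfl
    refine hcol ?_
    have : Q = ∅ := by
      rw [Finset.eq_empty_iff_forall_notMem]
      intro q hq
      obtain ⟨t, ht, -⟩ := hK.vertex q hq
      simp at ht
    rw [this, Finset.coe_empty]
    exact collinear_empty ℝ Pt
  obtain ⟨θ, hθ, hrow, hcolumn, l, m, hlm⟩ := hK.exists_angles hΔ (hK.total hcol h1 h2 h3) h4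
  have hat := hK.sum_edges_at hcol hrow hcolumn
  have hinn : ∀ v ∈ Q, firsts (fan (otri K) v) ⊆ seconds (fan (otri K) v) →
      ∑ x ∈ fan (otri K) v, θ x = 2 * π := by
    intro v hv hc
    have h5 := hat v
    rw [if_pos hc, h1 v hv (by rw [hK.frontier_iff hv]; exact not_not.2 hc)] at h5
    linarith
  have hbd : ∀ v ∈ Q, v ∈ frontier (convexHull ℝ (Q : Set Pt)) →
      ∑ x ∈ fan (otri K) v, θ x = Λ v := by
    intro v hv hf
    have h5 := hat v
    rw [if_neg ((hK.frontier_iff hv).1 hf)] at h5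
    linarith [h2 v hv hf]
  obtain ⟨p, hp⟩ := hK.exists_development hcol hθ hrow hinn hlm
  have hang : ∀ q, angSum (fan (otri K) q) p = ∑ x ∈ fan (otri K) q, θ x := fun q =>
    Finset.sum_congr rfl fun x hx => (hp _ _ _ (mem_fan.1 hx).1).2
  have hdev : Devel Q (otri K) p :=
    ⟨hK.disk hcol, fun x hx => (hp _ _ _ hx).1, fun v hv hc => (hang v).trans (hinn v hv hc),
      fun v hv hc => by
        have hf := (hK.frontier_iff hv).2 hc
        rw [hang, hbd v hv hf]
        exact (hΛ v hv hf).2⟩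
  have hloc : LocDel (otri K) p := by
    intro v a b w hx hy
    rw [(hp _ _ _ hx).2, (hp _ _ _ hy).2]
    have he := oedge_mem hx (mem_otri.1 hx).1
    refine le_trans ?_ (hΔ _ he).2
    rw [← hcolumn _ he, ← Finset.sum_pair]
    · refine Finset.sum_le_sum_of_subset_of_nonneg ?_ fun x hx' _ =>
        (hθ x (Finset.mem_filter.1 hx').1).1.le
      intro x hx'
      rw [Finset.mem_insert, Finset.mem_singleton] at hx'
      rcases hx' with rfl | rfl
      · exact Finset.mem_filter.2 ⟨hx, rfl⟩
      · exact Finset.mem_filter.2 ⟨hy, Finset.pair_comm _ _⟩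
    · intro h
      exact (ne_of_ori (mem_otri.1 hx).2).2.2 (congrArg (fun x => x.2.1) h)
  refine ⟨p, ⟨hK.image hne hdev, hK.emptyCircumdisk_image hdev hloc⟩, hdev.injOn,
    fun e he => ?_, fun q hq hf => ?_⟩
  · rw [hK.dihedral_image hne hdev he, ← hcolumn e he]
    exact Finset.sum_congr rfl fun x hx => (hp _ _ _ (Finset.mem_filter.1 hx).1).2
  · rw [hK.bdryAngle_image hne hdev hq, hang, hbd q hq hf]

end

/-- **Theorem 5.1 (characterization of planar Delaunay triangulations).** Let `K` be a
triangulation of the convex polygon `conv(Q)` with vertex set `Q` (not all collinear),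
`Δ` an assignment of values in `(0, π]` to the edges of `K` and `Λ` an assignment of
values in `(0, π]` to the boundary vertices of `K`. Then `K` can be realized, via a
vertex bijection `φ`, as a Delaunay triangulation of a planar point set with dihedral
angles `Δ` and boundary angles `Λ` if and only if the vertex angle conditions (1), (2),
the total angle condition (3) and the positive-excess condition (4) hold. -/
theorem delaunay_realization_iff
    (Q : Finset Pt) (K : Finset (Finset Pt))
    (hcol : ¬ Collinear ℝ (Q : Set Pt))
    (hK : IsTriangulationOf K Q)
    (Δ : Finset Pt → ℝ) (Λ : Pt → ℝ)
    (hΔ : ∀ e ∈ edgesOf K, 0 < Δ e ∧ Δ e ≤ π)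
    (hΛ : ∀ q ∈ Q, q ∈ frontier (convexHull ℝ (Q : Set Pt)) → 0 < Λ q ∧ Λ q ≤ π) :
    (∃ (P : Finset Pt) (D : Finset (Finset Pt)) (φ : Pt → Pt),
      IsDelaunay D P ∧
      Set.BijOn φ (Q : Set Pt) (P : Set Pt) ∧
      (∀ a b c : Pt, a ∈ Q → b ∈ Q → c ∈ Q →
        (({a, b, c} : Finset Pt) ∈ K ↔ ({φ a, φ b, φ c} : Finset Pt) ∈ D)) ∧
      (∀ e ∈ edgesOf K, dihedral D (e.image φ) = Δ e) ∧
      (∀ q ∈ Q, q ∈ frontier (convexHull ℝ (Q : Set Pt)) → bdryAngle D (φ q) = Λ q))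
    ↔
    ((∀ q ∈ Q, q ∉ frontier (convexHull ℝ (Q : Set Pt)) →
        ∑ e ∈ (edgesOf K).filter (fun e => q ∈ e), (π - Δ e) = 2 * π) ∧
     (∀ q ∈ Q, q ∈ frontier (convexHull ℝ (Q : Set Pt)) →
        (∑ e ∈ (edgesOf K).filter (fun e => q ∈ e), (π - Δ e)) + (π - Λ q) = 2 * π) ∧
     (∑ q ∈ Q.filter (fun q => q ∈ frontier (convexHull ℝ (Q : Set Pt))), (π - Λ q)
        = 2 * π) ∧
     (∀ S : Finset (Finset Pt), S ⊆ K → S.Nonempty → S ≠ K →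
        π * S.card < ∑ e ∈ edgesOf S, Δ e)) := by
  constructor
  · rintro ⟨P, D, φ, hD, hφ, htri, hdih, hbd⟩
    exact necessity hK hcol hD.1 hφ (isIso_of_bijOn hK hD.1 hφ htri) hdih hbd
  · rintro ⟨h1, h2, h3, h4⟩
    obtain ⟨p, hD, hinj, hdih, hbd⟩ := sufficiency hK hcol hΔ hΛ h1 h2 h3 h4
    refine ⟨_, _, p, hD, ?_, fun a b c ha hb hc => ?_, hdih, hbd⟩
    · rw [Finset.coe_image]
      exact hinj.bijOn_image
    · have hiso : IsIso K (K.image (Finset.image p)) Q p := ⟨hinj, hK.subset, rfl⟩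
      have himg : ({p a, p b, p c} : Finset Pt) = ({a, b, c} : Finset Pt).image p := by
        simp [Finset.image_insert]
      have hsub : ({a, b, c} : Finset Pt) ⊆ Q := by
        intro x
        simp only [Finset.mem_insert, Finset.mem_singleton]
        rintro (rfl | rfl | rfl) <;> assumption
      rw [himg, Finset.mem_image]
      refine ⟨fun h => ⟨_, h, rfl⟩, ?_⟩
      rintro ⟨t, ht, hte⟩
      rwa [← hiso.image_inj (hK.subset t ht) hsub hte]

end
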